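/- arXiv:2110.07779 — 4 statements merged into one kernel-verified Lean document; each statement's English description precedes it below -/
import Mathlib

section
/- Let n ≥ m ≥ 1 and p ≥ 1 be integers with n ≥ p + 1, and set c = 2p+1. Every 2-coloring of the edges of the complete graph on 2(n+m+p) − 1 vertices in which every vertex v satisfies red-d(v) ≤ 2n + m − 2 and blue-d(v) ≤ 2n + m − 2 contains a monochromatic copy of S_c(n,m). -/
open SimpleGraph

/-- The relation generating the edges of the linked double star `S_c(n,m)`:
vertices are `a_1, …, a_c` (the link, modelled by `Fin c`), the spokes
`v_1, …, v_n` of the `n`-star at `a_1` (modelled by `Fin n`), and the spokes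
`w_1, …, w_m` of the `m`-star at `a_c` (modelled by `Fin m`). -/
def ldsRel (c n m : ℕ) : (Fin c ⊕ Fin n ⊕ Fin m) → (Fin c ⊕ Fin n ⊕ Fin m) → Prop
  | Sum.inl i, Sum.inl j => (j : ℕ) = (i : ℕ) + 1
  | Sum.inl i, Sum.inr (Sum.inl _) => (i : ℕ) = 0
  | Sum.inl i, Sum.inr (Sum.inr _) => (i : ℕ) = c - 1
  | _, _ => False

/-- The linked double star `S_c(n,m)`. -/
def LinkedDoubleStar (c n m : ℕ) : SimpleGraph (Fin c ⊕ Fin n ⊕ Fin m) :=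
  SimpleGraph.fromRel (ldsRel c n m)

/-- `G` contains a (not necessarily induced) subgraph isomorphic to `H`. -/
def HasCopy {α β : Type*} (H : SimpleGraph α) (G : SimpleGraph β) : Prop :=
  ∃ f : α → β, Function.Injective f ∧ ∀ ⦃a b⦄, H.Adj a b → G.Adj (f a) (f b)

/-- A 2-coloring of the complete graph on `β` is encoded by the graph `G` of red
edges (so `Gᶜ` is the graph of blue edges).  `HasMonoLDS G c n m` says this
coloring contains a monochromatic copy of `S_c(n,m)`. -/
def HasMonoLDS {β : Type*} (G : SimpleGraph β) (c n m : ℕ) : Prop :=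
  HasCopy (LinkedDoubleStar c n m) G ∨ HasCopy (LinkedDoubleStar c n m) Gᶜ

/-- Every 2-coloring of the edges of `K_r` contains a monochromatic `S_c(n,m)`. -/
def IsRamseyLDS (c n m r : ℕ) : Prop :=
  ∀ G : SimpleGraph (Fin r), HasMonoLDS G c n m

/-- The Ramsey number of the linked double star `S_c(n,m)`: the least positive
`r` such that every 2-coloring of the edges of `K_r` contains a monochromatic
copy of `S_c(n,m)`. -/
noncomputable def ramseyLDS (c n m : ℕ) : ℕ :=
  sInf {r | 0 < r ∧ IsRamseyLDS c n m r}

/-- `f` exhibits a cycle on `L` vertices in `G` (the vertices `f 0, f 1, …`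
arranged cyclically, consecutive ones adjacent in `G`). -/
def IsCycleMap {β : Type*} {L : ℕ} (G : SimpleGraph β) (f : ZMod L → β) : Prop :=
  Function.Injective f ∧ ∀ i : ZMod L, G.Adj (f i) (f (i + 1))

/-- For a monochromatic cycle with vertex set `C`, all of whose edges have the
color given by the graph `H`, `cycStat H C` is the maximum over vertices
`z ∉ C` of the number of `H`-edges from `z` into `C` (denoted `s(C)`). -/
noncomputable def cycStat {β : Type*} (H : SimpleGraph β) (C : Set β) : ℕ :=
  sSup ((fun z => ({w ∈ C | H.Adj z w}).ncard) '' Cᶜ)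

section LDSProof

set_option linter.unusedSectionVars false

open Classical in
theorem lds_emb {V : Type*} (G : SimpleGraph V) (n m : ℕ) (l : List V)
    (nd : l.Nodup) (ch : l.IsChain G.Adj) (x y : V) (hx : l.head? = some x)
    (hy : l.getLast? = some y) (P Q : Finset V) (hP : P.card = n) (hQ : Q.card = m)
    (hPQ : Disjoint P Q) (hPl : ∀ v ∈ P, v ∉ l) (hQl : ∀ v ∈ Q, v ∉ l)
    (hPx : ∀ v ∈ P, G.Adj x v) (hQy : ∀ v ∈ Q, G.Adj y v) :
    HasCopy (LinkedDoubleStar l.length n m) G := by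
  let e := P.equivFinOfCardEq hP
  let g := Q.equivFinOfCardEq hQ
  have hP' : ∀ i, ((e.symm i : P) : V) ∈ P := fun i => (e.symm i).2
  have hQ' : ∀ i, ((g.symm i : Q) : V) ∈ Q := fun i => (g.symm i).2
  have hd : ∀ a ∈ P, ∀ b ∈ Q, a ≠ b := fun a ha b hb h =>
    (Finset.disjoint_left.1 hPQ ha) (h ▸ hb)
  refine ⟨Sum.elim (fun i => l[i]) (Sum.elim (fun i => ((e.symm i : P) : V))
    (fun i => ((g.symm i : Q) : V))), ?_, ?_⟩
  · rintro (i | i | i) (j | j | j) h <;> simp only [Sum.elim_inl, Sum.elim_inr] at h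
    · have := (List.Nodup.getElem_inj_iff nd).1 h
      rw [Fin.ext this]
    · exact absurd (h ▸ List.getElem_mem _) (hPl _ (hP' j))
    · exact absurd (h ▸ List.getElem_mem _) (hQl _ (hQ' j))
    · exact absurd (h ▸ List.getElem_mem _) (hPl _ (hP' i))
    · have := e.symm.injective (Subtype.ext h)
      rw [this]
    · exact absurd h (hd _ (hP' i) _ (hQ' j))
    · exact absurd (h ▸ List.getElem_mem _) (hQl _ (hQ' i))
    · exact absurd h.symm (hd _ (hP' j) _ (hQ' i))
    · have := g.symm.injective (Subtype.ext h)
      rw [this]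
  · have key : ∀ a b, ldsRel l.length n m a b → G.Adj
        (Sum.elim (fun i : Fin l.length => l[i]) (Sum.elim (fun i => ((e.symm i : P) : V))
          (fun i => ((g.symm i : Q) : V))) a)
        (Sum.elim (fun i : Fin l.length => l[i]) (Sum.elim (fun i => ((e.symm i : P) : V))
          (fun i => ((g.symm i : Q) : V))) b) := by
      rintro (i | i | i) (j | j | j) h <;> simp only [ldsRel] at h
      · simp only [Sum.elim_inl]
        have := ch.getElem i.1 (by have := j.2; omega)
        simpa [h] using this
      · simp only [Sum.elim_inl, Sum.elim_inr]
        have : l[i] = x := by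
          have h2 := hx
          rw [List.head?_eq_getElem?] at h2
          have := List.getElem?_eq_some_iff.1 h2
          obtain ⟨h3, h4⟩ := this
          simpa [h] using h4
        rw [this]; exact hPx _ (hP' j)
      · simp only [Sum.elim_inl, Sum.elim_inr]
        have : l[i] = y := by
          have h2 := hy
          rw [List.getLast?_eq_getElem?] at h2
          have := List.getElem?_eq_some_iff.1 h2
          obtain ⟨h3, h4⟩ := this
          simpa [h] using h4
        rw [this]; exact hQy _ (hQ' j)
    intro a b h
    rcases (SimpleGraph.fromRel_adj _ _ _).1 h with ⟨_, h | h⟩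
    · exact key _ _ h
    · exact (key _ _ h).symm

variable {V : Type*} [DecidableEq V]

/-- number of vertices of `B` on the list -/
def cB (B : Finset V) (l : List V) : ℕ := l.countP (· ∈ B)

/-- number of links of the list with both ends in `B` -/
def dBB (B : Finset V) : List V → ℕ
  | a :: b :: l => (if a ∈ B ∧ b ∈ B then 1 else 0) + dBB B (b :: l)
  | _ => 0

@[simp] theorem cB_nil (B : Finset V) : cB B [] = 0 := rfl
@[simp] theorem cB_cons (B : Finset V) (a : V) (l : List V) :
    cB B (a :: l) = (if a ∈ B then 1 else 0) + cB B l := by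
  simp [cB, List.countP_cons, add_comm]
@[simp] theorem cB_append (B : Finset V) (l l' : List V) :
    cB B (l ++ l') = cB B l + cB B l' := by
  simp [cB]
@[simp] theorem cB_reverse (B : Finset V) (l : List V) : cB B l.reverse = cB B l := by
  simp [cB]

theorem count_lemma (B : Finset V) (R : V → V → Prop) (hR : ∀ u v, R u v → u ∈ B ∨ v ∈ B)
    (a : V) (l : List V) (ch : (a :: l).IsChain R) :
    (a :: l).length + dBB B (a :: l) + (if a ∈ B then 1 else 0)
      + (if (a :: l).getLast (by simp) ∈ B then 1 else 0) = 2 * cB B (a :: l) + 1 := by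
  induction l generalizing a with
  | nil => by_cases ha : a ∈ B <;> simp [dBB, ha]
  | cons b l ih =>
    rw [List.isChain_cons_cons] at ch
    have h1 := ih b ch.2
    have h2 := hR _ _ ch.1
    rw [List.getLast_cons (by simp)]
    simp only [List.length_cons, dBB, cB_cons] at h1 ⊢
    by_cases ha : a ∈ B <;> by_cases hb : b ∈ B <;> simp_all <;> omega

theorem prefix_lemma (B : Finset V) (k : ℕ) (hk : 1 ≤ k) (l : List V) (h : k ≤ cB B l) :
    ∃ W b R, l = W ++ b :: R ∧ b ∈ B ∧ cB B W + 1 = k := by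
  induction l generalizing k with
  | nil => simp at h; omega
  | cons a l ih =>
    by_cases ha : a ∈ B
    · rcases Nat.lt_or_ge 1 k with h1 | h1
      · obtain ⟨W, b, R, h2, h3, h4⟩ := ih (k - 1) (by omega) (by simp [ha] at h; omega)
        exact ⟨a :: W, b, R, by simp [h2], h3, by simp [ha]; omega⟩
      · exact ⟨[], a, l, rfl, ha, by simp; omega⟩
    · obtain ⟨W, b, R, h2, h3, h4⟩ := ih k hk (by simpa [ha] using h)
      exact ⟨a :: W, b, R, by simp [h2], h3, by simp [ha]; omega⟩

/-- nonempty path with both ends in `B` -/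
structure BP (H : SimpleGraph V) (B : Finset V) (l : List V) : Prop where
  ne : l ≠ []
  nd : l.Nodup
  ch : l.IsChain H.Adj
  hd : ∀ y ∈ l.head?, y ∈ B
  lt : ∀ y ∈ l.getLast?, y ∈ B

theorem BP.rev {H : SimpleGraph V} {B : Finset V} {l : List V} (h : BP H B l) :
    BP H B l.reverse := by
  refine ⟨by simpa using h.ne, by simpa using h.nd, ?_, by simpa using h.lt, by simpa using h.hd⟩
  rw [List.isChain_reverse]
  exact h.ch.imp fun a b hab => hab.symm

theorem BP.count {H : SimpleGraph V} {B : Finset V} {l : List V} (h : BP H B l)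
    (hH : ∀ u v, H.Adj u v → u ∈ B ∨ v ∈ B) : l.length + dBB B l + 1 = 2 * cB B l := by
  obtain ⟨ne, nd, ch, hd, lt⟩ := h
  cases l with
  | nil => simp at ne
  | cons a l =>
    have h1 := count_lemma B H.Adj hH a l ch
    have h2 := hd a (by simp)
    have h3 := lt _ (by rw [List.getLast?_eq_getLast_of_ne_nil (by simp)]; rfl)
    simp only [h2, h3, if_true] at h1
    omega

theorem BP.pre {H : SimpleGraph V} {B : Finset V} {l : List V} (k : ℕ) (hk : 1 ≤ k)
    (nd : l.Nodup) (ch : l.IsChain H.Adj) (hd : ∀ y ∈ l.head?, y ∈ B) (h : k ≤ cB B l) :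
    ∃ W, W <+: l ∧ BP H B W ∧ cB B W = k := by
  obtain ⟨W, b, R, h2, h3, h4⟩ := prefix_lemma B k hk l h
  have e : l = (W ++ [b]) ++ R := by simp [h2]
  refine ⟨W ++ [b], ⟨R, e.symm⟩, ⟨by simp, ?_, ?_, ?_, ?_⟩, by simp [h3]; omega⟩
  · rw [e] at nd; exact (List.nodup_append.1 nd).1
  · rw [e] at ch; exact (List.isChain_append.1 ch).1
  · intro y hy; apply hd; rw [e]
    cases W <;> simp_all
  · simp [h3]

theorem getLast?_app_cons (L M : List V) (a : V) :
    (L ++ a :: M).getLast? = (a :: M).getLast? := by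
  rw [List.getLast?_append]; simp [List.getLast?_cons]

theorem chain_of_split (R : V → V → Prop) (l : List V)
    (h : ∀ L1 u w L2, l = L1 ++ u :: w :: L2 → R u w) : l.IsChain R := by
  induction l with
  | nil => simp
  | cons a l ih =>
    cases l with
    | nil => simp
    | cons b l =>
      rw [List.isChain_cons_cons]
      refine ⟨h [] a b l rfl, ih fun L1 u w L2 e => h (a :: L1) u w L2 (by simp [e])⟩

theorem card_le_countP (X : Finset V) (l : List V) (q : V → Prop) [DecidablePred q]
    (h : ∀ x ∈ X, x ∈ l ∧ q x) : X.card ≤ l.countP q := by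
  rw [List.countP_eq_length_filter]
  refine le_trans (Finset.card_le_card ?_) (List.toFinset_card_le _)
  intro x hx
  simpa using h x hx

theorem pair_count (B X Y : Finset V) (l : List V)
    (h : l.IsChain fun u w => (w ∈ X → u ∈ B ∧ w ∈ B) ∧ (u ∈ Y → u ∈ B ∧ w ∈ B) ∧
      ¬ (w ∈ X ∧ u ∈ Y)) :
    l.tail.countP (· ∈ X) + l.dropLast.countP (· ∈ Y) ≤ dBB B l := by
  induction l with
  | nil => simp
  | cons a l ih =>
    cases l with
    | nil => simp
    | cons b l =>
      rw [List.isChain_cons_cons] at h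
      have h1 := ih h.2
      obtain ⟨⟨h2, h3, h4⟩, -⟩ := h
      simp only [List.tail_cons, List.dropLast_cons_cons, List.countP_cons, dBB] at h1 ⊢
      by_cases hb : b ∈ X <;> by_cases ha : a ∈ Y <;> simp_all <;> omega

section LemE

variable (H : SimpleGraph V) [DecidableRel H.Adj] (B : Finset V)

/-- the weight function of the density argument -/
def fE (U : Finset V) : ℕ := ∑ b ∈ U.filter (· ∈ B), ((U.filter (H.Adj b)).card + 1)

theorem fE_loss (U S : Finset V) (hS : S ⊆ U) :
    fE H B U ≤ fE H B (U \ S) + ∑ b ∈ S.filter (· ∈ B), ((U.filter (H.Adj b)).card + 1)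
      + ∑ s ∈ S, (((U \ S).filter (· ∈ B)).filter (H.Adj s)).card := by
  have e1 : U.filter (· ∈ B) = (U \ S).filter (· ∈ B) ∪ S.filter (· ∈ B) := by
    rw [← Finset.filter_union, Finset.sdiff_union_of_subset hS]
  have dj : Disjoint ((U \ S).filter (· ∈ B)) (S.filter (· ∈ B)) :=
    Finset.disjoint_filter_filter Finset.sdiff_disjoint
  have e2 : ∀ b, (U.filter (H.Adj b)).card
      = ((U \ S).filter (H.Adj b)).card + (S.filter (H.Adj b)).card := by
    intro b
    rw [← Finset.card_union_of_disjoint (Finset.disjoint_filter_filter Finset.sdiff_disjoint),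
      ← Finset.filter_union, Finset.sdiff_union_of_subset hS]
  have e3 : ∑ s ∈ S, (((U \ S).filter (· ∈ B)).filter (H.Adj s)).card
      = ∑ b ∈ (U \ S).filter (· ∈ B), (S.filter (H.Adj b)).card := by
    have := Finset.sum_card_bipartiteAbove_eq_sum_card_bipartiteBelow (s := S)
      (t := (U \ S).filter (· ∈ B)) H.Adj
    simp only [Finset.bipartiteAbove, Finset.bipartiteBelow] at this
    rw [this]
    refine Finset.sum_congr rfl fun b _ => ?_
    congr 1
    ext s
    simp [H.adj_comm]
  unfold fE
  rw [e1, Finset.sum_union dj, e3]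
  have e4 : ∑ b ∈ (U \ S).filter (· ∈ B), ((U.filter (H.Adj b)).card + 1)
      = ∑ b ∈ (U \ S).filter (· ∈ B), (((U \ S).filter (H.Adj b)).card + 1)
        + ∑ b ∈ (U \ S).filter (· ∈ B), (S.filter (H.Adj b)).card := by
    rw [← Finset.sum_add_distrib]
    refine Finset.sum_congr rfl fun b _ => ?_
    rw [e2 b]; omega
  rw [e4]
  omega

variable {H B}

theorem E_alpha {U : Finset V} {κ ℓ : ℕ} (hℓ : ℓ ≤ κ)
    (rich : ∀ a ∈ U, a ∉ B → κ < ((U.filter (· ∈ B)).filter (H.Adj a)).card)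
    (hmax : ∀ l, BP H B l → (∀ v ∈ l, v ∈ U) → cB B l ≤ ℓ)
    {l : List V} (hl : BP H B l) (hlU : ∀ v ∈ l, v ∈ U) (hc : cB B l = ℓ)
    {b v : V} (hb : b ∈ l.head?) (hv : v ∈ U) (hbv : H.Adj b v) : v ∈ l := by
  by_contra hvl
  obtain ⟨ne, nd, ch, hd, lt⟩ := hl
  have hbB := hd b hb
  cases l with
  | nil => simp at ne
  | cons b1 t =>
    obtain rfl : b1 = b := by simpa using hb
    by_cases hvB : v ∈ B
    · have := hmax (v :: b1 :: t) ⟨by simp, List.nodup_cons.2 ⟨hvl, nd⟩,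
        List.isChain_cons_cons.2 ⟨hbv.symm, ch⟩, by simpa using hvB, by simpa using lt⟩
        (by intro w hw; rcases List.mem_cons.1 hw with rfl | hw; exacts [hv, hlU _ hw])
      rw [cB_cons, if_pos hvB] at this
      omega
    · have h1 := rich v hv hvB
      have : ∃ b' ∈ (U.filter (· ∈ B)).filter (H.Adj v), b' ∉ (b1 :: t) := by
        by_contra hcon
        push Not at hcon
        have := card_le_countP ((U.filter (· ∈ B)).filter (H.Adj v)) (b1 :: t) (· ∈ B)
          (fun x hx => ⟨hcon x hx, by simp at hx; exact hx.1.2⟩)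
        change _ ≤ cB B (b1 :: t) at this
        omega
      obtain ⟨b', hb', hb'l⟩ := this
      simp only [Finset.mem_filter] at hb'
      obtain ⟨⟨hb'U, hb'B⟩, hvb'⟩ := hb'
      have := hmax (b' :: v :: b1 :: t) ⟨by simp, List.nodup_cons.2
        ⟨by rw [List.mem_cons]; rintro (rfl | h); exacts [hvB hb'B, hb'l h],
          List.nodup_cons.2 ⟨hvl, nd⟩⟩,
        List.isChain_cons_cons.2 ⟨hvb'.symm, List.isChain_cons_cons.2 ⟨hbv.symm, ch⟩⟩,
          by simpa using hb'B, by simpa using lt⟩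
        (by intro w hw
            rcases List.mem_cons.1 hw with rfl | hw
            · exact hb'U
            rcases List.mem_cons.1 hw with rfl | hw
            exacts [hv, hlU _ hw])
      rw [cB_cons, if_pos hb'B, cB_cons, if_neg hvB] at this
      omega

/-- flipping an initial segment -/
theorem flip_chain {L1 L2 : List V} {b1 bj : V} (ch1 : L1.IsChain H.Adj)
    (ch2 : (bj :: L2).IsChain H.Adj) (hb : b1 ∈ L1.head?) (h : H.Adj b1 bj) :
    (L1.reverse ++ bj :: L2).IsChain H.Adj := by
  rw [List.isChain_append]
  refine ⟨?_, ch2, ?_⟩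
  · rw [List.isChain_reverse]; exact ch1.imp fun a b hab => hab.symm
  · intro x hx y hy
    rw [List.getLast?_reverse] at hx
    simp only [List.head?_cons, Option.mem_def, Option.some.injEq] at hy hx hb
    rw [hb] at hx
    simp only [Option.some.injEq] at hx
    rw [← hx, ← hy]; exact h

theorem E_beta {U : Finset V} {κ ℓ : ℕ} (hH : ∀ u v, H.Adj u v → u ∈ B ∨ v ∈ B) (hℓ : ℓ ≤ κ)
    (rich : ∀ a ∈ U, a ∉ B → κ < ((U.filter (· ∈ B)).filter (H.Adj a)).card)
    (hmax : ∀ l, BP H B l → (∀ v ∈ l, v ∈ U) → cB B l ≤ ℓ)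
    {l : List V} (hl : BP H B l) (hlU : ∀ v ∈ l, v ∈ U) (hc : cB B l = ℓ)
    {b u w : V} {L1 L2 : List V} (hb : b ∈ l.head?) (e : l = L1 ++ u :: w :: L2)
    (hbw : H.Adj b w) : u ∈ B := by
  by_contra huB
  obtain ⟨ne, nd, ch, hd, lt⟩ := hl
  have hbB := hd b hb
  subst e
  rcases List.eq_nil_or_concat L1 with rfl | ⟨K, z, rfl⟩
  · simp at hb; exact huB (hb ▸ hbB)
  rw [List.concat_eq_append] at *
  have hb' : b ∈ (K ++ [z]).head? := by
    cases K <;> simpa using hb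
  obtain ⟨c1, c2, c3⟩ := List.isChain_append.1 ch
  have hzu : H.Adj z u := c3 z (by simp) u (by simp)
  have hzB : z ∈ B := (hH _ _ hzu).resolve_right huB
  rw [List.isChain_cons_cons] at c2
  have cc := flip_chain c1 c2.2 hb' hbw
  have nd' : ((K ++ [z]).reverse ++ w :: L2).Nodup ∧ u ∉ ((K ++ [z]).reverse ++ w :: L2) := by
    have : (u :: ((K ++ [z]).reverse ++ w :: L2)).Perm ((K ++ [z]) ++ u :: w :: L2) := by
      refine List.Perm.trans ?_ List.perm_middle.symm
      exact List.Perm.cons _ (List.Perm.append_right _ (List.reverse_perm _))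
    have := this.nodup_iff.2 nd
    rw [List.nodup_cons] at this
    exact this.symm
  have := E_alpha hℓ rich hmax (l := (K ++ [z]).reverse ++ w :: L2)
    ⟨by simp, nd'.1, cc, by simpa using hzB, by
      intro y hy; apply lt
      rw [getLast?_app_cons] at hy ⊢
      rw [List.getLast?_cons_cons]; exact hy⟩
    (by intro v hv; apply hlU; simp at hv ⊢; tauto)
    (by simp [huB] at hc ⊢; omega) (b := z) (v := u) (by simp) (hlU _ (by simp)) hzu
  exact nd'.2 this

theorem E_cyc {U : Finset V} {κ ℓ : ℕ} (hH : ∀ u v, H.Adj u v → u ∈ B ∨ v ∈ B) (hℓ : ℓ ≤ κ)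
    (hℓ1 : 1 ≤ ℓ)
    (rich : ∀ a ∈ U, a ∉ B → κ < ((U.filter (· ∈ B)).filter (H.Adj a)).card)
    (hmax : ∀ l, BP H B l → (∀ v ∈ l, v ∈ U) → cB B l ≤ ℓ)
    {C : List V} (nd : C.Nodup) (ch : C.IsChain H.Adj)
    (cy : ∀ x ∈ C.getLast?, ∀ y ∈ C.head?, H.Adj x y)
    (hCU : ∀ v ∈ C, v ∈ U) (hc : cB B C = ℓ) (v : V) (hv : v ∈ C) :
    v ∈ B ∧ ∀ w ∈ U, H.Adj v w → w ∈ C := by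
  obtain ⟨P, Q, rfl⟩ := List.append_of_mem hv
  obtain ⟨c1, c2, c3⟩ := List.isChain_append.1 ch
  -- the rotated list
  have ch' : (v :: (Q ++ P)).IsChain H.Adj := by
    have : ((v :: Q) ++ P).IsChain H.Adj := by
      rw [List.isChain_append]
      refine ⟨c2, c1, fun x hx y hy => cy x ?_ y ?_⟩
      · rw [List.getLast?_append]; simp at hx ⊢; simp [hx]
      · rw [List.head?_append]; simp at hy ⊢; simp [hy]
    simpa using this
  have pm : (v :: (Q ++ P)).Perm (P ++ v :: Q) :=
    List.Perm.trans (List.Perm.cons _ List.perm_append_comm) List.perm_middle.symm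
  have nd' := pm.nodup_iff.2 nd
  have hc' : cB B (v :: (Q ++ P)) = ℓ := by simp at hc ⊢; omega
  have cy' : ∀ x ∈ (v :: (Q ++ P)).getLast?, Q ++ P ≠ [] → H.Adj x v := by
    intro x hx hne
    rcases List.eq_nil_or_concat P with rfl | ⟨K, z, rfl⟩
    · simp only [List.append_nil] at hx
      apply cy <;> simp_all
    · rw [List.concat_eq_append] at *
      have : x = z := by
        have : (v :: (Q ++ (K ++ [z]))) = (v :: (Q ++ K)) ++ [z] := by simp
        rw [this, List.getLast?_append] at hx
        simpa using hx.symm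
      subst this
      exact c3 x (by simp) v (by simp)
  have hU' : ∀ w ∈ v :: (Q ++ P), w ∈ U := fun w hw => hCU w (pm.mem_iff.1 hw)
  generalize hR : Q ++ P = R at *
  have hvB : v ∈ B := by
    by_contra hvB
    cases R with
    | nil => simp [hvB] at hc'; omega
    | cons r R =>
      rw [List.isChain_cons_cons] at ch'
      rw [List.nodup_cons] at nd'
      have := E_alpha hℓ rich hmax (l := r :: R) (b := r) (v := v) ⟨by simp, nd'.2, ch'.2, by
          simpa using (hH _ _ ch'.1).resolve_left hvB, by
          intro y hy
          have := cy' y (by simpa using hy) (by simp)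
          exact (hH _ _ this).resolve_right hvB⟩ (fun w hw => hU' w (by simp [List.mem_cons.1 hw]))
          (by rw [cB_cons, if_neg hvB] at hc'; omega) (by simp) (hU' _ (by simp)) ch'.1.symm
      exact nd'.1 this
  refine ⟨hvB, fun w hw hvw => ?_⟩
  rw [← pm.mem_iff]
  rcases List.eq_nil_or_concat R with rfl | ⟨K, z, rfl⟩
  · exact E_alpha hℓ rich hmax (l := [v]) (b := v) ⟨by simp, nd', ch', by simpa, by simpa⟩
      hU' hc' (by simp) hw hvw
  rw [List.concat_eq_append] at *
  by_cases hzB : z ∈ B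
  · exact E_alpha hℓ rich hmax (b := v) ⟨by simp, nd', ch', by simpa,
      by
        have : (v :: (K ++ [z])) = (v :: K) ++ [z] := by simp
        rw [this, List.getLast?_append]; simpa using hzB⟩
      hU' hc' (by simp) hw hvw
  · have e : (v :: (K ++ [z])) = (v :: K) ++ [z] := by simp
    rw [e] at ch' nd' hc' hU' ⊢
    obtain ⟨d1, d2, d3⟩ := List.isChain_append.1 ch'
    have := E_alpha hℓ rich hmax (b := v) (l := v :: K) (v := w) ⟨by simp,
      (List.nodup_append.1 nd').1, d1, by simpa,
      by
        intro y hy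
        exact (hH _ _ (d3 y hy z (by simp))).resolve_right hzB⟩
      (fun w hw => hU' w (List.mem_append_left _ hw)) (by simp [hzB] at hc' ⊢; omega)
      (by simp) hw hvw
    exact List.mem_append_left _ this

end LemE
section LemE2

variable {H : SimpleGraph V} [DecidableRel H.Adj] {B : Finset V}

theorem lemE (hH : ∀ u v, H.Adj u v → u ∈ B ∨ v ∈ B) (κ : ℕ) (U : Finset V)
    (hf : κ * U.card < fE H B U) : ∃ l, BP H B l ∧ cB B l = κ + 1 := by
  induction U using Finset.strongInduction with
  | H U ih =>
  by_contra hno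
  -- every path has at most κ vertices in B
  have hle : ∀ l, BP H B l → cB B l ≤ κ := by
    intro l hl
    by_contra hcon
    obtain ⟨W, -, hW, hWc⟩ := BP.pre (κ + 1) (by omega) hl.nd hl.ch hl.hd (by omega)
    exact hno ⟨W, hW, hWc⟩
  have hmin : ∀ S, S ⊆ U → S.Nonempty →
      κ * S.card < ∑ b ∈ S.filter (· ∈ B), ((U.filter (H.Adj b)).card + 1)
        + ∑ s ∈ S, (((U \ S).filter (· ∈ B)).filter (H.Adj s)).card := by
    intro S hS hne
    have h1 : fE H B (U \ S) ≤ κ * (U \ S).card := by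
      by_contra hcon
      exact hno (ih (U \ S) (Finset.sdiff_ssubset hS hne) (by omega))
    have h2 := fE_loss H B U S hS
    have h3 : (U \ S).card + S.card = U.card := Finset.card_sdiff_add_card_eq_card hS
    rw [← h3, mul_add] at hf
    omega
  have rich : ∀ a ∈ U, a ∉ B → κ < ((U.filter (· ∈ B)).filter (H.Adj a)).card := by
    intro a ha haB
    have h1 := hmin {a} (by simpa using ha) (by simp)
    rw [Finset.filter_singleton, if_neg haB] at h1
    simp only [Finset.card_singleton, Finset.sum_empty, Finset.sum_singleton, mul_one,
      zero_add] at h1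
    refine lt_of_lt_of_le h1 (Finset.card_le_card ?_)
    intro x hx
    simp only [Finset.mem_filter, Finset.mem_sdiff] at hx ⊢
    tauto
  have degB : ∀ b ∈ U, b ∈ B →
      κ ≤ (U.filter (H.Adj b)).card + ((U.filter (· ∈ B)).filter (H.Adj b)).card := by
    intro b hb hbB
    have h1 := hmin {b} (by simpa using hb) (by simp)
    rw [Finset.filter_singleton, if_pos hbB] at h1
    simp only [Finset.card_singleton, Finset.sum_singleton, mul_one] at h1
    have : (((U \ {b}).filter (· ∈ B)).filter (H.Adj b)).card
        ≤ ((U.filter (· ∈ B)).filter (H.Adj b)).card := by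
      refine Finset.card_le_card ?_
      intro x hx
      simp only [Finset.mem_filter, Finset.mem_sdiff] at hx ⊢
      tauto
    omega
  -- a longest path inside U
  have hUB : (U.filter (· ∈ B)).Nonempty := by
    rw [Finset.nonempty_iff_ne_empty]
    intro h
    rw [fE, h] at hf
    simp at hf
  obtain ⟨b0, hb0⟩ := hUB
  simp only [Finset.mem_filter] at hb0
  let P : ℕ → Prop := fun k => ∃ l, BP H B l ∧ (∀ v ∈ l, v ∈ U) ∧ cB B l = k
  classical
  have hP1 : P 1 := ⟨[b0], ⟨by simp, by simp, by simp, by simpa using hb0.2,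
    by simpa using hb0.2⟩, by simpa using hb0.1, by simp [hb0.2]⟩
  have h1κ : 1 ≤ κ := by
    obtain ⟨l, hl, -, h⟩ := hP1
    rw [← h]; exact hle l hl
  obtain ⟨ℓ, hℓdef⟩ : ∃ ℓ, ℓ = Nat.findGreatest P κ := ⟨_, rfl⟩
  have hPℓ : P ℓ := hℓdef ▸ Nat.findGreatest_spec h1κ hP1
  have hℓ1 : 1 ≤ ℓ := hℓdef ▸ Nat.le_findGreatest h1κ hP1
  have hℓ : ℓ ≤ κ := hℓdef ▸ Nat.findGreatest_le κ
  have hmax : ∀ l, BP H B l → (∀ v ∈ l, v ∈ U) → cB B l ≤ ℓ := by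
    intro l hl hlU
    rw [hℓdef]
    exact Nat.le_findGreatest (hle l hl) ⟨l, hl, hlU, rfl⟩
  obtain ⟨l, hl, hlU, hc⟩ := hPℓ
  have hrU : ∀ v ∈ l.reverse, v ∈ U := fun v hv => hlU v (by simpa using hv)
  have hcr : cB B l.reverse = ℓ := by simpa using hc
  obtain ⟨b1, hb1⟩ : ∃ b1, b1 ∈ l.head? := by
    cases l with
    | nil => exact absurd rfl hl.ne
    | cons a t => exact ⟨a, by simp⟩
  obtain ⟨b2, hb2⟩ : ∃ b2, b2 ∈ l.getLast? := by
    exact ⟨_, List.getLast?_eq_getLast_of_ne_nil hl.ne⟩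
  have hb2r : b2 ∈ l.reverse.head? := by simpa using hb2
  have hb1B := hl.hd b1 hb1
  have hb2B := hl.lt b2 hb2
  have hb1l : b1 ∈ l := List.mem_of_mem_head? hb1
  have hb2l : b2 ∈ l := List.mem_of_mem_getLast? hb2
  have al1 : ∀ v ∈ U, H.Adj b1 v → v ∈ l := fun v hv h =>
    E_alpha hℓ rich hmax hl hlU hc hb1 hv h
  have al2 : ∀ v ∈ U, H.Adj b2 v → v ∈ l := fun v hv h => by
    simpa using E_alpha hℓ rich hmax hl.rev hrU hcr hb2r hv h
  by_cases hcross : ∃ L1 u w L2, l = L1 ++ u :: w :: L2 ∧ H.Adj b1 w ∧ H.Adj b2 u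
  · obtain ⟨L1, u, w, L2, e, h1w, h2u⟩ := hcross
    have e' : l = (L1 ++ [u]) ++ w :: L2 := by simp [e]
    have ch := hl.ch
    rw [e'] at ch
    obtain ⟨c1, c2, -⟩ := List.isChain_append.1 ch
    have hb1' : b1 ∈ (L1 ++ [u]).head? := by
      rw [e] at hb1
      cases L1 <;> simpa using hb1
    have pm : ((L1 ++ [u]).reverse ++ w :: L2).Perm l := by
      rw [e']; exact List.Perm.append_right _ (List.reverse_perm _)
    have hb2' : (w :: L2).getLast? = some b2 := by
      rw [e', getLast?_app_cons] at hb2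
      exact hb2
    have cyc := E_cyc hH hℓ hℓ1 rich hmax (C := (L1 ++ [u]).reverse ++ w :: L2)
      (pm.nodup_iff.2 hl.nd) (flip_chain c1 c2 hb1' h1w)
      (by
        intro x hx y hy
        rw [getLast?_app_cons, hb2'] at hx
        obtain rfl : b2 = x := by simpa using hx
        obtain rfl : u = y := by simpa using hy
        exact h2u)
      (fun v hv => hlU v (pm.mem_iff.1 hv)) (by rw [← hc, e']; simp; omega)
    have cyc' : ∀ v ∈ l, v ∈ B ∧ ∀ w ∈ U, H.Adj v w → w ∈ l := by
      intro v hv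
      obtain ⟨h1, h2⟩ := cyc v (pm.mem_iff.2 hv)
      exact ⟨h1, fun w hw h => pm.mem_iff.1 (h2 w hw h)⟩
    have hlen : l.length = ℓ := by
      rw [← hc, cB, List.countP_eq_length.2]
      intro a ha; simpa using (cyc' a ha).1
    have hcard : l.toFinset.card = ℓ := by rw [List.toFinset_card_of_nodup hl.nd, hlen]
    have h1 := hmin l.toFinset (by intro v hv; exact hlU v (by simpa using hv))
      ⟨b1, by simpa using hb1l⟩
    have h2 : ∑ s ∈ l.toFinset, (((U \ l.toFinset).filter (· ∈ B)).filter (H.Adj s)).card = 0 := by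
      refine Finset.sum_eq_zero fun s hs => ?_
      rw [Finset.card_eq_zero, Finset.filter_eq_empty_iff]
      intro x hx hsx
      simp only [Finset.mem_filter, Finset.mem_sdiff, List.mem_toFinset] at hx hs
      exact hx.1.2 ((cyc' s hs).2 x hx.1.1 hsx)
    have h3 : ∑ b ∈ l.toFinset.filter (· ∈ B), ((U.filter (H.Adj b)).card + 1) ≤ ℓ * ℓ := by
      have : ∀ b ∈ l.toFinset.filter (· ∈ B), (U.filter (H.Adj b)).card + 1 ≤ ℓ := by
        intro b hb
        simp only [Finset.mem_filter, List.mem_toFinset] at hb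
        rw [← hcard]
        refine Finset.card_lt_card ?_
        rw [Finset.ssubset_iff_of_subset]
        · exact ⟨b, by simpa using hb.1, by simp⟩
        · intro x hx
          simp only [Finset.mem_filter, List.mem_toFinset] at hx ⊢
          exact (cyc' b hb.1).2 x hx.1 hx.2
      refine (Finset.sum_le_card_nsmul _ _ _ this).trans ?_
      rw [smul_eq_mul]
      refine Nat.mul_le_mul_right _ ?_
      rw [← hcard]
      exact Finset.card_le_card (Finset.filter_subset _ _)
    rw [h2, hcard] at h1
    have := Nat.mul_le_mul_right ℓ hℓ
    omega
  · push Not at hcross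
    have hcount := hl.count hH
    have key : ∀ b, (∀ v ∈ U, H.Adj b v → v ∈ l) →
        (U.filter (H.Adj b)).card ≤ ((U.filter (· ∈ B)).filter (H.Adj b)).card
          + (l.length - cB B l) := by
      intro b hb
      have h1 : U.filter (H.Adj b) = (U.filter (· ∈ B)).filter (H.Adj b)
          ∪ (U.filter (· ∉ B)).filter (H.Adj b) := by
        ext x; simp only [Finset.mem_filter, Finset.mem_union]; tauto
      have h2 : ((U.filter (· ∉ B)).filter (H.Adj b)).card ≤ l.countP (· ∉ B) := by
        apply card_le_countP
        intro x hx
        simp only [Finset.mem_filter] at hx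
        exact ⟨hb x hx.1.1 hx.2, hx.1.2⟩
      have h3 : l.length = cB B l + l.countP (· ∉ B) := by
        rw [cB, List.length_eq_countP_add_countP (p := fun v => decide (v ∈ B))]
        simp
      rw [h1]
      refine (Finset.card_union_le _ _).trans ?_
      omega
    have k1 := key b1 al1
    have k2 := key b2 al2
    have d1 := degB b1 (hlU _ hb1l) hb1B
    have d2 := degB b2 (hlU _ hb2l) hb2B
    have pc := pair_count B ((U.filter (· ∈ B)).filter (H.Adj b1))
      ((U.filter (· ∈ B)).filter (H.Adj b2)) l (by
        apply chain_of_split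
        intro L1 u w L2 e
        simp only [Finset.mem_filter]
        refine ⟨fun h => ⟨E_beta hH hℓ rich hmax hl hlU hc hb1 e h.2, h.1.2⟩,
          fun h => ⟨h.1.2, ?_⟩, fun h => hcross L1 u w L2 e h.1.2 h.2.2⟩
        exact E_beta hH hℓ rich hmax hl.rev hrU hcr hb2r (L1 := L2.reverse) (L2 := L1.reverse)
          (u := w) (w := u) (by simp [e]) h.2)
    have p1 : ((U.filter (· ∈ B)).filter (H.Adj b1)).card
        ≤ l.tail.countP (· ∈ (U.filter (· ∈ B)).filter (H.Adj b1)) := by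
      apply card_le_countP
      intro x hx
      refine ⟨?_, hx⟩
      simp only [Finset.mem_filter] at hx
      have := al1 x hx.1.1 hx.2
      cases l with
      | nil => simp at this
      | cons a t =>
        obtain rfl : a = b1 := by simpa using hb1
        rcases List.mem_cons.1 this with rfl | h
        · exact absurd hx.2 (by simp)
        · exact h
    have p2 : ((U.filter (· ∈ B)).filter (H.Adj b2)).card
        ≤ l.dropLast.countP (· ∈ (U.filter (· ∈ B)).filter (H.Adj b2)) := by
      apply card_le_countP
      intro x hx
      refine ⟨?_, hx⟩
      simp only [Finset.mem_filter] at hx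
      have := al2 x hx.1.1 hx.2
      rw [← List.dropLast_append_getLast? b2 hb2] at this
      rcases List.mem_append.1 this with h | h
      · exact h
      · obtain rfl : x = b2 := by simpa using h
        exact absurd hx.2 (by simp)
    have hcl : cB B l ≤ l.length := List.countP_le_length
    omega

end LemE2
/-- the graph of edges meeting `B` -/
def gB (G : SimpleGraph V) (B : Finset V) : SimpleGraph V where
  Adj u v := G.Adj u v ∧ (u ∈ B ∨ v ∈ B)
  symm := ⟨fun _ _ h => ⟨h.1.symm, h.2.symm⟩⟩
  loopless := ⟨fun _ h => G.loopless.irrefl _ h.1⟩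

instance (G : SimpleGraph V) [DecidableRel G.Adj] (B : Finset V) : DecidableRel (gB G B).Adj :=
  fun u v => inferInstanceAs (Decidable (G.Adj u v ∧ (u ∈ B ∨ v ∈ B)))

/-- the situation around a vertex `x` of maximum monochromatic degree -/
structure Ctx [Fintype V] (G : SimpleGraph V) [DecidableRel G.Adj] (n m p M T : ℕ)
    (x : V) (A B : Finset V) : Prop where
  hA : ∀ v, v ∈ A ↔ G.Adj x v
  hB : ∀ v, v ∈ B ↔ v ≠ x ∧ v ∉ A
  cA : A.card = M + T
  cBB : B.card + T = M
  hM : M + 1 = n + m + p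
  hm : 1 ≤ m
  hp : 1 ≤ p
  lo : ∀ v, B.card ≤ (Finset.univ.filter (G.Adj v)).card
  hi : ∀ v, (Finset.univ.filter (G.Adj v)).card ≤ M + T
  hδ : m + 2 * p ≤ B.card
  hno : ¬ HasCopy (LinkedDoubleStar (2 * p + 1) n m) G

namespace Ctx

variable [Fintype V] {G : SimpleGraph V} [DecidableRel G.Adj] {n m p M T : ℕ}
    {x : V} {A B : Finset V}

theorem xA (c : Ctx G n m p M T x A B) : x ∉ A := by rw [c.hA]; simp
theorem xB (c : Ctx G n m p M T x A B) : x ∉ B := by rw [c.hB]; simp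
theorem AB (c : Ctx G n m p M T x A B) {v : V} (h : v ∈ A) : v ∉ B := by
  rw [c.hB]; tauto
theorem tri (c : Ctx G n m p M T x A B) {v : V} (h : v ≠ x) (h' : v ∉ B) : v ∈ A := by
  rw [c.hB] at h'; tauto
theorem xnB (c : Ctx G n m p M T x A B) {v : V} (h : v ∈ B) : ¬ G.Adj x v := by
  rw [← c.hA]; exact fun h' => c.AB h' h

theorem star (c : Ctx G n m p M T x A B) {t : List V} {y : V} (nd : (x :: t).Nodup)
    (ch : (x :: t).IsChain G.Adj) (hl : t.length = 2 * p) (hy : (x :: t).getLast? = some y)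
    (Q : Finset V) (hQ : Q.card = m) (hQy : ∀ v ∈ Q, G.Adj y v) (hQl : ∀ v ∈ Q, v ∉ x :: t)
    (hP : n ≤ ((A.filter (· ∉ t)) \ Q).card) : False := by
  obtain ⟨P, hP1, hP2⟩ := Finset.exists_subset_card_eq hP
  have h := lds_emb G n m (x :: t) nd ch x y (by simp) hy P Q hP2 hQ
    (Finset.disjoint_left.2 fun v hv => (Finset.mem_sdiff.1 (hP1 hv)).2)
    (by
      intro v hv
      have := hP1 hv
      simp only [Finset.mem_sdiff, Finset.mem_filter] at this
      rw [List.mem_cons]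
      rintro (rfl | h)
      · exact c.xA this.1.1
      · exact this.1.2 h)
    hQl
    (by
      intro v hv
      have := hP1 hv
      simp only [Finset.mem_sdiff, Finset.mem_filter] at this
      exact (c.hA v).1 this.1.1)
    hQy
  rw [List.length_cons, hl] at h
  exact c.hno h

theorem cardNX (c : Ctx G n m p M T x A B) (t : List V) :
    M + T + cB B t ≤ (A.filter (· ∉ t)).card + t.length := by
  have h1 : (A.filter (· ∈ t)).card ≤ t.countP (· ∉ B) := by
    apply card_le_countP
    intro v hv
    simp only [Finset.mem_filter] at hv
    exact ⟨hv.2, c.AB hv.1⟩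
  have h3 : t.length = cB B t + t.countP (· ∉ B) := by
    rw [cB, List.length_eq_countP_add_countP (p := fun v => decide (v ∈ B))]
    simp
  have h4 := Finset.card_filter_add_card_filter_not (s := A) (· ∈ t)
  have := c.cA
  omega

/-- enough neighbours off a short path -/
theorem cardNY (c : Ctx G n m p M T x A B) {l : List V} {y : V} (hy : y ∈ l) :
    B.card + 1 ≤ ((Finset.univ.filter (G.Adj y)).filter (· ∉ l)).card + l.length := by
  have h1 : ((Finset.univ.filter (G.Adj y)).filter (· ∈ l)).card ≤ (l.toFinset.erase y).card := by
    apply Finset.card_le_card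
    intro v hv
    simp only [Finset.mem_filter, Finset.mem_univ, true_and] at hv
    simp only [Finset.mem_erase, List.mem_toFinset]
    exact ⟨hv.1.ne', hv.2⟩
  rw [Finset.card_erase_of_mem (by simpa using hy)] at h1
  have h2 := List.toFinset_card_le l
  have h3 : 0 < l.toFinset.card := Finset.card_pos.2 ⟨y, by simpa using hy⟩
  have h4 := Finset.card_filter_add_card_filter_not (s := Finset.univ.filter (G.Adj y)) (· ∈ l)
  have := c.lo y
  omega

theorem SL1 (c : Ctx G n m p M T x A B) {t : List V} (nd : (x :: t).Nodup)
    (ch : (x :: t).IsChain G.Adj) (hl : t.length = 2 * p) (hb : p + 1 ≤ cB B t + T) : False := by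
  obtain ⟨y, hy⟩ : ∃ y, (x :: t).getLast? = some y :=
    ⟨_, List.getLast?_eq_getLast_of_ne_nil (by simp)⟩
  have h1 := c.cardNY (List.mem_of_mem_getLast? hy)
  have h2 := c.cardNX t
  have h3 := c.hδ
  have h4 := c.hM
  rw [List.length_cons] at h1
  obtain ⟨Q, hQ1, hQ2⟩ := Finset.exists_subset_card_eq (n := m)
    (s := (Finset.univ.filter (G.Adj y)).filter (· ∉ x :: t)) (by omega)
  have h5 : ∀ v ∈ Q, G.Adj y v ∧ v ∉ x :: t := fun v hv => by
    have := hQ1 hv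
    simpa only [Finset.mem_filter, Finset.mem_univ, true_and] using this
  refine c.star nd ch hl hy Q hQ2 (fun v hv => (h5 v hv).1) (fun v hv => (h5 v hv).2) ?_
  have := Finset.le_card_sdiff Q (A.filter (· ∉ t))
  omega

theorem SL2 (c : Ctx G n m p M T x A B) {t : List V} {y z : V} (nd : (x :: t).Nodup)
    (ch : (x :: t).IsChain G.Adj) (hl : t.length = 2 * p) (hb : p ≤ cB B t + T)
    (hy : (x :: t).getLast? = some y) (hz : z ∈ B) (hzt : z ∉ x :: t) (hyz : G.Adj y z) :
    False := by
  have h1 := c.cardNY (List.mem_of_mem_getLast? hy)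
  have h2 := c.cardNX t
  have h3 := c.hδ
  have h4 := c.hM
  have hm := c.hm
  rw [List.length_cons] at h1
  obtain ⟨Q, hQ0, hQ1, hQ2⟩ := Finset.exists_subsuperset_card_eq (n := m) (s := {z})
    (t := (Finset.univ.filter (G.Adj y)).filter (· ∉ x :: t))
    (by
      rw [Finset.singleton_subset_iff]
      simp only [Finset.mem_filter, Finset.mem_univ, true_and]
      exact ⟨hyz, hzt⟩) (by simpa using hm) (by omega)
  have h5 : ∀ v ∈ Q, G.Adj y v ∧ v ∉ x :: t := fun v hv => by
    have := hQ1 hv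
    simpa only [Finset.mem_filter, Finset.mem_univ, true_and] using this
  refine c.star nd ch hl hy Q hQ2 (fun v hv => (h5 v hv).1) (fun v hv => (h5 v hv).2) ?_
  have e : (A.filter (· ∉ t)) \ Q = (A.filter (· ∉ t)) \ (Q.erase z) := by
    ext v
    simp only [Finset.mem_sdiff, Finset.mem_filter, Finset.mem_erase]
    have : v ∈ A → v ≠ z := fun h h' => c.AB h (h' ▸ hz)
    tauto
  have := Finset.le_card_sdiff (Q.erase z) (A.filter (· ∉ t))
  rw [Finset.card_erase_of_mem (Finset.singleton_subset_iff.1 hQ0)] at this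
  rw [e]
  omega

theorem SL1' (c : Ctx G n m p M T x A B) (j : ℕ) {t : List V} (nd : (x :: t).Nodup)
    (ch : (x :: t).IsChain G.Adj) (hl : t.length + j = 2 * p) (hb : p + 1 ≤ cB B t + T) :
    False := by
  induction j generalizing t with
  | zero => exact c.SL1 nd ch (by omega) hb
  | succ j ih =>
    obtain ⟨y, hy⟩ : ∃ y, (x :: t).getLast? = some y :=
      ⟨_, List.getLast?_eq_getLast_of_ne_nil (by simp)⟩
    have h1 := c.cardNY (List.mem_of_mem_getLast? hy)
    have h3 := c.hδ
    have hm := c.hm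
    rw [List.length_cons] at h1
    obtain ⟨w, hw⟩ := Finset.card_pos.1 (show 0 <
      ((Finset.univ.filter (G.Adj y)).filter (· ∉ x :: t)).card by omega)
    simp only [Finset.mem_filter, Finset.mem_univ, true_and] at hw
    have e : x :: (t ++ [w]) = (x :: t) ++ [w] := by simp
    refine ih (t := t ++ [w]) ?_ ?_ (by simp; omega) (by simp; omega)
    · rw [e, List.nodup_append]
      refine ⟨nd, by simp, ?_⟩
      intro a ha b hb
      obtain rfl : b = w := by simpa using hb
      rintro rfl
      exact hw.2 ha
    · rw [e, List.isChain_append]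
      refine ⟨ch, by simp, ?_⟩
      intro a ha b hb
      obtain rfl : w = b := by simpa using hb
      rw [hy] at ha
      obtain rfl : y = a := by simpa using ha
      exact hw.1

theorem SL' (c : Ctx G n m p M T x A B) {t : List V} (nd : (x :: t).Nodup)
    (ch : (x :: t).IsChain G.Adj) (hl : t.length ≤ 2 * p + 1) (hb : p + 1 ≤ cB B t + T)
    (hlast : ∀ z ∈ t.getLast?, z ∈ B) : False := by
  rcases Nat.lt_or_ge (2 * p) t.length with h | h
  · rcases List.eq_nil_or_concat t with rfl | ⟨t', z, rfl⟩
    · simp at h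
    rw [List.concat_eq_append] at *
    have hz : z ∈ B := hlast z (by simp)
    have e : x :: (t' ++ [z]) = (x :: t') ++ [z] := by simp
    rw [e] at nd ch
    obtain ⟨d1, -, d3⟩ := List.nodup_append.1 nd
    obtain ⟨c1, -, c3⟩ := List.isChain_append.1 ch
    obtain ⟨y, hy⟩ : ∃ y, (x :: t').getLast? = some y :=
      ⟨_, List.getLast?_eq_getLast_of_ne_nil (by simp)⟩
    simp [hz] at hb hl h
    exact c.SL2 d1 c1 (by omega) (by omega) hy hz (fun h => d3 z h z (by simp) rfl)
      (c3 y hy z (by simp))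
  · exact c.SL1' (2 * p - t.length) nd ch (by omega) hb

theorem hH (G : SimpleGraph V) (B : Finset V) : ∀ u v, (gB G B).Adj u v → u ∈ B ∨ v ∈ B :=
  fun _ _ h => h.2

theorem notx (c : Ctx G n m p M T x A B) {l : List V} (ch : l.IsChain (gB G B).Adj)
    (hd : ∀ y ∈ l.head?, y ∈ B) : x ∉ l := by
  intro hx
  obtain ⟨P, Q, rfl⟩ := List.append_of_mem hx
  rcases List.eq_nil_or_concat P with rfl | ⟨K, z, rfl⟩
  · exact c.xB (hd x (by simp))
  · rw [List.concat_eq_append] at *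
    have h := (List.isChain_append.1 ch).2.2 z (by simp) x (by simp)
    exact c.xnB (h.2.resolve_right c.xB) h.1.symm

theorem noA (c : Ctx G n m p M T x A B) {W : List V} (hW : BP (gB G B) B W)
    (hk : p + 1 ≤ cB B W + T) (hl : W.length ≤ 2 * p) {a b : V} (ha : a ∈ A)
    (hb : b ∈ W.head?) (hab : G.Adj b a) : a ∈ W := by
  by_contra haW
  have hx := c.notx hW.ch hW.hd
  refine c.SL' (t := a :: W) ?_ ?_ (by simp; omega) (by simp [c.AB ha]; omega) ?_
  · rw [List.nodup_cons, List.nodup_cons, List.mem_cons]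
    refine ⟨?_, haW, hW.nd⟩
    rintro (rfl | h)
    exacts [c.xA ha, hx h]
  · rw [List.isChain_cons_cons, List.isChain_cons]
    refine ⟨(c.hA a).1 ha, ?_, hW.ch.imp fun _ _ h => h.1⟩
    intro y hy
    have : b = y := by
      rw [Option.mem_def] at hy hb; rw [hy] at hb; simpa using hb.symm
    rw [← this]; exact hab.symm
  · intro z hz
    apply hW.lt
    cases W with
    | nil => exact absurd rfl hW.ne
    | cons w W => simpa using hz

theorem exA (c : Ctx G n m p M T x A B) {b : V} (hb : b ∈ B) : ∃ a ∈ A, G.Adj b a := by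
  by_contra hcon
  push Not at hcon
  have : (Finset.univ.filter (G.Adj b)).card < B.card := by
    apply Finset.card_lt_card
    rw [Finset.ssubset_iff_of_subset]
    · exact ⟨b, hb, by simp⟩
    · intro v hv
      simp only [Finset.mem_filter, Finset.mem_univ, true_and] at hv
      by_contra hvB
      refine hcon v (c.tri ?_ hvB) hv
      rintro rfl
      exact c.xnB hb hv.symm
  have := c.lo b
  omega

theorem acc (c : Ctx G n m p M T x A B) {k : ℕ} (hk : p + 1 ≤ k + T) {W : List V}
    (hW : BP (gB G B) B W) (hc : cB B W = k) (hl : W.length ≤ 2 * p) : False := by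
  have step : ∀ j : ℕ, ∃ W, BP (gB G B) B W ∧ cB B W = k ∧ W.length ≤ 2 * p ∧
      ∀ v ∈ W.take j, v ∈ B := by
    intro j
    induction j with
    | zero => exact ⟨W, hW, hc, hl, by simp⟩
    | succ j ih =>
      clear hW hc hl W
      obtain ⟨W, hW, hc, hl, hj⟩ := ih
      obtain ⟨b, hb⟩ : ∃ b, W.head? = some b := by
        cases W with
        | nil => exact absurd rfl hW.ne
        | cons a t => exact ⟨a, by simp⟩
      have hbB := hW.hd b hb
      have h1 := c.cardNY (List.mem_of_mem_head? hb)
      have h3 := c.hδ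
      obtain ⟨w, hw⟩ := Finset.card_pos.1 (show 0 <
        ((Finset.univ.filter (G.Adj b)).filter (· ∉ W)).card by omega)
      simp only [Finset.mem_filter, Finset.mem_univ, true_and] at hw
      have hwB : w ∈ B := by
        by_contra hwB
        refine hw.2 (c.noA hW (by omega) hl (c.tri ?_ hwB) hb hw.1)
        rintro rfl
        exact c.xnB hbB hw.1.symm
      have hk1 : 1 ≤ k := by
        rw [← hc]
        cases W with
        | nil => exact absurd rfl hW.ne
        | cons a t =>
          obtain rfl : a = b := by simpa using hb
          simp [hbB]
      obtain ⟨W', hpre, hW', hc'⟩ := BP.pre (H := gB G B) (B := B) (l := w :: W) k hk1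
        (List.nodup_cons.2 ⟨hw.2, hW.nd⟩)
        (by
          rw [List.isChain_cons]
          refine ⟨?_, hW.ch⟩
          intro y hy
          rw [hb] at hy
          obtain rfl : b = y := by simpa using hy
          exact ⟨hw.1.symm, Or.inl hwB⟩)
        (by simpa using hwB) (by simp [hwB]; omega)
      refine ⟨W', hW', hc', ?_, ?_⟩
      · have h5 := hpre.length_le
        rcases Nat.lt_or_ge W'.length (w :: W).length with h | h
        · simp at h; omega
        · have := hpre.eq_of_length (le_antisymm h5 h)
          rw [this] at hc'
          simp [hwB] at hc'
          omega
      · intro v hv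
        have h6 : W'.take (j + 1) <+: (w :: W).take (j + 1) := hpre.take (j + 1)
        have h7 := h6.subset hv
        rw [List.take_succ_cons, List.mem_cons] at h7
        rcases h7 with rfl | h7
        exacts [hwB, hj v h7]
  clear hW hc hl W
  obtain ⟨W, hW, hc, hl, hj⟩ := step (2 * p)
  rw [List.take_of_length_le hl] at hj
  obtain ⟨b, hb⟩ : ∃ b, W.head? = some b := by
    cases W with
    | nil => exact absurd rfl hW.ne
    | cons a t => exact ⟨a, by simp⟩
  obtain ⟨a, ha, hba⟩ := c.exA (hW.hd b hb)
  exact c.AB ha (hj a (c.noA hW (by omega) hl ha hb hba))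

theorem exW (c : Ctx G n m p M T x A B) :
    ∃ W, BP (gB G B) B W ∧ cB B W = (p - T) + 1 := by
  refine lemE (hH G B) (p - T) (A ∪ B) ?_
  have hc : (A ∪ B).card = A.card + B.card :=
    Finset.card_union_of_disjoint (Finset.disjoint_left.2 fun v hv => c.AB hv)
  have hfil : (A ∪ B).filter (· ∈ B) = B := by
    ext v; simp only [Finset.mem_filter, Finset.mem_union]; tauto
  have h1 : B.card * (B.card + 1) ≤ fE (gB G B) B (A ∪ B) := by
    unfold fE
    rw [hfil, ← smul_eq_mul]
    apply Finset.card_nsmul_le_sum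
    intro b hb
    have h2 := c.lo b
    have : (Finset.univ.filter (G.Adj b)).card ≤ ((A ∪ B).filter ((gB G B).Adj b)).card := by
      apply Finset.card_le_card
      intro v hv
      simp only [Finset.mem_filter, Finset.mem_univ, true_and, Finset.mem_union] at hv ⊢
      refine ⟨?_, hv, Or.inl hb⟩
      by_cases hvB : v ∈ B
      · exact Or.inr hvB
      · refine Or.inl (c.tri ?_ hvB)
        rintro rfl
        exact c.xnB hb hv.symm
    omega
  refine lt_of_lt_of_le ?_ h1
  rw [hc, c.cA]
  have h2 := c.cBB
  have h3 := c.hδ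
  have h4 := c.hm
  have h5 := c.hp
  rcases Nat.lt_or_ge p T with h | h
  · rw [Nat.sub_eq_zero_of_le h.le, zero_mul]
    have : 0 < B.card := by omega
    positivity
  · obtain ⟨κ, hκ⟩ : ∃ κ, p = κ + T := ⟨p - T, by omega⟩
    rw [← h2, hκ, Nat.add_sub_cancel]
    rw [hκ] at h3
    nlinarith [Nat.zero_le (κ * T), Nat.zero_le κ, Nat.zero_le T, Nat.zero_le (T * T)]

theorem Tpos (c : Ctx G n m p M T x A B) (hT : 1 ≤ T) : False := by
  obtain ⟨W, hW, hc⟩ := c.exW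
  have h1 := hW.count (hH G B)
  have hp := c.hp
  exact c.acc (k := p - T + 1) (by omega) hW hc (by omega)

end Ctx
theorem dBB_pos (B : Finset V) (L R : List V) (z w : V) (hz : z ∈ B) (hw : w ∈ B) :
    1 ≤ dBB B (L ++ z :: w :: R) := by
  induction L with
  | nil => simp [dBB, hz, hw]
  | cons a L ih =>
    cases L with
    | nil => simp only [List.nil_append, List.cons_append, dBB] at ih ⊢; omega
    | cons b L => simp only [List.cons_append, dBB] at ih ⊢; omega

namespace Ctx

variable [Fintype V] {G : SimpleGraph V} [DecidableRel G.Adj] {n m p M T : ℕ}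
    {x : V} {A B : Finset V}

theorem alt (c : Ctx G n m p M 0 x A B) {W : List V} (hW : BP (gB G B) B W)
    (hc : cB B W = p + 1) : W.length = 2 * p + 1 ∧ dBB B W = 0 := by
  have h1 := hW.count (hH G B)
  have : ¬ W.length ≤ 2 * p := fun h => c.acc (k := p + 1) (by omega) hW hc h
  omega

theorem dir (c : Ctx G n m p M 0 x A B) {b b' : V} {l : List V} (nd : (b :: b' :: l).Nodup)
    (ch : (b :: b' :: l).IsChain (gB G B).Adj) (hb : b ∈ B) (hb' : b' ∈ B)
    (hc : p + 1 ≤ cB B (b :: b' :: l)) : False := by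
  have hp := c.hp
  obtain ⟨W, hpre, hW, hWc⟩ := BP.pre (p + 1) (by omega) nd ch (by simpa using hb) hc
  have := (c.alt hW hWc).2
  match W, hpre with
  | [], _ => simp at hWc
  | [w], h =>
    by_cases hw : w ∈ B <;> simp [hw] at hWc
    omega
  | w :: w' :: W', h =>
    rw [List.cons_prefix_cons, List.cons_prefix_cons] at h
    obtain ⟨rfl, rfl, -⟩ := h
    have := dBB_pos B [] W' w w' hb hb'
    rw [List.nil_append] at this
    omega

theorem twin (c : Ctx G n m p M 0 x A B) {W : List V} (hW : BP (gB G B) B W)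
    (hc : cB B W = p + 1) {b1 b0 : V} (hb1 : b1 ∈ W.head?) (hb0 : b0 ∈ B) : ¬ G.Adj b1 b0 := by
  intro hadj
  have hb1B := hW.hd b1 hb1
  have hH1 : (gB G B).Adj b1 b0 := ⟨hadj, Or.inr hb0⟩
  obtain ⟨hlen, hd0⟩ := c.alt hW hc
  by_cases h0 : b0 ∈ W
  · obtain ⟨L1, L2, rfl⟩ := List.append_of_mem h0
    rcases List.eq_nil_or_concat L1 with rfl | ⟨K, z, rfl⟩
    · obtain rfl : b0 = b1 := by simpa using hb1
      exact G.loopless.irrefl _ hadj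
    rw [List.concat_eq_append] at *
    have hz : z ∉ B := by
      intro hz
      have := dBB_pos B K L2 z b0 hz hb0
      simp only [List.append_assoc, List.singleton_append] at hd0
      omega
    rcases List.eq_nil_or_concat K with rfl | ⟨K', y, rfl⟩
    · obtain rfl : z = b1 := by simpa using hb1
      exact hz hb1B
    rw [List.concat_eq_append] at *
    have hch := hW.ch
    obtain ⟨c1, c2, c3⟩ := List.isChain_append.1 hch
    obtain ⟨e1, e2, e3⟩ := List.isChain_append.1 c1
    have hyz := e3 y (by simp) z (by simp)
    have hy : y ∈ B := hyz.2.resolve_right hz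
    have hb1' : b1 ∈ (K' ++ [y]).head? := by
      cases K' <;> simpa using hb1
    refine c.acc (k := p + 1) (by omega) (W := (K' ++ [y]).reverse ++ b0 :: L2)
      ⟨by simp, ?_, flip_chain e1 c2 hb1' hH1, by simpa using hy, ?_⟩ ?_ ?_
    · have hnd := hW.nd
      have pm : (z :: ((K' ++ [y]).reverse ++ b0 :: L2)).Perm (K' ++ [y] ++ [z] ++ b0 :: L2) := by
        have : K' ++ [y] ++ [z] ++ b0 :: L2 = (K' ++ [y]) ++ z :: b0 :: L2 := by simp
        rw [this]
        refine List.Perm.trans ?_ List.perm_middle.symm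
        exact List.Perm.cons _ (List.Perm.append_right _ (List.reverse_perm _))
      exact (List.nodup_cons.1 (pm.nodup_iff.2 hnd)).2
    · have := hW.lt
      rw [getLast?_app_cons] at this ⊢
      exact this
    · simp [hz, hy] at hc ⊢; omega
    · simp at hlen ⊢; omega
  · cases W with
    | nil => simp at hb1
    | cons a t =>
      obtain rfl : a = b1 := by simpa using hb1
      exact c.dir (List.nodup_cons.2 ⟨h0, hW.nd⟩)
        (List.isChain_cons_cons.2 ⟨hH1.symm, hW.ch⟩) hb0 hb1B
        (by rw [cB_cons, hc]; omega)

theorem full (c : Ctx G n m p M 0 x A B) {b : V} (hb : b ∈ B) (h : ∀ b0 ∈ B, ¬ G.Adj b b0) :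
    ∀ a ∈ A, G.Adj b a := by
  have hsub : Finset.univ.filter (G.Adj b) ⊆ A := by
    intro v hv
    simp only [Finset.mem_filter, Finset.mem_univ, true_and] at hv
    refine c.tri ?_ fun hvB => h v hvB hv
    rintro rfl
    exact c.xnB hb hv.symm
  have h1 := c.lo b
  have h2 := c.cA
  have h3 := c.cBB
  have := Finset.eq_of_subset_of_card_le hsub (by omega)
  intro a ha
  rw [← this] at ha
  simpa using ha

theorem twins (c : Ctx G n m p M 0 x A B) {W : List V} (hW : BP (gB G B) B W)
    (hc : cB B W = p + 1) {b : V} (hbW : b ∈ W) (hbB : b ∈ B) : ∀ b0 ∈ B, ¬ G.Adj b b0 := by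
  intro b0 hb0
  obtain ⟨hlen, hd0⟩ := c.alt hW hc
  obtain ⟨L1, L2, e⟩ := List.append_of_mem hbW
  cases L2 with
  | nil =>
    refine c.twin hW.rev (by simpa using hc) ?_ hb0
    simp [e]
  | cons a L2 =>
    have ha : a ∉ B := by
      intro ha
      have := dBB_pos B L1 L2 b a hbB ha
      rw [e] at hd0
      omega
    have haA : a ∈ A := c.tri (by rintro rfl; exact c.notx hW.ch hW.hd (by simp [e])) ha
    obtain ⟨b1, hb1⟩ : ∃ b1, b1 ∈ W.head? := by
      cases W with
      | nil => exact absurd rfl hW.ne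
      | cons a t => exact ⟨a, by simp⟩
    have hb1B := hW.hd b1 hb1
    have h1a := c.full hb1B (fun b0 hb0 => c.twin hW hc hb1 hb0) a haA
    have e' : W = (L1 ++ [b]) ++ a :: L2 := by simp [e]
    have hch := hW.ch
    rw [e'] at hch
    obtain ⟨c1, c2, c3⟩ := List.isChain_append.1 hch
    have hb1' : b1 ∈ (L1 ++ [b]).head? := by
      rw [e'] at hb1
      cases L1 <;> simpa using hb1
    have pm : ((L1 ++ [b]).reverse ++ a :: L2).Perm W := by
      rw [e']; exact List.Perm.append_right _ (List.reverse_perm _)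
    refine c.twin (W := (L1 ++ [b]).reverse ++ a :: L2)
      ⟨by simp, pm.nodup_iff.2 hW.nd, flip_chain c1 c2 hb1' ⟨h1a, Or.inl hb1B⟩,
        by simpa using hbB, ?_⟩ ?_ (by simp) hb0
    · have := hW.lt
      rw [e', getLast?_app_cons] at this
      rw [getLast?_app_cons]
      exact this
    · rw [← hc, cB, cB, pm.countP_eq]

theorem indep (c : Ctx G n m p M 0 x A B) {b b0 : V} (hb : b ∈ B) (hb0 : b0 ∈ B) :
    ¬ G.Adj b b0 := by
  intro hadj
  obtain ⟨W, hW, hc⟩ := c.exW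
  rw [Nat.sub_zero] at hc
  obtain ⟨hlen, hd0⟩ := c.alt hW hc
  have hbW : b ∉ W := fun h => c.twins hW hc h hb b0 hb0 hadj
  have hb0W : b0 ∉ W := fun h => c.twins hW hc h hb0 b hb hadj.symm
  have fl : ∀ b ∈ W, b ∈ B → ∀ a ∈ A, G.Adj b a := fun b hbW hbB =>
    c.full hbB (c.twins hW hc hbW hbB)
  have hne : b0 ≠ b := hadj.ne'
  obtain ⟨a, ha, hba⟩ := c.exA hb
  have haB := c.AB ha
  have hab0 : a ≠ b0 := fun h => haB (h ▸ hb0)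
  have hab : a ≠ b := fun h => haB (h ▸ hb)
  by_cases haW : a ∈ W
  · -- a fresh vertex of A
    have hcX := c.cardNX W
    have hδ := c.hδ
    have hcB := c.cBB
    have hm := c.hm
    obtain ⟨a', ha'⟩ := Finset.card_pos.1 (show 0 < (A.filter (· ∉ W)).card by omega)
    simp only [Finset.mem_filter] at ha'
    obtain ⟨ha', ha'W⟩ := ha'
    have ha'B := c.AB ha'
    obtain ⟨L1, L2, e⟩ := List.append_of_mem haW
    have hch := hW.ch
    have hnd := hW.nd
    have hlt := hW.lt
    have hhd := hW.hd
    rw [e] at hch hnd hlt hhd hbW hb0W ha'W hc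
    rw [e] at fl
    obtain ⟨c1, c2, c3⟩ := List.isChain_append.1 hch
    rw [List.isChain_cons] at c2
    refine c.dir (b := b0) (b' := b) (l := a :: (L2 ++ a' :: L1)) ?_ ?_ hb0 hb ?_
    · have pm : (b0 :: b :: a :: (L2 ++ a' :: L1)).Perm (b0 :: b :: a' :: (L1 ++ a :: L2)) := by
        refine List.Perm.cons _ (List.Perm.cons _ ?_)
        have h1 : (a :: (L2 ++ a' :: L1)).Perm (a' :: ((a :: L2) ++ L1)) :=
          List.perm_middle (l₁ := a :: L2)
        exact h1.trans (List.Perm.cons _ List.perm_append_comm)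
      rw [pm.nodup_iff, List.nodup_cons, List.nodup_cons, List.nodup_cons, List.mem_cons,
        List.mem_cons, List.mem_cons]
      have h2 : b0 ≠ a' := fun h => ha'B (h ▸ hb0)
      have h3 : b ≠ a' := fun h => ha'B (h ▸ hb)
      tauto
    · rw [List.isChain_cons_cons, List.isChain_cons_cons]
      refine ⟨⟨hadj.symm, Or.inl hb0⟩, ⟨hba, Or.inl hb⟩, ?_⟩
      have : (a :: L2 ++ a' :: L1).IsChain (gB G B).Adj := by
        rw [List.isChain_append]
        refine ⟨List.isChain_cons.2 c2, List.isChain_cons.2 ⟨?_, c1⟩, ?_⟩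
        · intro y hy
          have hyW : y ∈ L1 ++ a :: L2 := List.mem_append_left _ (List.mem_of_mem_head? hy)
          have hyB : y ∈ B := by
            apply hhd
            rw [List.head?_append]
            rw [Option.mem_def] at hy ⊢
            simp [hy]
          exact ⟨(fl y hyW hyB a' ha').symm, Or.inr hyB⟩
        · intro u hu y hy
          obtain rfl : a' = y := by simpa using hy
          have huW : u ∈ L1 ++ a :: L2 := List.mem_append_right _ (List.mem_of_mem_getLast? hu)
          have huB : u ∈ B := by
            apply hlt
            rw [getLast?_app_cons]; exact hu
          exact ⟨fl u huW huB a' ha', Or.inl huB⟩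
      simpa using this
    · simp [hb, hb0, haB, ha'B] at hc ⊢; omega
  · refine c.dir (b := b0) (b' := b) (l := a :: W) ?_ ?_ hb0 hb ?_
    · rw [List.nodup_cons, List.nodup_cons, List.nodup_cons, List.mem_cons, List.mem_cons,
        List.mem_cons]
      have := hW.nd
      have := hab.symm
      have := hab0.symm
      tauto
    · rw [List.isChain_cons_cons, List.isChain_cons_cons, List.isChain_cons]
      refine ⟨⟨hadj.symm, Or.inl hb0⟩, ⟨hba, Or.inl hb⟩, ?_, hW.ch⟩
      intro y hy
      have hyB := hW.hd y hy
      exact ⟨(fl y (List.mem_of_mem_head? hy) hyB a ha).symm, Or.inr hyB⟩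
    · simp [hb, hb0]; omega

theorem Tzero (c : Ctx G n m p M 0 x A B) : False := by
  have h1 := c.cA
  have h2 := c.cBB
  have h3 := c.hδ
  have hm := c.hm
  obtain ⟨a, ha⟩ := Finset.card_pos.1 (show 0 < A.card by omega)
  have h4 := c.hi a
  have : (insert x B).card ≤ (Finset.univ.filter (G.Adj a)).card := by
    apply Finset.card_le_card
    intro v hv
    simp only [Finset.mem_filter, Finset.mem_univ, true_and]
    rcases Finset.mem_insert.1 hv with rfl | hv
    · exact ((c.hA a).1 ha).symm
    · exact (c.full hv (fun b0 hb0 => c.indep hv hb0) a ha).symm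
  rw [Finset.card_insert_of_notMem c.xB] at this
  omega

theorem absurd (c : Ctx G n m p M T x A B) : False := by
  rcases Nat.eq_zero_or_pos T with rfl | h
  · exact c.Tzero
  · exact c.Tpos h

end Ctx

theorem lds_core [Fintype V] (n m p : ℕ) (hm : 1 ≤ m) (hp : 1 ≤ p)
    (hn : p + 1 ≤ n) (hV : Fintype.card V = 2 * (n + m + p) - 1) (G : SimpleGraph V)
    [DecidableRel G.Adj] (x : V) (D : ℕ) (hD : (Finset.univ.filter (G.Adj x)).card = D)
    (hDle : D ≤ 2 * n + m - 2) (hDge : n + m + p - 1 ≤ D)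
    (hi : ∀ v, (Finset.univ.filter (G.Adj v)).card ≤ D)
    (lo : ∀ v, Fintype.card V ≤ (Finset.univ.filter (G.Adj v)).card + D + 1) :
    HasCopy (LinkedDoubleStar (2 * p + 1) n m) G := by
  by_contra hno
  have hxA : x ∉ Finset.univ.filter (G.Adj x) := by simp
  have hcB : (Finset.univ \ insert x (Finset.univ.filter (G.Adj x))).card + (D + 1)
      = Fintype.card V := by
    rw [← hD, ← Finset.card_insert_of_notMem hxA,
      Finset.card_sdiff_add_card_eq_card (Finset.subset_univ _), Finset.card_univ]
  refine Ctx.absurd (G := G) (n := n) (m := m) (p := p) (M := n + m + p - 1)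
    (T := D - (n + m + p - 1)) (x := x) (A := Finset.univ.filter (G.Adj x))
    (B := Finset.univ \ insert x (Finset.univ.filter (G.Adj x)))
    ⟨by simp, ?_, by omega, by omega, by omega, hm, hp, ?_, ?_, by omega, hno⟩
  · intro v; simp
  · intro v; have := lo v; omega
  · intro v; have := hi v; omega

theorem deg_compl [Fintype V] (G : SimpleGraph V) [DecidableRel G.Adj] [DecidableRel Gᶜ.Adj]
    (v : V) : (Finset.univ.filter (G.Adj v)).card + (Finset.univ.filter (Gᶜ.Adj v)).card + 1
      = Fintype.card V := by
  have h1 : Finset.univ.filter (Gᶜ.Adj v)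
      = Finset.univ \ insert v (Finset.univ.filter (G.Adj v)) := by
    ext w
    simp only [Finset.mem_filter, Finset.mem_univ, true_and, Finset.mem_sdiff, Finset.mem_insert,
      SimpleGraph.compl_adj]
    rw [not_or, ne_comm]
  have h2 : v ∉ Finset.univ.filter (G.Adj v) := by simp
  have h3 := Finset.card_sdiff_add_card_eq_card
    (Finset.subset_univ (insert v (Finset.univ.filter (G.Adj v))))
  rw [Finset.card_insert_of_notMem h2, Finset.card_univ] at h3
  rw [h1]
  omega

end LDSProof

/-- on `2(n+m+p)−1` vertices, if both monochromatic degrees of every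
vertex are at most `2n + m − 2`, then there is a monochromatic `S_c(n,m)`
(here `G` is the graph of red edges, `Gᶜ` the graph of blue edges). -/
theorem lds_small_k (n m p : ℕ) (hm : 1 ≤ m) (hmn : m ≤ n) (hp : 1 ≤ p)
    (hn : p + 1 ≤ n) {V : Type*} [Fintype V]
    (hV : Fintype.card V = 2 * (n + m + p) - 1) (G : SimpleGraph V)
    (hdeg : ∀ v : V, ({w | G.Adj v w}).ncard ≤ 2 * n + m - 2 ∧
      ({w | Gᶜ.Adj v w}).ncard ≤ 2 * n + m - 2) :
    HasMonoLDS G (2 * p + 1) n m := by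
  classical
  have hc : ∀ (K : SimpleGraph V) [DecidableRel K.Adj] v, ({w | K.Adj v w}).ncard
      = (Finset.univ.filter (K.Adj v)).card := by
    intro K _ v
    rw [← Set.ncard_coe_finset]
    congr 1
    ext w; simp
  simp only [hc] at hdeg
  have hne : Nonempty V := Fintype.card_pos_iff.1 (by omega)
  obtain ⟨x, -, hx⟩ := Finset.exists_max_image (Finset.univ : Finset V)
    (fun v => max (Finset.univ.filter (G.Adj v)).card (Finset.univ.filter (Gᶜ.Adj v)).card)
    Finset.univ_nonempty
  have hx' : ∀ v, (Finset.univ.filter (G.Adj v)).card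
        ≤ max (Finset.univ.filter (G.Adj x)).card (Finset.univ.filter (Gᶜ.Adj x)).card
      ∧ (Finset.univ.filter (Gᶜ.Adj v)).card
        ≤ max (Finset.univ.filter (G.Adj x)).card (Finset.univ.filter (Gᶜ.Adj x)).card :=
    fun v => max_le_iff.1 (hx v (Finset.mem_univ v))
  have hdc := deg_compl G
  have hdx := hdc x
  have hb := hdeg x
  rcases le_total (Finset.univ.filter (Gᶜ.Adj x)).card (Finset.univ.filter (G.Adj x)).card
    with h | h
  · rw [max_eq_left h] at hx'
    left
    refine lds_core n m p hm hp hn hV G x _ rfl hb.1 (by omega) (fun v => (hx' v).1) ?_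
    intro v
    have h1 := hdc v
    have h2 := (hx' v).2
    omega
  · rw [max_eq_right h] at hx'
    right
    refine lds_core n m p hm hp hn hV Gᶜ x _ rfl hb.2 (by omega) (fun v => (hx' v).2) ?_
    intro v
    have h1 := hdc v
    have h2 := (hx' v).1
    omega
end

section
/- Let n ≥ m ≥ 1 and p ≥ 1 be integers with n ≥ p + 3, and set c = 2p+1. Consider a 2-coloring of the edges of the complete graph on a vertex set V with |V| = 2(n+m+p) − 1, and suppose u ∈ V satisfies red-d(u) ≥ red-d(v) and red-d(u) ≥ blue-d(v) for all v ∈ V, and red-d(u) ≥ n + m + 2p. If there is a red cycle on 2p+2 vertices contained in V \ {u} whose vertices alternate between R(u) and B(u) (so that exactly p+1 of its vertices, alternating along the cycle, lie in R(u)), then the coloring contains a monochromatic copy of S_c(n,m). -/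
open SimpleGraph

open Classical in
lemma hasCopy_of_path {V : Type*} [Fintype V] (H : SimpleGraph V) (c n m : ℕ) (hc : 1 ≤ c)
    (g : ℕ → V) (hinj : ∀ i j, i < c → j < c → g i = g j → i = j)
    (hadj : ∀ i, i + 1 < c → H.Adj (g i) (g (i + 1)))
    (S T : Finset V) (hS : ∀ x ∈ S, H.Adj (g 0) x) (hT : ∀ x ∈ T, H.Adj (g (c - 1)) x)
    (hS' : ∀ x ∈ S, ∀ i, i < c → g i ≠ x) (hT' : ∀ x ∈ T, ∀ i, i < c → g i ≠ x)
    (hcS : n + m ≤ S.card) (hcT : m ≤ T.card) : HasCopy (LinkedDoubleStar c n m) H := by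
  obtain ⟨T1, hT1, hT1c⟩ := Finset.exists_subset_card_eq hcT
  have h1 : n ≤ (S \ T1).card := by
    have := Finset.le_card_sdiff T1 S
    omega
  obtain ⟨S1, hS1, hS1c⟩ := Finset.exists_subset_card_eq h1
  let eS := (Finset.equivFinOfCardEq hS1c).symm
  let eT := (Finset.equivFinOfCardEq hT1c).symm
  have mS : ∀ i, (eS i : V) ∈ S ∧ (eS i : V) ∉ T1 := fun i => by
    have := hS1 (eS i).2
    simpa using this
  have mT : ∀ i, (eT i : V) ∈ T1 := fun i => (eT i).2
  let F : Fin c ⊕ Fin n ⊕ Fin m → V :=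
    Sum.elim (fun i => g i) (Sum.elim (fun i => (eS i : V)) (fun i => (eT i : V)))
  have key : ∀ a b, ldsRel c n m a b → H.Adj (F a) (F b) := by
    rintro (i | i | i) (j | j | j) h <;> simp only [ldsRel] at h
    · change H.Adj (g i) (g j)
      rw [h]
      exact hadj _ (by omega)
    · change H.Adj (g i) (eS j)
      rw [h]
      exact hS _ (mS j).1
    · change H.Adj (g i) (eT j)
      rw [h]
      exact hT _ (hT1 (mT j))
  refine ⟨F, ?_, ?_⟩
  · rintro (i | i | i) (j | j | j) h
    · have := hinj i j i.2 j.2 h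
      rw [Fin.ext this]
    · exact absurd h (hS' _ (mS j).1 i i.2)
    · exact absurd h (hT' _ (hT1 (mT j)) i i.2)
    · exact absurd h.symm (hS' _ (mS i).1 j j.2)
    · have := eS.injective (Subtype.ext h)
      rw [this]
    · have h' : (eS i : V) = eT j := h
      exact absurd (h' ▸ mT j) (mS i).2
    · exact absurd h.symm (hT' _ (hT1 (mT i)) j j.2)
    · have h' : (eT i : V) = eS j := h
      exact absurd (h' ▸ mT i) (mS j).2
    · have := eT.injective (Subtype.ext h)
      rw [this]
  · intro a b hab
    simp only [LinkedDoubleStar, SimpleGraph.fromRel_adj] at hab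
    rcases hab.2 with h | h
    · exact key _ _ h
    · exact (key _ _ h).symm

lemma zmod_add_inj {L : ℕ} (k : ZMod L) {a b : ℕ} (ha : a < L) (hb : b < L)
    (h : k + (a : ZMod L) = k + (b : ZMod L)) : a = b := by
  have h2 := add_left_cancel h
  rw [ZMod.natCast_eq_natCast_iff] at h2
  exact Nat.ModEq.eq_of_lt_of_lt h2 ha hb

/-- no red cycle of length `2p+2` avoiding `u` whose vertices
alternate between `R(u)` and `B(u)`, where `u` has maximum monochromatic degree
and `red-d(u) ≥ n + m + 2p`. -/
theorem lds_no_red_cycle_two (n m p : ℕ) (hm : 1 ≤ m) (hmn : m ≤ n) (hp : 1 ≤ p)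
    (hn : p + 3 ≤ n) {V : Type*} [Fintype V]
    (hV : Fintype.card V = 2 * (n + m + p) - 1) (G : SimpleGraph V) (u : V)
    (hmaxr : ∀ v : V, ({w | G.Adj v w}).ncard ≤ ({w | G.Adj u w}).ncard)
    (hmaxb : ∀ v : V, ({w | Gᶜ.Adj v w}).ncard ≤ ({w | G.Adj u w}).ncard)
    (hdu : n + m + 2 * p ≤ ({w | G.Adj u w}).ncard)
    (f : ZMod (2 * p + 2) → V) (hf : IsCycleMap G f) (hfu : ∀ i, f i ≠ u)
    (halt : ∀ i, G.Adj u (f i) ↔ Gᶜ.Adj u (f (i + 1))) :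
    HasMonoLDS G (2 * p + 1) n m := by
  classical
  obtain ⟨hfi, hfa⟩ := hf
  have hcomp : ∀ i, Gᶜ.Adj u (f i) ↔ ¬ G.Adj u (f i) := fun i => by
    rw [SimpleGraph.compl_adj]
    exact ⟨fun h => h.2, fun h => ⟨(hfu i).symm, h⟩⟩
  have hflip : ∀ i, G.Adj u (f (i + 1)) ↔ ¬ G.Adj u (f i) := fun i => by
    have := halt i
    rw [hcomp] at this
    tauto
  have hflip2 : ∀ i, G.Adj u (f (i + 2)) ↔ G.Adj u (f i) := fun i => by
    have h1 := hflip i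
    have h2 := hflip (i + 1)
    rw [show i + 1 + 1 = i + 2 by ring] at h2
    tauto
  have hzero : (2 * (p : ZMod (2 * p + 2)) + 2) = 0 := by
    have := ZMod.natCast_self (2 * p + 2)
    push_cast at this
    exact this
  by_contra hno
  rw [HasMonoLDS, not_or] at hno
  obtain ⟨hnoR, hnoB⟩ := hno
  let C : Finset V := Finset.univ.image f
  have hCc : C.card = 2 * p + 2 := by
    rw [Finset.card_image_of_injective _ hfi, Finset.card_univ, ZMod.card]
  let R : V → Finset V := fun v => Finset.univ.filter (G.Adj v)
  have hRu : n + m + 2 * p ≤ (R u).card := by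
    rw [Set.ncard_eq_toFinset_card'] at hdu
    convert hdu using 2
    ext x; simp [R]
  have hCk : (Finset.univ \ C).card = 2 * n + 2 * m - 3 := by
    rw [Finset.card_sdiff_of_subset (Finset.subset_univ _), Finset.card_univ, hV, hCc]
    omega
  -- red step: blue-side cycle vertices have few red neighbours outside the cycle
  have red : ∀ k, ¬ G.Adj u (f k) → (R (f k) \ C).card + 2 ≤ m := by
    intro k hk
    by_contra hlt
    apply hnoR
    let g : ℕ → V := fun i => if i = 0 then u else f (k + 2 + (i : ZMod (2 * p + 2)))
    have g0 : g 0 = u := by simp [g]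
    have gs : ∀ i, i ≠ 0 → g i = f (k + 2 + (i : ZMod (2 * p + 2))) := fun i hi => by simp [g, hi]
    have glast : g (2 * p + 1 - 1) = f k := by
      rw [gs _ (by omega)]
      congr 1
      simp only [Nat.add_sub_cancel]
      push_cast
      linear_combination hzero
    let P : Finset V := (Finset.range (2 * p + 1)).image g
    have hPc : P.card ≤ 2 * p + 1 := by
      simpa using (Finset.card_image_le (s := Finset.range (2 * p + 1)) (f := g))
    have hP : ∀ i, i < 2 * p + 1 → g i ∈ P := fun i hi =>
      Finset.mem_image_of_mem _ (Finset.mem_range.2 hi)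
    have huP : u ∈ P := by
      have := hP 0 (by omega)
      rwa [g0] at this
    refine hasCopy_of_path G (2 * p + 1) n m (by omega) g ?_ ?_ (R u \ P)
      (insert (f (k + 1)) (R (f k) \ C)) ?_ ?_ ?_ ?_ ?_ ?_
    · intro i j hi hj h
      rcases Nat.eq_zero_or_pos i with rfl | hi0 <;> rcases Nat.eq_zero_or_pos j with rfl | hj0
      · rfl
      · rw [g0, gs j (by omega)] at h
        exact absurd h.symm (hfu _)
      · rw [g0, gs i (by omega)] at h
        exact absurd h (hfu _)
      · rw [gs i (by omega), gs j (by omega)] at h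
        exact zmod_add_inj _ (by omega) (by omega) (hfi h)
    · intro i hi
      rcases Nat.eq_zero_or_pos i with rfl | hi0
      · rw [g0, gs _ (by omega)]
        have := hflip2 (k + 1)
        rw [hflip k] at this
        have h2 := this.2 hk
        convert h2 using 2
        push_cast
        ring
      · rw [gs i (by omega), gs _ (by omega)]
        convert hfa _ using 2
        push_cast
        ring
    · intro x hx
      rw [g0]
      simp only [R, Finset.mem_sdiff, Finset.mem_filter, Finset.mem_univ, true_and] at hx
      exact hx.1
    · intro x hx
      rw [glast]
      simp only [R, Finset.mem_insert, Finset.mem_sdiff, Finset.mem_filter, Finset.mem_univ,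
        true_and] at hx
      rcases hx with rfl | hx
      · exact hfa k
      · exact hx.1
    · intro x hx i hi h
      exact (Finset.mem_sdiff.1 hx).2 (h ▸ hP i hi)
    · intro x hx i hi h
      rcases Finset.mem_insert.1 hx with hx | hx
      · subst hx
        rcases Nat.eq_zero_or_pos i with rfl | hi0
        · rw [g0] at h
          exact hfu _ h.symm
        · rw [gs i (by omega)] at h
          have h2 : (k + 1) + ((i + 1 : ℕ) : ZMod (2 * p + 2)) = (k + 1) + ((0 : ℕ) : ZMod (2 * p + 2)) := by
            have h3 := hfi h
            push_cast
            linear_combination h3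
          have := zmod_add_inj _ (by omega) (by omega) h2
          omega
      · have hx2 := (Finset.mem_sdiff.1 hx)
        rcases Nat.eq_zero_or_pos i with rfl | hi0
        · rw [g0] at h
          subst h
          simp only [R, Finset.mem_filter] at hx2
          exact hk hx2.1.2.symm
        · rw [gs i (by omega)] at h
          exact hx2.2 (h ▸ Finset.mem_image_of_mem _ (Finset.mem_univ _))
    · have h1 : (R u \ P) = R u \ (P.erase u) := by
        ext x
        simp only [R, Finset.mem_sdiff, Finset.mem_filter, Finset.mem_erase, Finset.mem_univ, true_and]
        constructor
        · rintro ⟨a, b⟩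
          exact ⟨a, fun h => b h.2⟩
        · rintro ⟨a, b⟩
          exact ⟨a, fun h => b ⟨a.ne', h⟩⟩
      rw [h1]
      have h2 := Finset.le_card_sdiff (P.erase u) (R u)
      rw [Finset.card_erase_of_mem huP] at h2
      omega
    · rw [Finset.card_insert_of_notMem]
      · omega
      · intro h
        exact (Finset.mem_sdiff.1 h).2 (Finset.mem_image_of_mem _ (Finset.mem_univ _))
  -- blue step
  obtain ⟨k, hk⟩ : ∃ k, ¬ G.Adj u (f k) := by
    by_cases h : G.Adj u (f 0)
    · exact ⟨0 + 1, fun h' => (hflip 0).1 h' h⟩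
    · exact ⟨0, h⟩
  let y : ℕ → V := fun j => f (k + ((2 * j : ℕ) : ZMod (2 * p + 2)))
  have hyu : ∀ j, ¬ G.Adj u (y j) := by
    intro j
    induction j with
    | zero => simpa [y] using hk
    | succ j ih =>
      intro h
      apply ih
      rw [← hflip2]
      convert h using 2
      push_cast
      ring
  have hyC : ∀ j, y j ∈ C := fun j => Finset.mem_image_of_mem _ (Finset.mem_univ _)
  have hyinj : ∀ i j, i ≤ p → j ≤ p → y i = y j → i = j := by
    intro i j hi hj h
    have := zmod_add_inj _ (by omega) (by omega) (hfi h)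
    omega
  have hyr : ∀ j, (R (y j) \ C).card + 2 ≤ m := fun j => red _ (hyu j)
  let A : ℕ → Finset V := fun j => (Finset.univ \ C) \ (R (y j) \ C)
  have hAc : ∀ j, 2 * n + m - 1 ≤ (A j).card := fun j => by
    have h1 := Finset.le_card_sdiff (R (y j) \ C) (Finset.univ \ C)
    have h2 := hyr j
    simp only [A]
    omega
  have hA : ∀ j x, x ∈ A j → x ∉ C ∧ Gᶜ.Adj (y j) x := by
    intro j x hx
    simp only [A, R, Finset.mem_sdiff, Finset.mem_filter, Finset.mem_univ, true_and] at hx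
    refine ⟨hx.1, ?_⟩
    rw [SimpleGraph.compl_adj]
    refine ⟨fun h => hx.1 (h ▸ hyC j), fun h => hx.2 ⟨h, hx.1⟩⟩
  let B : Fin p → Finset V := fun j => A j \ (R (y (j + 1)) \ C)
  have hBc : ∀ j, p ≤ (B j).card := fun j => by
    have h1 := Finset.le_card_sdiff (R (y (j + 1)) \ C) (A j)
    have h2 := hyr (j + 1)
    have h3 := hAc j
    simp only [B]
    omega
  have hB : ∀ j x, x ∈ B j → x ∈ A j ∧ x ∈ A (j + 1) := by
    intro j x hx
    simp only [A, B, Finset.mem_sdiff] at hx ⊢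
    tauto
  obtain ⟨z, hzi, hz⟩ := (Finset.all_card_le_biUnion_card_iff_exists_injective B).1 (by
    intro s
    rcases s.eq_empty_or_nonempty with rfl | ⟨a, ha⟩
    · simp
    · calc s.card ≤ p := by simpa using Finset.card_le_univ s
        _ ≤ (B a).card := hBc a
        _ ≤ _ := Finset.card_le_card (Finset.subset_biUnion_of_mem B ha))
  let Z : Finset V := Finset.univ.image z
  have hZc : Z.card ≤ p := by
    simpa using (Finset.card_image_le (s := Finset.univ) (f := z))
  let g : ℕ → V := fun i => if h : i % 2 = 1 ∧ i / 2 < p then z ⟨i / 2, h.2⟩ else y (i / 2)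
  have ge : ∀ j, g (2 * j) = y j := fun j => by
    have h1 : ¬ (2 * j % 2 = 1 ∧ 2 * j / 2 < p) := by omega
    have h2 : 2 * j / 2 = j := by omega
    simp only [g, dif_neg h1, h2]
  have go : ∀ j (h : j < p), g (2 * j + 1) = z ⟨j, h⟩ := fun j h => by
    have h2 : (2 * j + 1) / 2 = j := by omega
    have h1 : ((2 * j + 1) % 2 = 1 ∧ (2 * j + 1) / 2 < p) := by omega
    simp only [g, dif_pos h1, h2]
  have hgm : ∀ i, i < 2 * p + 1 → g i ∈ C ∪ Z := by
    intro i hi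
    rcases Nat.even_or_odd' i with ⟨j, rfl | rfl⟩
    · rw [ge]
      exact Finset.mem_union_left _ (hyC j)
    · rw [go j (by omega)]
      exact Finset.mem_union_right _ (Finset.mem_image_of_mem _ (Finset.mem_univ _))
  have hzC : ∀ j, z j ∉ C := fun j => (hA _ _ (hB _ _ (hz j)).1).1
  have hdisj : ∀ j x, x ∈ A j \ Z → ∀ i, i < 2 * p + 1 → g i ≠ x := by
    intro j x hx i hi h
    rw [Finset.mem_sdiff] at hx
    rcases Finset.mem_union.1 (hgm i hi) with h' | h'
    · exact (hA j x hx.1).1 (h ▸ h')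
    · exact hx.2 (h ▸ h')
  have hAZ : ∀ j, n + m ≤ (A j \ Z).card := fun j => by
    have h1 := Finset.le_card_sdiff Z (A j)
    have h2 := hAc j
    omega
  apply hnoB
  refine hasCopy_of_path Gᶜ (2 * p + 1) n m (by omega) g ?_ ?_ (A 0 \ Z) (A p \ Z) ?_ ?_
    (hdisj 0) (hdisj p) (hAZ 0) (by have := hAZ p; omega)
  · intro i j hi hj h
    rcases Nat.even_or_odd' i with ⟨a, rfl | rfl⟩ <;> rcases Nat.even_or_odd' j with ⟨b, rfl | rfl⟩
    · rw [ge, ge] at h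
      rw [hyinj a b (by omega) (by omega) h]
    · rw [ge, go b (by omega)] at h
      exact absurd (h ▸ hyC a) (hzC _)
    · rw [ge, go a (by omega)] at h
      exact absurd (h ▸ hyC b) (hzC _)
    · rw [go a (by omega), go b (by omega)] at h
      have := congrArg Fin.val (hzi h)
      simp only at this
      omega
  · intro i hi
    rcases Nat.even_or_odd' i with ⟨a, rfl | rfl⟩
    · rw [ge, go a (by omega)]
      exact (hA _ _ (hB _ _ (hz ⟨a, by omega⟩)).1).2
    · rw [show 2 * a + 1 + 1 = 2 * (a + 1) by ring, ge, go a (by omega)]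
      exact (hA _ _ (hB _ _ (hz ⟨a, by omega⟩)).2).2.symm
  · intro x hx
    have := ge 0
    rw [mul_zero] at this
    rw [this]
    exact (hA _ _ (Finset.mem_sdiff.1 hx).1).2
  · intro x hx
    rw [Nat.add_sub_cancel, ge]
    exact (hA _ _ (Finset.mem_sdiff.1 hx).1).2
end

section
/- Let n ≥ m ≥ 2 and p ≥ 1 be integers with n ≥ p + 3, and set c = 2p+1. Consider a 2-coloring of the edges of the complete graph on a vertex set V with |V| = 2(n+m+p) − 1, and suppose u ∈ V satisfies red-d(u) ≥ red-d(v) and red-d(u) ≥ blue-d(v) for all v ∈ V, and red-d(u) ≥ n + m + 2p. Suppose there is a vertex v ∈ R(u) and a set A' ⊆ R(u) \ {v} with |A'| = m + 2p such that every edge between v and A' is blue (so v is the center of a blue (m+2p)-star with spoke set A' inside R(u)), and suppose further that there is a blue cycle Q on 2p vertices, all of whose vertices lie in R(u), with v not on Q and |A' ∩ V(Q)| ≥ p + 1. Then the coloring contains a monochromatic copy of S_c(n,m). -/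
open SimpleGraph

def Seg {V : Type*} (R : V → V → Prop) (a b : V) (l : List V) : Prop :=
  l.IsChain R ∧ l.head? = some a ∧ l.getLast? = some b

theorem Seg.single {V : Type*} {R : V → V → Prop} (a : V) : Seg R a a [a] := by
  simp [Seg]

theorem Seg.append {V : Type*} {R : V → V → Prop} {a b c d : V} {l l' : List V}
    (h : Seg R a b l) (h' : Seg R c d l') (hbc : R b c) : Seg R a d (l ++ l') := by
  obtain ⟨h1, h2, h3⟩ := h
  obtain ⟨h1', h2', h3'⟩ := h'
  refine ⟨?_, ?_, ?_⟩
  · rw [List.isChain_append]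
    refine ⟨h1, h1', ?_⟩
    intro x hx y hy
    rw [h3] at hx; rw [h2'] at hy
    simp at hx hy
    subst hx; subst hy; exact hbc
  · simp [List.head?_append, h2]
  · simp [List.getLast?_append, h3']

theorem Seg.cons {V : Type*} {R : V → V → Prop} {a c d : V} {l' : List V}
    (hbc : R a c) (h' : Seg R c d l') : Seg R a d (a :: l') :=
  Seg.append (Seg.single a) h' hbc

theorem Seg.reverse {V : Type*} {R : V → V → Prop} (hR : ∀ x y, R x y → R y x) {a b : V}
    {l : List V} (h : Seg R a b l) : Seg R b a l.reverse := by
  obtain ⟨h1, h2, h3⟩ := h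
  refine ⟨?_, ?_, ?_⟩
  · rw [List.isChain_reverse]
    exact h1.imp (fun _ _ hxy => hR _ _ hxy)
  · simpa using h3
  · simpa using h2

theorem Seg.mono {V : Type*} {R R' : V → V → Prop} (hR : ∀ x y, R x y → R' x y) {a b : V}
    {l : List V} (h : Seg R a b l) : Seg R' a b l :=
  ⟨h.1.imp (fun _ _ hxy => hR _ _ hxy), h.2⟩

theorem Seg.split {V : Type*} {R : V → V → Prop} {a b y : V} {S T : List V}
    (h : Seg R a b (S ++ y :: T)) (ha : y ≠ a) (hb : y ≠ b) :
    ∃ p q, Seg R a p S ∧ R p y ∧ R y q ∧ Seg R q b T := by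
  obtain ⟨h1, h2, h3⟩ := h
  rw [List.isChain_append] at h1
  obtain ⟨c1, c2, c3⟩ := h1
  rcases List.eq_nil_or_concat S with rfl | ⟨S', p, rfl⟩
  · simp at h2; exact absurd h2 ha
  rcases T with _ | ⟨q, T'⟩
  · simp at h3; exact absurd h3 hb
  refine ⟨p, q, ⟨c1, ?_, by simp⟩, ?_, ?_, ?_, by simp, ?_⟩
  · rw [← h2]; simp [List.head?_append]
  · exact c3 p (by simp) y (by simp)
  · simp at c2; exact c2.1
  · simp at c2; exact c2.2
  · rw [← h3]; simp [List.getLast?_append, List.getLast?_cons]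

/-- A path with two disjoint stars at its ends gives a linked double star. -/
theorem hasCopy_of_seg {V : Type*} [DecidableEq V] (H : SimpleGraph V) (c n m : ℕ)
    (a b : V) (l : List V)
    (hl : Seg H.Adj a b l) (hlen : l.length = c) (hnd : l.Nodup) (A B : Finset V)
    (hA : A.card = n) (hB : B.card = m) (hAB : Disjoint A B)
    (hAl : ∀ x ∈ A, x ∉ l) (hBl : ∀ x ∈ B, x ∉ l)
    (hAa : ∀ x ∈ A, H.Adj a x) (hBb : ∀ x ∈ B, H.Adj b x) :
    HasCopy (LinkedDoubleStar c n m) H := by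
  subst hlen
  let eA : Fin n ≃ A := (Fintype.equivFinOfCardEq (by simp [hA])).symm
  let eB : Fin m ≃ B := (Fintype.equivFinOfCardEq (by simp [hB])).symm
  obtain ⟨h1, h2, h3⟩ := hl
  let f : (Fin l.length ⊕ Fin n ⊕ Fin m) → V :=
    Sum.elim (fun i => l[i]) (Sum.elim (fun i => (eA i : V)) (fun i => (eB i : V)))
  have key : ∀ s t, ldsRel l.length n m s t → H.Adj (f s) (f t) := by
    rintro (i | i | i) (j | j | j) hr <;> simp only [ldsRel] at hr
    · simp only [f, Sum.elim_inl]
      have := List.isChain_iff_getElem.1 h1 i (by omega)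
      simpa [hr] using this
    · simp only [f, Sum.elim_inl, Sum.elim_inr]
      have hi : l[i] = a := by
        have : l[(i:ℕ)] = a := by
          simp only [hr]
          rw [List.head?_eq_getElem?] at h2
          exact (List.getElem?_eq_some_iff.1 h2).2
        simpa using this
      rw [hi]; exact hAa _ (eA j).2
    · simp only [f, Sum.elim_inl, Sum.elim_inr]
      have hi : l[i] = b := by
        have : l[(i:ℕ)] = b := by
          simp only [hr]
          rw [List.getLast?_eq_getElem?] at h3
          exact (List.getElem?_eq_some_iff.1 h3).2
        simpa using this
      rw [hi]; exact hBb _ (eB j).2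
  refine ⟨f, ?_, ?_⟩
  · rintro (i | i | i) (j | j | j) hij <;> simp only [f, Sum.elim_inl, Sum.elim_inr] at hij
    · congr 1
      exact Fin.ext ((List.Nodup.getElem_inj_iff hnd).1 hij)
    · exact absurd (hij ▸ List.getElem_mem _) (hAl _ (eA j).2)
    · exact absurd (hij ▸ List.getElem_mem _) (hBl _ (eB j).2)
    · exact absurd (hij ▸ List.getElem_mem _) (hAl _ (eA i).2)
    · congr 2
      exact eA.injective (Subtype.ext hij)
    · exact absurd (eB j).2 (Finset.disjoint_left.1 hAB (hij ▸ (eA i).2))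
    · exact absurd (hij ▸ List.getElem_mem _) (hBl _ (eB i).2)
    · exact absurd (eB i).2 (Finset.disjoint_left.1 hAB (hij ▸ (eA j).2))
    · congr 2
      exact eB.injective (Subtype.ext hij)
  · intro s t hst
    rw [LinkedDoubleStar, SimpleGraph.fromRel_adj] at hst
    rcases hst.2 with h | h
    · exact key _ _ h
    · exact (key _ _ h).symm

/-- Alternating chains: number of vertices in terms of the number of `Y` vertices. -/
theorem alt_count {V : Type*} [DecidableEq V] {R : V → V → Prop} {X Y : Finset V}
    (hXY : Disjoint X Y) (hE : ∀ a b, R a b → (a ∈ X ∧ b ∈ Y) ∨ (a ∈ Y ∧ b ∈ X))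
    (b : V) (hb : b ∈ X) (l : List V) : ∀ a, Seg R a b l →
    (a ∈ X → l.length = 2 * l.countP (· ∈ Y) + 1) ∧ (a ∈ Y → l.length = 2 * l.countP (· ∈ Y)) := by
  induction l with
  | nil => intro a h; simp [Seg] at h
  | cons c l ih =>
    intro a h
    obtain ⟨h1, h2, h3⟩ := h
    simp at h2; subst h2
    rcases l with _ | ⟨d, l⟩
    · simp at h3; subst h3
      have : c ∉ Y := Finset.disjoint_left.1 hXY hb
      simp [this]
    · have hcd : R c d := by simp at h1; exact h1.1
      have hs : Seg R d b (d :: l) := by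
        refine ⟨by simp at h1; exact h1.2, by simp, ?_⟩
        rw [← h3]; simp [List.getLast?_cons]
      obtain ⟨i1, i2⟩ := ih d hs
      constructor
      · intro hc
        have hcY : c ∉ Y := Finset.disjoint_left.1 hXY hc
        have hd : d ∈ Y := by
          rcases hE _ _ hcd with h | h
          · exact h.2
          · exact absurd h.1 hcY
        have := i2 hd
        have e := List.countP_cons_of_neg (p := fun x => decide (x ∈ Y)) (a := c) (l := d :: l)
          (by simpa using hcY)
        rw [List.length_cons, this, e]
      · intro hc
        have hcX : c ∉ X := Finset.disjoint_right.1 hXY hc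
        have hd : d ∈ X := by
          rcases hE _ _ hcd with h | h
          · exact absurd h.1 hcX
          · exact h.2
        have := i1 hd
        have e := List.countP_cons_of_pos (p := fun x => decide (x ∈ Y)) (a := c) (l := d :: l)
          (by simpa using hc)
        rw [List.length_cons, this, e]
        omega

theorem alt_card {V : Type*} [DecidableEq V] {R : V → V → Prop} {X Y : Finset V}
    (hXY : Disjoint X Y) (hE : ∀ a b, R a b → (a ∈ X ∧ b ∈ Y) ∨ (a ∈ Y ∧ b ∈ X))
    {a b : V} (ha : a ∈ X) (hb : b ∈ X) {l : List V} (h : Seg R a b l) (hnd : l.Nodup) :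
    l.length = 2 * (Y.filter (· ∈ l)).card + 1 := by
  rw [((alt_count hXY hE b hb l a h).1 ha), List.countP_eq_length_filter]
  congr 2
  rw [← List.toFinset_card_of_nodup (hnd.filter _)]
  congr 1
  ext x; simp [and_comm]

/-- Extending an alternating path (the core of a Jackson-type theorem on paths covering one side
of a bipartite graph). -/
theorem alt_extend {V : Type*} [DecidableEq V] {R : V → V → Prop} {X Y : Finset V}
    (hXY : Disjoint X Y) (hE : ∀ a b, R a b → (a ∈ X ∧ b ∈ Y) ∨ (a ∈ Y ∧ b ∈ X))
    (hR : ∀ a b, R a b → R b a) (κ : ℕ)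
    (hdeg : ∀ x ∈ X, ∃ S ⊆ Y, κ ≤ S.card ∧ ∀ y ∈ S, R x y) (hY : Y.card + 1 ≤ 2 * κ)
    {a b x : V} (ha : a ∈ X) (hb : b ∈ X) {l : List V} (h : Seg R a b l) (hnd : l.Nodup)
    (ℓ : ℕ) (hℓ : l.length + 1 = 2 * ℓ) (hκ : ℓ ≤ κ) (hx : x ∈ X) (hxl : x ∉ l) :
    ∃ a' ∈ X, ∃ b' ∈ X, ∃ l', Seg R a' b' l' ∧ l'.Nodup ∧ l'.length = l.length + 2 := by
  classical
  by_contra hno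
  have hYX : ∀ {y}, y ∈ Y → y ∉ X := fun hy => Finset.disjoint_right.1 hXY hy
  have hXY' : ∀ {y}, y ∈ X → y ∉ Y := fun hy => Finset.disjoint_left.1 hXY hy
  have nx : ∀ {y q}, y ∈ Y → R y q → q ∈ X := by
    intro y q hy hyq
    rcases hE _ _ hyq with h | h
    · exact absurd h.1 (hYX hy)
    · exact h.2
  have key : ∀ z ∈ Y, z ∉ l → ∀ l' a' b', a' ∈ X → b' ∈ X → Seg R a' b' l' →
      l'.Perm (x :: z :: l) → False := by
    intro z hz hzl l' a' b' ha' hb' hs hp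
    apply hno
    refine ⟨a', ha', b', hb', l', hs, ?_, by simpa using hp.length_eq⟩
    rw [hp.nodup_iff]
    simp only [List.nodup_cons, List.mem_cons, not_or]
    exact ⟨⟨fun e => hYX hz (e ▸ hx), hxl⟩, hzl, hnd⟩
  -- splitting at a `Y` vertex
  have sp : ∀ {a b y S T}, a ∈ X → b ∈ X → y ∈ Y → Seg R a b (S ++ y :: T) →
      ∃ p q, p ∈ X ∧ q ∈ X ∧ Seg R a p S ∧ R p y ∧ R y q ∧ Seg R q b T := by
    intro a b y S T ha hb hy hs
    obtain ⟨p, q, h1, h2, h3, h4⟩ := hs.split (fun e => hYX hy (e ▸ ha)) (fun e => hYX hy (e ▸ hb))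
    exact ⟨p, q, nx hy (hR _ _ h2), nx hy h3, h1, h2, h3, h4⟩
  have c1 : ∀ z ∈ Y, z ∉ l → R x z → R a z → False := by
    intro z hz hzl h1 h2
    exact key z hz hzl (x :: z :: l) x b hx hb (Seg.cons h1 (Seg.cons (hR _ _ h2) h))
      (List.Perm.refl _)
  have c2 : ∀ z ∈ Y, z ∉ l → R x z → R b z → False := by
    intro z hz hzl h1 h2
    refine key z hz hzl (x :: z :: l.reverse) x a hx ha
      (Seg.cons h1 (Seg.cons (hR _ _ h2) (h.reverse hR))) ?_
    exact ((List.reverse_perm l).cons z).cons x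
  have c3 : ∀ z ∈ Y, z ∉ l → R a z → R b z → False := by
    intro z hz hzl h1 h2
    have hxn : ∀ y ∈ Y, R x y → y ∉ l := by
      intro y hy hxy hyl
      obtain ⟨S, T, rfl⟩ := List.append_of_mem hyl
      obtain ⟨p, q, hp, hq, s1, e1, e2, s2⟩ := sp ha hb hy h
      refine key z hz hzl (x :: y :: (T ++ z :: S)) x p hx hp
        (Seg.cons hxy (Seg.cons e2 (s2.append (Seg.cons (hR _ _ h1) s1) h2))) ?_
      rw [List.perm_iff_count]; intro w
      simp only [List.count_append, List.count_cons]; omega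
    obtain ⟨S, hS, hSc, hSR⟩ := hdeg x hx
    obtain ⟨T, hT, hTc, hTR⟩ := hdeg a ha
    have : (S ∩ T).Nonempty := by
      rw [← Finset.card_pos]
      have := Finset.card_union_add_card_inter S T
      have := Finset.card_le_card (Finset.union_subset hS hT)
      omega
    obtain ⟨y, hy⟩ := this
    rw [Finset.mem_inter] at hy
    exact c1 y (hS hy.1) (hxn y (hS hy.1) (hSR _ hy.1)) (hSR _ hy.1) (hTR _ hy.2)
  -- one cut vertex
  have c4 : ∀ S T y q, l = S ++ y :: T → y ∈ Y → R x y → R a y → R b y → T.head? = some q →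
      ∀ z ∈ Y, z ∉ l → R q z → ¬ R x z ∧ ¬ R a z := by
    intro S T y q hl hy hxy hay hby hq z hz hzl hqz
    subst hl
    obtain ⟨p, q', hp, hq', s1, e1, e2, s2⟩ := sp ha hb hy h
    have : q' = q := by have := s2.2.1; rw [hq] at this; simpa using this.symm
    subst this
    constructor
    · intro h1
      refine key z hz hzl (x :: z :: (T ++ y :: S)) x p hx hp
        (Seg.cons h1 (Seg.cons (hR _ _ hqz) (s2.append (Seg.cons (hR _ _ hay) s1) hby))) ?_
      rw [List.perm_iff_count]; intro w
      simp only [List.count_append, List.count_cons]; omega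
    · intro h1
      refine key z hz hzl (S.reverse ++ z :: (T ++ y :: [x])) p x hp hx
        ((s1.reverse hR).append (Seg.cons (hR _ _ hqz) (s2.append
          (Seg.cons (hR _ _ hxy) (Seg.single x)) hby)) h1) ?_
      rw [List.perm_iff_count]; intro w
      simp only [List.count_append, List.count_cons, List.count_reverse, List.count_nil]; omega
  -- two cut vertices
  have c5 : ∀ S T U y y' q q', l = S ++ y :: (T ++ y' :: U) → y ∈ Y → y' ∈ Y →
      R x y → R a y → R b y → R x y' → R a y' → R b y' → T.head? = some q → U.head? = some q' →
      ∀ z ∈ Y, z ∉ l → R q z → ¬ R b z ∧ ¬ R q' z := by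
    intro S T U y y' q q' hl hy hy' hxy hay hby hxy' hay' hby' hq hq' z hz hzl hqz
    subst hl
    obtain ⟨p, q1, hp, hq1, s1, e1, e2, s2⟩ := sp ha hb hy h
    obtain ⟨p', q1', hp', hq1', s1', e1', e2', s2'⟩ := sp hq1 hb hy' s2
    have : q1 = q := by have := s1'.2.1; rw [hq] at this; simpa using this.symm
    subst this
    have : q1' = q' := by have := s2'.2.1; rw [hq'] at this; simpa using this.symm
    subst this
    constructor
    · intro h1
      refine key z hz hzl (U ++ z :: (T ++ y' :: x :: y :: S)) q1' p hq1' hp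
        (s2'.append (Seg.cons (hR _ _ hqz) (s1'.append (Seg.cons (hR _ _ hxy') (Seg.cons hxy
          (Seg.cons (hR _ _ hay) s1))) e1')) h1) ?_
      rw [List.perm_iff_count]; intro w
      simp only [List.count_append, List.count_cons]; omega
    · intro h1
      refine key z hz hzl (U.reverse ++ z :: (T ++ y' :: x :: y :: S)) b p hb hp
        ((s2'.reverse hR).append (Seg.cons (hR _ _ hqz) (s1'.append (Seg.cons (hR _ _ hxy')
          (Seg.cons hxy (Seg.cons (hR _ _ hay) s1))) e1')) h1) ?_
      rw [List.perm_iff_count]; intro w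
      simp only [List.count_append, List.count_cons, List.count_reverse]; omega
  -- index version
  let f : ℕ → V := fun i => l.getD i x
  have hf : ∀ i (hi : i < l.length), f i = l[i] := by
    intro i hi; simp [f, hi]
  have hfinj : ∀ i j, i < l.length → j < l.length → f i = f j → i = j := by
    intro i j hi hj hij
    rw [hf i hi, hf j hj] at hij
    exact (List.Nodup.getElem_inj_iff hnd).1 hij
  have hpos : 0 < l.length := by omega
  have hf0 : f 0 = a := by
    rw [hf 0 hpos]
    have := h.2.1
    rw [List.head?_eq_getElem?] at this
    exact (List.getElem?_eq_some_iff.1 this).2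
  have hfl : f (l.length - 1) = b := by
    rw [hf _ (by omega)]
    have := h.2.2
    rw [List.getLast?_eq_getElem?] at this
    exact (List.getElem?_eq_some_iff.1 this).2
  let P : V → Prop := fun y => y ∈ Y ∧ R x y ∧ R a y ∧ R b y
  let I : Finset ℕ := (Finset.range l.length).filter (fun i => P (f i))
  have hI : ∀ i ∈ I, i + 1 < l.length ∧ P (f i) := by
    intro i hi
    simp only [I, Finset.mem_filter, Finset.mem_range] at hi
    refine ⟨?_, hi.2⟩
    by_contra hc
    have : i = l.length - 1 := by omega
    rw [this, hfl] at hi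
    exact hYX hi.2.1 hb
  have split1 : ∀ i, i + 1 < l.length →
      l = l.take i ++ f i :: l.drop (i+1) ∧ (l.drop (i+1)).head? = some (f (i+1)) := by
    intro i hi
    refine ⟨?_, ?_⟩
    · rw [hf i (by omega), ← List.drop_eq_getElem_cons (by omega), List.take_append_drop]
    · rw [List.head?_drop, hf _ hi]; simp [hi]
  have d1 : ∀ i ∈ I, ∀ z ∈ Y, z ∉ l → R (f (i+1)) z → ¬ R x z ∧ ¬ R a z := by
    intro i hi
    obtain ⟨h1, h2, h3, h4, h5⟩ := hI i hi
    obtain ⟨s1, s2⟩ := split1 i h1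
    exact c4 _ _ _ _ s1 h2 h3 h4 h5 s2
  have d2 : ∀ i ∈ I, ∀ j ∈ I, i < j → ∀ z ∈ Y, z ∉ l → R (f (i+1)) z →
      ¬ R b z ∧ ¬ R (f (j+1)) z := by
    intro i hi j hj hij
    obtain ⟨h1, h2, h3, h4, h5⟩ := hI i hi
    obtain ⟨h1', h2', h3', h4', h5'⟩ := hI j hj
    obtain ⟨s1, s2⟩ := split1 i h1
    obtain ⟨s1', s2'⟩ := split1 j h1'
    have hij1 : i + 1 < j := by
      rcases Nat.lt_or_ge (i+1) j with hlt | hge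
      · exact hlt
      · exfalso
        have : j = i + 1 := by omega
        subst this
        have hc := List.isChain_iff_getElem.1 h.1 i h1
        rw [← hf, ← hf] at hc
        exact hYX h2' (nx h2 hc)
    have e : l.drop (i+1) = (l.drop (i+1)).take (j - (i+1)) ++ f j :: l.drop (j+1) := by
      have : f j :: l.drop (j+1) = (l.drop (i+1)).drop (j - (i+1)) := by
        rw [List.drop_drop, hf j (by omega), ← List.drop_eq_getElem_cons (by omega)]
        congr 1; omega
      rw [this, List.take_append_drop]
    have hT : ((l.drop (i+1)).take (j - (i+1))).head? = some (f (i+1)) := by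
      rw [List.head?_take, s2, if_neg (by omega)]
    exact c5 _ _ _ _ _ _ _ (e ▸ s1) h2 h2' h3 h4 h5 h3' h4' h5' hT s2'
  obtain ⟨J, hJI, hJc, hJ⟩ : ∃ J ⊆ I, I.card ≤ J.card + 1 ∧ ∀ i ∈ J, ∃ j ∈ I, i < j := by
    rcases I.eq_empty_or_nonempty with h0 | h0
    · exact ⟨∅, by simp, by simp [h0], by simp⟩
    · refine ⟨I.erase (I.max' h0), Finset.erase_subset _ _, ?_, ?_⟩
      · rw [Finset.card_erase_of_mem (Finset.max'_mem _ _)]; omega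
      · intro i hi
        rw [Finset.mem_erase] at hi
        exact ⟨I.max' h0, Finset.max'_mem _ _, lt_of_le_of_ne (Finset.le_max' _ _ hi.2) hi.1⟩
  let D : Finset V := insert x (insert b (insert a (J.image (fun i => f (i+1)))))
  have hDX : ∀ d ∈ D, d ∈ X := by
    intro d hd
    simp only [D, Finset.mem_insert, Finset.mem_image] at hd
    rcases hd with rfl | rfl | rfl | ⟨i, hi, rfl⟩
    · exact hx
    · exact hb
    · exact ha
    · obtain ⟨h1, h2⟩ := hI i (hJI hi)
      have hc := List.isChain_iff_getElem.1 h.1 i h1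
      rw [← hf, ← hf] at hc
      exact nx h2.1 hc
  have hDcard : I.card + 2 ≤ D.card := by
    rcases I.eq_empty_or_nonempty with h0 | h0
    · rw [h0]
      have : ({x, b} : Finset V) ⊆ D := by
        intro w hw
        simp only [D, Finset.mem_insert, Finset.mem_singleton] at hw ⊢
        tauto
      have hxb : x ≠ b := by
        rintro rfl
        exact hxl (List.mem_of_getLast? h.2.2)
      have := Finset.card_le_card this
      rw [Finset.card_pair hxb] at this
      simpa using this
    · have hne : 3 ≤ l.length := by
        obtain ⟨i, hi⟩ := h0
        obtain ⟨h1, h2⟩ := hI i hi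
        omega
      have hinj : (J.image (fun i => f (i+1))).card = J.card := by
        apply Finset.card_image_of_injOn
        intro i hi j hj hij
        have := hfinj _ _ (hI i (hJI hi)).1 (hI j (hJI hj)).1 hij
        omega
      have n1 : a ∉ J.image (fun i => f (i+1)) := by
        intro hm
        obtain ⟨i, hi, he⟩ := Finset.mem_image.1 hm
        rw [← hf0] at he
        have := hfinj _ _ (hI i (hJI hi)).1 hpos he
        omega
      have n2 : b ∉ insert a (J.image (fun i => f (i+1))) := by
        intro hm
        rw [Finset.mem_insert] at hm
        rcases hm with hm | hm
        · rw [← hf0, ← hfl] at hm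
          have := hfinj _ _ (by omega) hpos hm
          omega
        obtain ⟨i, hi, he⟩ := Finset.mem_image.1 hm
        rw [← hfl] at he
        have := hfinj _ _ (hI i (hJI hi)).1 (by omega) he
        obtain ⟨j, hj, hij⟩ := hJ i hi
        have := (hI j hj).1
        omega
      have n3 : x ∉ insert b (insert a (J.image (fun i => f (i+1)))) := by
        intro hm
        simp only [Finset.mem_insert, Finset.mem_image] at hm
        apply hxl
        rcases hm with hm | hm | ⟨i, hi, he⟩
        · rw [hm]; exact List.mem_of_getLast? h.2.2
        · rw [hm]; exact List.mem_of_head? h.2.1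
        · rw [← he, hf _ (hI i (hJI hi)).1]; exact List.getElem_mem _
      simp only [D]
      rw [Finset.card_insert_of_notMem n3, Finset.card_insert_of_notMem n2,
        Finset.card_insert_of_notMem n1, hinj]
      omega
  have hpair : ∀ z ∈ Y, z ∉ l → ∀ d ∈ D, ∀ d' ∈ D, R d z → R d' z → d = d' := by
    intro z hz hzl d hd d' hd' r r'
    simp only [D, Finset.mem_insert, Finset.mem_image] at hd hd'
    rcases hd with rfl | rfl | rfl | ⟨i, hi, rfl⟩ <;>
      rcases hd' with rfl | rfl | rfl | ⟨j, hj, rfl⟩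
    · rfl
    · exact (c2 z hz hzl r r').elim
    · exact (c1 z hz hzl r r').elim
    · exact ((d1 j (hJI hj) z hz hzl r').1 r).elim
    · exact (c2 z hz hzl r' r).elim
    · rfl
    · exact (c3 z hz hzl r' r).elim
    · obtain ⟨k, hk, hjk⟩ := hJ j hj
      exact ((d2 j (hJI hj) k hk hjk z hz hzl r').1 r).elim
    · exact (c1 z hz hzl r' r).elim
    · exact (c3 z hz hzl r r').elim
    · rfl
    · exact ((d1 j (hJI hj) z hz hzl r').2 r).elim
    · exact ((d1 i (hJI hi) z hz hzl r).1 r').elim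
    · obtain ⟨k, hk, hik⟩ := hJ i hi
      exact ((d2 i (hJI hi) k hk hik z hz hzl r).1 r').elim
    · exact ((d1 i (hJI hi) z hz hzl r).2 r').elim
    · rcases lt_trichotomy i j with hij | hij | hij
      · exact ((d2 i (hJI hi) j (hJI hj) hij z hz hzl r).2 r').elim
      · rw [hij]
      · exact ((d2 j (hJI hj) i (hJI hi) hij z hz hzl r').2 r).elim
  -- counting
  have hT : ((Y.filter (· ∈ l)).filter P).card ≤ I.card := by
    have : ((Y.filter (· ∈ l)).filter P) ⊆ I.image f := by
      intro y hy
      simp only [Finset.mem_filter] at hy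
      obtain ⟨i, hi, rfl⟩ := List.getElem_of_mem hy.1.2
      rw [Finset.mem_image]
      refine ⟨i, ?_, hf i hi⟩
      simp only [I, Finset.mem_filter, Finset.mem_range]
      exact ⟨hi, by rw [hf i hi]; exact hy.2⟩
    exact (Finset.card_le_card this).trans Finset.card_image_le
  have hYl := alt_card hXY hE ha hb h hnd
  have hsum1 : D.card * κ ≤ ∑ d ∈ D, (Y.filter (fun y => R d y)).card := by
    rw [← smul_eq_mul]
    apply Finset.card_nsmul_le_sum
    intro d hd
    obtain ⟨S, hS, hSc, hSR⟩ := hdeg d (hDX d hd)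
    refine hSc.trans (Finset.card_le_card ?_)
    intro y hy
    exact Finset.mem_filter.2 ⟨hS hy, hSR y hy⟩
  have hsum2 : ∑ d ∈ D, (Y.filter (fun y => R d y)).card
      = ∑ y ∈ Y, (D.filter (fun d => R d y)).card :=
    Finset.sum_card_bipartiteAbove_eq_sum_card_bipartiteBelow R
  rw [hsum2, ← Finset.sum_filter_add_sum_filter_not Y (· ∈ l),
    ← Finset.sum_filter_add_sum_filter_not (Y.filter (· ∈ l)) P] at hsum1
  have b1 : ∑ y ∈ Y.filter (fun y => ¬ y ∈ l), (D.filter (fun d => R d y)).card ≤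
      (Y.filter (fun y => ¬ y ∈ l)).card * 1 := by
    rw [← smul_eq_mul]
    apply Finset.sum_le_card_nsmul
    intro y hy
    rw [Finset.mem_filter] at hy
    rw [Finset.card_le_one]
    intro d hd d' hd'
    rw [Finset.mem_filter] at hd hd'
    exact hpair y hy.1 hy.2 d hd.1 d' hd'.1 hd.2 hd'.2
  have b2 : ∑ y ∈ (Y.filter (· ∈ l)).filter P, (D.filter (fun d => R d y)).card ≤
      ((Y.filter (· ∈ l)).filter P).card * D.card := by
    rw [← smul_eq_mul]
    apply Finset.sum_le_card_nsmul
    intro y _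
    exact Finset.card_le_card (Finset.filter_subset _ _)
  have b3 : ∑ y ∈ (Y.filter (· ∈ l)).filter (fun y => ¬ P y), (D.filter (fun d => R d y)).card ≤
      ((Y.filter (· ∈ l)).filter (fun y => ¬ P y)).card * (D.card - 1) := by
    rw [← smul_eq_mul]
    apply Finset.sum_le_card_nsmul
    intro y hy
    simp only [Finset.mem_filter] at hy
    have : (D.filter (fun d => R d y)) ⊂ D := by
      rw [Finset.filter_ssubset]
      by_contra hc
      push Not at hc
      apply hy.2
      refine ⟨hy.1.1, hc x ?_, hc a ?_, hc b ?_⟩ <;> simp [D]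
    have := Finset.card_lt_card this
    omega
  have e1 := Finset.card_filter_add_card_filter_not (s := Y) (· ∈ l)
  have e2 := Finset.card_filter_add_card_filter_not (s := Y.filter (· ∈ l)) P
  obtain ⟨s, hs⟩ : ∃ s, D.card = s + 2 := ⟨D.card - 2, by omega⟩
  rw [hs] at hsum1 b2 b3
  rw [show s + 2 - 1 = s + 1 from rfl] at b3
  generalize ((Y.filter (· ∈ l)).filter P).card = t at *
  generalize ((Y.filter (· ∈ l)).filter (fun y => ¬ P y)).card = t' at *
  generalize (Y.filter (fun y => ¬ y ∈ l)).card = r at *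
  have hts : t ≤ s := by omega
  have hle : ℓ = t + t' + 1 := by omega
  have : s * ℓ ≤ s * κ := Nat.mul_le_mul_left _ hκ
  subst hle
  nlinarith

/-- Existence of alternating paths with a given number of vertices. -/
theorem alt_exists {V : Type*} [DecidableEq V] {R : V → V → Prop} {X Y : Finset V}
    (hXY : Disjoint X Y) (hE : ∀ a b, R a b → (a ∈ X ∧ b ∈ Y) ∨ (a ∈ Y ∧ b ∈ X))
    (hR : ∀ a b, R a b → R b a) (κ : ℕ)
    (hdeg : ∀ x ∈ X, ∃ S ⊆ Y, κ ≤ S.card ∧ ∀ y ∈ S, R x y) (hY : Y.card + 1 ≤ 2 * κ)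
    (k : ℕ) (hk : k + 1 ≤ X.card) (hkκ : k ≤ κ) :
    ∃ a ∈ X, ∃ b ∈ X, ∃ l, Seg R a b l ∧ l.Nodup ∧ l.length = 2 * k + 1 := by
  induction k with
  | zero =>
    obtain ⟨a, ha⟩ : X.Nonempty := by rw [← Finset.card_pos]; omega
    exact ⟨a, ha, a, ha, [a], Seg.single a, by simp, by simp⟩
  | succ k ih =>
    obtain ⟨a, ha, b, hb, l, h, hnd, hlen⟩ := ih (by omega) (by omega)
    have hc := alt_card hXY hE ha hb h hnd
    obtain ⟨x, hx, hxl⟩ : ∃ x ∈ X, x ∉ l := by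
      by_contra hcon
      push Not at hcon
      have hsub : X ∪ Y.filter (· ∈ l) ⊆ l.toFinset := by
        intro w hw
        rw [Finset.mem_union, Finset.mem_filter] at hw
        rw [List.mem_toFinset]
        rcases hw with hw | hw
        · exact hcon w hw
        · exact hw.2
      have h1 := Finset.card_le_card hsub
      rw [Finset.card_union_of_disjoint (hXY.mono_right (Finset.filter_subset _ _)),
        List.toFinset_card_of_nodup hnd] at h1
      omega
    obtain ⟨a', ha', b', hb', l', h1, h2, h3⟩ := alt_extend hXY hE hR κ hdeg hY ha hb h hnd (k+1)
      (by omega) hkκ hx hxl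
    exact ⟨a', ha', b', hb', l', h1, h2, by omega⟩

set_option maxHeartbeats 1000000

/-- a blue `(m+2p)`-star in `R(u)` centered at `v` with spoke set
`A'`, together with a blue `2p`-cycle in `R(u)` avoiding `v` and meeting `A'` in
at least `p+1` vertices, forces a monochromatic `S_c(n,m)`. -/
theorem lds_no_blue_star_helper (n m p : ℕ) (hm : 2 ≤ m) (hmn : m ≤ n) (hp : 1 ≤ p)
    (hn : p + 3 ≤ n) {V : Type*} [Fintype V]
    (hV : Fintype.card V = 2 * (n + m + p) - 1) (G : SimpleGraph V) (u : V)
    (hmaxr : ∀ v : V, ({w | G.Adj v w}).ncard ≤ ({w | G.Adj u w}).ncard)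
    (hmaxb : ∀ v : V, ({w | Gᶜ.Adj v w}).ncard ≤ ({w | G.Adj u w}).ncard)
    (hdu : n + m + 2 * p ≤ ({w | G.Adj u w}).ncard)
    (v : V) (hv : G.Adj u v) (A' : Set V)
    (hA'sub : A' ⊆ {w | G.Adj u w} \ {v}) (hA'card : A'.ncard = m + 2 * p)
    (hA'blue : ∀ a ∈ A', Gᶜ.Adj v a)
    (g : ZMod (2 * p) → V) (hg : IsCycleMap Gᶜ g) (hgR : ∀ i, G.Adj u (g i))
    (hgv : v ∉ Set.range g) (hint : p + 1 ≤ (A' ∩ Set.range g).ncard) :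
    HasMonoLDS G (2 * p + 1) n m := by
  classical
  by_contra hno
  have hblueN : ¬ HasCopy (LinkedDoubleStar (2 * p + 1) n m) Gᶜ := fun h => hno (Or.inr h)
  have hredN : ¬ HasCopy (LinkedDoubleStar (2 * p + 1) n m) G := fun h => hno (Or.inl h)
  clear hno
  have : NeZero (2 * p) := ⟨by omega⟩
  obtain ⟨hginj, hgadj⟩ := hg
  set Q : Finset V := Finset.univ.image g with hQ
  have hQc : Q.card = 2 * p := by
    rw [hQ, Finset.card_image_of_injective _ hginj, Finset.card_univ, ZMod.card]
  have hQset : (Q : Set V) = Set.range g := by simp [hQ]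
  have hgvQ : v ∉ Q := by rw [← Finset.mem_coe, hQset]; exact hgv
  have huQ : u ∉ Q := by
    intro h
    obtain ⟨i, _, hi⟩ := Finset.mem_image.1 h
    have := hgR i
    rw [hi] at this
    exact G.loopless.irrefl u this
  have huv : u ≠ v := hv.ne
  -- finset version of `A'`
  set A : Finset V := A'.toFinset with hA
  have hAc : A.card = m + 2 * p := by rw [← hA'card, Set.ncard_eq_toFinset_card']
  have hAmem : ∀ w, w ∈ A ↔ w ∈ A' := by simp [hA]
  have hAQ : p + 1 ≤ (A ∩ Q).card := by
    rw [← hQset] at hint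
    have : A' ∩ (Q : Set V) = ((A ∩ Q : Finset V) : Set V) := by simp [hA]
    rw [this, Set.ncard_coe_finset] at hint
    exact hint
  obtain ⟨M, hMsub, hMc⟩ : ∃ M ⊆ A \ Q, M.card = m := by
    apply Finset.exists_subset_card_eq
    have h1 := Finset.card_sdiff_add_card_inter A Q
    have h2 := Finset.card_le_card (Finset.inter_subset_right (s₁ := A) (s₂ := Q))
    omega
  have hMA : ∀ w ∈ M, w ∈ A' := fun w hw => (hAmem w).1 (Finset.mem_sdiff.1 (hMsub hw)).1
  have hMQ : ∀ w ∈ M, w ∉ Q := fun w hw => (Finset.mem_sdiff.1 (hMsub hw)).2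
  have hMv : v ∉ M := fun h => (hA'sub (hMA v h)).2 rfl
  have hMu : u ∉ M := fun h => G.loopless.irrefl u (hA'sub (hMA u h)).1
  set C : Finset V := insert u (insert v (Q ∪ M)) with hC
  have hCc : C.card = 2 * p + m + 2 := by
    rw [hC, Finset.card_insert_of_notMem, Finset.card_insert_of_notMem,
      Finset.card_union_of_disjoint, hQc, hMc]
    · exact Finset.disjoint_right.2 hMQ
    · simp [hgvQ, hMv]
    · simp [huQ, hMu, huv]
  set Y : Finset V := Cᶜ with hYdef
  have hYc : Y.card = 2 * n + m - 3 := by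
    rw [hYdef, Finset.card_compl, hV, hCc]; omega
  have hYmem : ∀ w, w ∈ Y ↔ w ≠ u ∧ w ≠ v ∧ w ∉ Q ∧ w ∉ M := by
    intro w; simp [hYdef, hC]
  -- the set `X`
  obtain ⟨X, hXsub, hXc⟩ : ∃ X ⊆ (Finset.univ.filter (fun i => g i ∈ A)).image (fun i => g (i + 1)),
      X.card = p + 1 := by
    apply Finset.exists_subset_card_eq
    rw [Finset.card_image_of_injective]
    · refine hAQ.trans ?_
      have : A ∩ Q ⊆ (Finset.univ.filter (fun i => g i ∈ A)).image g := by
        intro w hw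
        rw [Finset.mem_inter] at hw
        obtain ⟨i, _, rfl⟩ := Finset.mem_image.1 hw.2
        exact Finset.mem_image_of_mem _ (by simp [hw.1])
      exact (Finset.card_le_card this).trans Finset.card_image_le
    · intro i j hij
      exact add_right_cancel (hginj hij)
  have hXg : ∀ x ∈ X, ∃ i, g i ∈ A' ∧ x = g (i + 1) := by
    intro x hx
    obtain ⟨i, hi, rfl⟩ := Finset.mem_image.1 (hXsub hx)
    exact ⟨i, (hAmem _).1 (Finset.mem_filter.1 hi).2, rfl⟩
  have hXQ : ∀ x ∈ X, x ∈ Q := by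
    intro x hx
    obtain ⟨i, _, rfl⟩ := hXg x hx
    simp [hQ]
  have hXu : ∀ x ∈ X, G.Adj u x := by
    intro x hx
    obtain ⟨i, _, rfl⟩ := hXg x hx
    exact hgR _
  have hXY : Disjoint X Y := by
    rw [Finset.disjoint_left]
    intro x hx hy
    exact ((hYmem x).1 hy).2.2.1 (hXQ x hx)
  -- degrees
  have hblue : ∀ x ∈ X, (Y.filter (fun y => Gᶜ.Adj x y)).card < n := by
    intro x hx
    by_contra hc
    push Not at hc
    obtain ⟨S, hS, hSc⟩ := Finset.exists_subset_card_eq hc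
    obtain ⟨i, hi, rfl⟩ := hXg x hx
    apply hblueN
    let L : List V := (List.range (2 * p)).map (fun k => g (i + 1 + (k : ℕ)))
    have hLQ : ∀ w ∈ L, w ∈ Q := by
      intro w hw
      obtain ⟨k, _, rfl⟩ := List.mem_map.1 hw
      simp [hQ]
    have hseg : Seg Gᶜ.Adj (g (i + 1)) (g i) L := by
      refine ⟨?_, ?_, ?_⟩
      · rw [List.isChain_iff_getElem]
        intro k hk
        simp only [L, List.getElem_map, List.getElem_range]
        have := hgadj (i + 1 + (k : ℕ))
        rw [add_assoc (i + 1)] at this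
        push_cast
        exact this
      · rw [List.head?_eq_getElem?]
        simp [L, show 0 < p by omega]
      · rw [List.getLast?_eq_getElem?]
        have : ((2 * p - 1 : ℕ) : ZMod (2 * p)) + 1 = 0 := by
          have h2 : (((2 * p - 1) + 1 : ℕ) : ZMod (2 * p)) = 0 := by
            rw [show 2 * p - 1 + 1 = 2 * p by omega]; exact ZMod.natCast_self _
          exact_mod_cast h2
        have h3 : i + 1 + ((2 * p - 1 : ℕ) : ZMod (2 * p)) = i := by
          rw [add_assoc, add_comm 1, this, add_zero]
        simp [L, show 0 < p by omega, h3]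
    have hnd : L.Nodup := by
      refine List.Nodup.map_on ?_ List.nodup_range
      intro k hk k' hk' hkk
      have h1 := add_left_cancel (hginj hkk)
      rw [List.mem_range] at hk hk'
      have h2 := congrArg ZMod.val h1
      rwa [ZMod.val_natCast_of_lt hk, ZMod.val_natCast_of_lt hk'] at h2
    refine hasCopy_of_seg Gᶜ (2 * p + 1) n m (g (i + 1)) v (L ++ [v])
      (hseg.append (Seg.single v) (hA'blue _ hi).symm) (by simp [L]) ?_ S M hSc hMc ?_ ?_ ?_ ?_ ?_
    · rw [List.nodup_append]
      refine ⟨hnd, by simp, ?_⟩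
      intro w hw w' hw' e
      simp at hw'
      subst hw'; subst e
      exact hgvQ (hLQ _ hw)
    · rw [Finset.disjoint_left]
      intro w hw hw'
      exact ((hYmem w).1 (Finset.mem_filter.1 (hS hw)).1).2.2.2 hw'
    · intro w hw hw'
      have := (hYmem w).1 (Finset.mem_filter.1 (hS hw)).1
      rw [List.mem_append, List.mem_singleton] at hw'
      rcases hw' with h | h
      · exact this.2.2.1 (hLQ w h)
      · exact this.2.1 h
    · intro w hw hw'
      rw [List.mem_append, List.mem_singleton] at hw'
      rcases hw' with h | h
      · exact hMQ w hw (hLQ w h)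
      · subst h; exact hMv hw
    · intro w hw
      exact (Finset.mem_filter.1 (hS hw)).2
    · intro w hw
      exact hA'blue w (hMA w hw)
  have hred : ∀ x ∈ X, n + m - 2 ≤ (Y.filter (fun y => G.Adj x y)).card := by
    intro x hx
    have h1 := hblue x hx
    have h2 := Finset.card_filter_add_card_filter_not (s := Y) (fun y => G.Adj x y)
    have h3 : Y.filter (fun y => ¬ G.Adj x y) = Y.filter (fun y => Gᶜ.Adj x y) := by
      apply Finset.filter_congr
      intro y hy
      rw [SimpleGraph.compl_adj]
      have : x ≠ y := fun e => Finset.disjoint_left.1 hXY hx (e ▸ hy)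
      tauto
    rw [h3] at h2
    omega
  -- bipartite relation
  let E : V → V → Prop := fun a b => G.Adj a b ∧ ((a ∈ X ∧ b ∈ Y) ∨ (a ∈ Y ∧ b ∈ X))
  have hEE : ∀ a b, E a b → (a ∈ X ∧ b ∈ Y) ∨ (a ∈ Y ∧ b ∈ X) := fun a b h => h.2
  have hEs : ∀ a b, E a b → E b a := fun a b h => ⟨h.1.symm, by tauto⟩
  have hEG : ∀ a b, E a b → G.Adj a b := fun a b h => h.1
  have hGs : ∀ a b, G.Adj a b → G.Adj b a := fun a b h => h.symm
  have hYX : ∀ {y}, y ∈ Y → y ∉ X := fun hy => Finset.disjoint_right.1 hXY hy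
  have hXY' : ∀ {y}, y ∈ X → y ∉ Y := fun hy => Finset.disjoint_left.1 hXY hy
  have nxX : ∀ {y q}, y ∈ Y → E y q → q ∈ X := by
    intro y q hy hyq
    rcases hEE _ _ hyq with h | h
    · exact absurd h.1 (hYX hy)
    · exact h.2
  have nxY : ∀ {y q}, y ∈ X → E y q → q ∈ Y := by
    intro y q hy hyq
    rcases hEE _ _ hyq with h | h
    · exact h.2
    · exact absurd h.1 (hXY' hy)
  obtain ⟨a, ha, b, hb, l, hl, hnd, hlen⟩ := alt_exists hXY hEE hEs (n + m - 2)
    (fun x hx => ⟨Y.filter (fun y => G.Adj x y), Finset.filter_subset _ _, hred x hx,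
      fun y hy => ⟨(Finset.mem_filter.1 hy).2, Or.inl ⟨hx, (Finset.mem_filter.1 hy).1⟩⟩⟩)
    (by omega) p (by omega) (by omega)
  have hYl : (Y.filter (· ∈ l)).card = p := by
    have := alt_card hXY hEE ha hb hl hnd
    omega
  have hlXY : ∀ w ∈ l, w ∈ X ∨ w ∈ Y := by
    intro w hw
    obtain ⟨i, hi, rfl⟩ := List.getElem_of_mem hw
    by_cases h : i + 1 < l.length
    · have := hEE _ _ (List.isChain_iff_getElem.1 hl.1 i h)
      tauto
    · have h' : l[i - 1 + 1] = l[i] := by congr 1; omega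
      have := hEE _ _ (List.isChain_iff_getElem.1 hl.1 (i - 1) (by omega))
      rw [h'] at this
      tauto
  have hul : u ∉ l := by
    intro h
    rcases hlXY u h with h | h
    · exact huQ (hXQ _ h)
    · exact ((hYmem u).1 h).1 rfl
  -- finishing lemma for red copies
  have fin1 : ∀ e L, Seg G.Adj u e L → L.Nodup → L.length = 2 * p + 1 →
      m ≤ (Finset.univ.filter (fun w => G.Adj e w ∧ w ∉ L)).card → False := by
    intro e L hs hn hL hcard
    obtain ⟨B, hB, hBc⟩ := Finset.exists_subset_card_eq hcard
    have hd : n ≤ (Finset.univ.filter (fun w => G.Adj u w) \ (L.toFinset.erase u ∪ B)).card := by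
      have h1 := Finset.le_card_sdiff (L.toFinset.erase u ∪ B)
        (Finset.univ.filter (fun w => G.Adj u w))
      have h2 : (Finset.univ.filter (fun w => G.Adj u w)).card = ({w | G.Adj u w}).ncard := by
        rw [Set.ncard_eq_toFinset_card']; congr 1; ext w; simp
      have h3 := Finset.card_union_le (L.toFinset.erase u) B
      have h4 : (L.toFinset.erase u).card = 2 * p := by
        rw [Finset.card_erase_of_mem, List.toFinset_card_of_nodup hn, hL]; rfl
        rw [List.mem_toFinset]; exact List.mem_of_head? hs.2.1
      omega
    obtain ⟨S, hS, hSc⟩ := Finset.exists_subset_card_eq hd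
    have hS' : ∀ w ∈ S, G.Adj u w ∧ w ∉ L ∧ w ∉ B := by
      intro w hw
      have := hS hw
      simp only [Finset.mem_sdiff, Finset.mem_filter, Finset.mem_univ, true_and, Finset.mem_union,
        Finset.mem_erase, List.mem_toFinset, not_or, not_and] at this
      exact ⟨this.1, this.2.1 this.1.ne', this.2.2⟩
    have hB' : ∀ w ∈ B, G.Adj e w ∧ w ∉ L := by
      intro w hw
      simpa using hB hw
    exact hredN (hasCopy_of_seg G (2 * p + 1) n m u e L hs hL hn S B hSc hBc
      (Finset.disjoint_left.2 fun w hw => (hS' w hw).2.2) (fun w hw => (hS' w hw).2.1)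
      (fun w hw => (hB' w hw).2) (fun w hw => (hS' w hw).1) (fun w hw => (hB' w hw).1))
  -- version ending in `X`, possibly using one further `Y` vertex `z`
  have fin2 : ∀ e L z, e ∈ X → Seg G.Adj u e (u :: L) → (u :: L).Nodup → L.length = 2 * p →
      (∀ w ∈ L, w = z ∨ w ∈ l) → False := by
    intro e L z he hs hn hL hsub
    refine fin1 e (u :: L) hs hn (by simp [hL]) ?_
    have h1 := Finset.le_card_sdiff (insert z (Y.filter (· ∈ l))) (Y.filter (fun y => G.Adj e y))
    have h2 := hred e he
    have h3 := Finset.card_insert_le z (Y.filter (· ∈ l))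
    have h4 : Y.filter (fun y => G.Adj e y) \ insert z (Y.filter (· ∈ l)) ⊆
        Finset.univ.filter (fun w => G.Adj e w ∧ w ∉ u :: L) := by
      intro w hw
      simp only [Finset.mem_sdiff, Finset.mem_filter, Finset.mem_univ, true_and,
        Finset.mem_insert, not_or, not_and] at hw ⊢
      refine ⟨hw.1.2, ?_⟩
      rw [List.mem_cons, not_or]
      refine ⟨((hYmem w).1 hw.1.1).1, fun hwL => ?_⟩
      rcases hsub w hwL with h | h
      · exact hw.2.1 h
      · exact hw.2.2 hw.1.1 h
    have h5 := Finset.card_le_card h4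
    omega
  -- decompose `l`
  obtain ⟨y, K, rfl⟩ : ∃ y K, l = a :: y :: K := by
    rcases l with _ | ⟨x0, _ | ⟨y, K⟩⟩
    · simp at hlen
    · simp at hlen; omega
    · have := hl.2.1; simp at this; subst this
      exact ⟨y, K, rfl⟩
  have hKlen : K.length + 1 = 2 * p := by simp at hlen; omega
  have hay : E a y := by have := hl.1; simp at this; exact this.1
  have hyY : y ∈ Y := nxY ha hay
  obtain ⟨a1, k, sa, _, hyk, hK⟩ := Seg.split (S := [a]) (T := K) (y := y) hl
    (fun e => hYX hyY (e ▸ ha)) (fun e => hYX hyY (e ▸ hb))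
  clear sa
  have hkX : k ∈ X := nxX hyY hyk
  have hKG : Seg G.Adj k b K := hK.mono hEG
  have hndK := hnd
  rw [List.nodup_cons, List.nodup_cons] at hndK
  obtain ⟨haK, hyK, hndK⟩ := hndK
  rw [List.mem_cons, not_or] at hul
  rw [List.mem_cons, not_or] at hul
  obtain ⟨hua, huy, huK⟩ := hul
  -- `u` is not red-adjacent to `y`
  have huyn : ¬ G.Adj u y := by
    intro h
    refine fin2 b (y :: K) y hb (Seg.cons h (Seg.cons hyk.1 hKG)) ?_ (by simp; omega) ?_
    · simp [huy, huK, hyK, hndK]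
    · intro w hw; right; exact List.mem_cons_of_mem _ hw
  -- no outside common neighbours of `u` and `b`
  have hout : ∀ z ∈ Y, z ∉ a :: y :: K → G.Adj u z → ¬ G.Adj b z := by
    intro z hz hzl h1 h2
    simp only [List.mem_cons, not_or] at hzl
    refine fin2 k (z :: K.reverse) z hkX
      (Seg.cons h1 (Seg.cons h2.symm (hKG.reverse hGs))) ?_ (by simp; omega) ?_
    · simp [huK, hndK, hzl.2.2, h1.ne]
    · intro w hw
      simp at hw
      rcases hw with h | h
      · left; exact h
      · right; simp [h]
  -- shifted pattern
  have hshift : ∀ S T y' x' y'', a :: y :: K = S ++ y' :: x' :: y'' :: T → y' ∈ Y → y'' ∈ Y →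
      G.Adj b y' → ¬ G.Adj u y'' := by
    intro S T y' x' y'' heq hy' hy'' hby hu
    have hl' := hl
    rw [heq] at hl'
    obtain ⟨p1, q1, s1, e1, e2, s2⟩ := hl'.split (fun e => hYX hy' (e ▸ ha))
      (fun e => hYX hy' (e ▸ hb))
    have hq1 : q1 = x' := by have := s2.2.1; simpa using this.symm
    subst hq1
    have hq1X := nxX hy' e2
    obtain ⟨p2, q2, s3, e3, e4, s4⟩ := Seg.split (S := [q1]) (T := T) (y := y'') s2
      (fun e => hYX hy'' (e ▸ hq1X)) (fun e => hYX hy'' (e ▸ hb))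
    have hnd' := hnd
    rw [heq] at hnd'
    have hun : u ∉ S ++ y' :: q1 :: y'' :: T := by
      rw [← heq]; simp [hua, huy, huK]
    have hperm : (S ++ y' :: q1 :: y'' :: T).Perm (q1 :: (y'' :: (T ++ y' :: S.reverse))) := by
      rw [List.perm_iff_count]; intro w
      simp only [List.count_append, List.count_cons, List.count_reverse]; omega
    have hnd2 := hperm.nodup_iff.1 hnd'
    rw [List.nodup_cons] at hnd2
    refine fin2 a (y'' :: (T ++ y' :: S.reverse)) y ha
      (Seg.cons hu (Seg.cons e4.1 ((s4.mono hEG).append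
        (Seg.cons (hGs _ _ e1.1) ((s1.mono hEG).reverse hGs)) hby))) ?_ ?_ ?_
    · rw [List.nodup_cons]
      refine ⟨fun h => hun (hperm.mem_iff.2 (List.mem_cons_of_mem _ h)), hnd2.2⟩
    · have h1 := hperm.length_eq
      rw [← heq, hlen, List.length_cons] at h1
      omega
    · intro w hw
      right
      rw [heq]
      exact hperm.mem_iff.2 (List.mem_cons_of_mem _ hw)
  -- counting: the red degree of `u` is small
  have hdle : ({w | G.Adj u w}).ncard ≤ n + m + 2 * p := by
    set l := a :: y :: K with hldef
    let f : ℕ → V := fun i => l.getD i u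
    have hf : ∀ i (hi : i < l.length), f i = l[i] := by
      intro i hi; simp [f, hi]
    let I : Finset ℕ := (Finset.range l.length).filter (fun i => f i ∈ Y)
    let W : Finset ℕ := I.filter (fun i => G.Adj u (f i))
    let Z : Finset ℕ := I.filter (fun i => G.Adj b (f i))
    have hmI : ∀ i, i ∈ I ↔ i < l.length ∧ f i ∈ Y := by intro i; simp [I]
    have hIc : I.card ≤ p := by
      rw [← hYl]
      refine Finset.card_le_card_of_injOn f ?_ ?_
      · intro i hi
        have := (hmI i).1 hi
        simp only [Finset.coe_filter, Set.mem_setOf_eq]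
        exact ⟨this.2, by rw [hf i this.1]; exact List.getElem_mem _⟩
      · intro i hi j hj hij
        have h1 := (hmI i).1 hi
        have h2 := (hmI j).1 hj
        rw [hf i h1.1, hf j h2.1] at hij
        exact (List.Nodup.getElem_inj_iff hnd).1 hij
    have hf0 : f 0 = a := by simp [f, hldef]
    have hf1 : f 1 = y := by simp [f, hldef]
    have hstep : ∀ i, i + 1 < l.length → E (f i) (f (i+1)) := by
      intro i hi
      have := List.isChain_iff_getElem.1 hl.1 i hi
      rwa [← hf, ← hf] at this
    have hW2 : ∀ i ∈ W, ∃ j ∈ I, j + 2 = i := by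
      intro i hi
      obtain ⟨hi1, hi2⟩ := Finset.mem_filter.1 hi
      obtain ⟨hi3, hi4⟩ := (hmI i).1 hi1
      have n0 : i ≠ 0 := by rintro rfl; rw [hf0] at hi4; exact hYX hi4 ha
      have n1 : i ≠ 1 := by rintro rfl; rw [hf1] at hi2; exact huyn hi2
      obtain ⟨j, rfl⟩ : ∃ j, i = j + 2 := ⟨i - 2, by omega⟩
      refine ⟨j, (hmI j).2 ⟨by omega, ?_⟩, rfl⟩
      have h1 := nxX hi4 (hEs _ _ (hstep (j+1) hi3))
      exact nxY h1 (hEs _ _ (hstep j (by omega)))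
    have hdisj : Disjoint W (Z.image (· + 2)) := by
      rw [Finset.disjoint_left]
      intro i hi hi'
      obtain ⟨j, hj, rfl⟩ := Finset.mem_image.1 hi'
      obtain ⟨hi1, hi2⟩ := Finset.mem_filter.1 hi
      obtain ⟨hi3, hi4⟩ := (hmI _).1 hi1
      obtain ⟨hj1, hj2⟩ := Finset.mem_filter.1 hj
      obtain ⟨hj3, hj4⟩ := (hmI _).1 hj1
      refine hshift (l.take j) (l.drop (j+3)) (f j) (f (j+1)) (f (j+2)) ?_ hj4 hi4 hj2 hi2
      have hi3' : j + 2 < l.length := hi3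
      rw [hf j (by omega), hf (j+1) (by omega), hf (j+2) hi3',
        ← List.drop_eq_getElem_cons, ← List.drop_eq_getElem_cons, ← List.drop_eq_getElem_cons,
        List.take_append_drop]
    have hWZ : W.card + Z.card ≤ p := by
      have h1 : W ∪ Z.image (· + 2) ⊆ I.image (· + 2) := by
        intro i hi
        rw [Finset.mem_union] at hi
        rcases hi with hi | hi
        · obtain ⟨j, hj, rfl⟩ := hW2 i hi
          exact Finset.mem_image_of_mem _ hj
        · exact Finset.image_subset_image (Finset.filter_subset _ _) hi
      have h2 := Finset.card_le_card h1
      rw [Finset.card_union_of_disjoint hdisj, Finset.card_image_of_injective _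
        (add_left_injective 2)] at h2
      exact h2.trans (Finset.card_image_le.trans hIc)
    have himg : ∀ c : V, ((Y.filter (· ∈ l)).filter (fun w => G.Adj c w)).card ≤
        (I.filter (fun i => G.Adj c (f i))).card := by
      intro c
      refine (Finset.card_le_card (t := (I.filter (fun i => G.Adj c (f i))).image f) ?_).trans
        Finset.card_image_le
      intro w hw
      simp only [Finset.mem_filter] at hw
      obtain ⟨i, hi, rfl⟩ := List.getElem_of_mem hw.1.2
      rw [Finset.mem_image]
      refine ⟨i, ?_, hf i hi⟩
      rw [Finset.mem_filter, hmI, hf i hi]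
      exact ⟨⟨hi, hw.1.1⟩, hw.2⟩
    have i1 : ((Y.filter (· ∈ l)).filter (fun w => G.Adj u w)).card ≤ W.card := himg u
    have i2 : ((Y.filter (· ∈ l)).filter (fun w => G.Adj b w)).card ≤ Z.card := himg b
    have i3 : ((Y.filter (fun w => ¬ w ∈ l)).filter (fun w => G.Adj u w)).card +
        ((Y.filter (fun w => ¬ w ∈ l)).filter (fun w => G.Adj b w)).card ≤
        (Y.filter (fun w => ¬ w ∈ l)).card := by
      rw [← Finset.card_union_of_disjoint]
      · exact Finset.card_le_card
          (Finset.union_subset (Finset.filter_subset _ _) (Finset.filter_subset _ _))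
      · rw [Finset.disjoint_left]
        intro w hw hw'
        simp only [Finset.mem_filter] at hw hw'
        exact hout w hw.1.1 hw.1.2 hw.2 hw'.2
    have i4 := Finset.card_filter_add_card_filter_not (s := Y) (· ∈ l)
    have i5 : ∀ c : V, (Y.filter (fun w => G.Adj c w)).card =
        ((Y.filter (· ∈ l)).filter (fun w => G.Adj c w)).card +
        ((Y.filter (fun w => ¬ w ∈ l)).filter (fun w => G.Adj c w)).card := by
      intro c
      rw [← Finset.card_filter_add_card_filter_not (s := Y.filter (fun w => G.Adj c w)) (· ∈ l)]
      congr 2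
      · exact Finset.filter_comm _ _ _
      · exact Finset.filter_comm _ _ _
    have i6 := hred b hb
    rw [i5 b] at i6
    have i7 := i5 u
    have i8 : (Finset.univ.filter (fun w => G.Adj u w)).card = ({w | G.Adj u w}).ncard := by
      rw [Set.ncard_eq_toFinset_card']; congr 1; ext w; simp
    have i9 : (Finset.univ.filter (fun w => G.Adj u w)) ⊆
        Y.filter (fun w => G.Adj u w) ∪ insert v (Q ∪ M) := by
      intro w hw
      simp only [Finset.mem_filter, Finset.mem_univ, true_and] at hw
      have hwu : w ≠ u := hw.ne'
      rw [Finset.mem_union]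
      by_cases hin : w ∈ insert v (Q ∪ M)
      · exact Or.inr hin
      · left
        rw [Finset.mem_insert, Finset.mem_union, not_or, not_or] at hin
        exact Finset.mem_filter.2 ⟨(hYmem w).2 ⟨hwu, hin.1, hin.2.1, hin.2.2⟩, hw⟩
    have i10 := Finset.card_le_card i9
    have i11 := Finset.card_union_le (Y.filter (fun w => G.Adj u w)) (insert v (Q ∪ M))
    have i12 := Finset.card_insert_le v (Q ∪ M)
    have i13 := Finset.card_union_le Q M
    omega
  -- `y` has no red neighbour among the other connectors
  have hyy : ∀ y' ∈ Y, y' ∈ K → ¬ G.Adj y y' := by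
    intro y' hy' hy'K hadj
    obtain ⟨S, T, rfl⟩ := List.append_of_mem hy'K
    obtain ⟨p1, q1, s1, e1, e2, s2⟩ := hK.split (fun e => hYX hy' (e ▸ hkX))
      (fun e => hYX hy' (e ▸ hb))
    have hp1 := nxX hy' (hEs _ _ e1)
    have hperm : (y :: (S ++ y' :: T)).Perm (S.reverse ++ y :: y' :: T) := by
      rw [List.perm_iff_count]; intro w
      simp only [List.count_append, List.count_cons, List.count_reverse]; omega
    refine fin2 b (S.reverse ++ y :: y' :: T) y hb
      (Seg.cons (hXu _ hp1) (((s1.mono hEG).reverse hGs).append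
        (Seg.cons hadj (Seg.cons e2.1 (s2.mono hEG))) hyk.1.symm)) ?_ ?_ ?_
    · rw [List.nodup_cons, ← hperm.nodup_iff, ← hperm.mem_iff, List.nodup_cons, List.mem_cons]
      exact ⟨not_or.2 ⟨huy, huK⟩, hyK, hndK⟩
    · rw [← hperm.length_eq, List.length_cons]; omega
    · intro w hw
      right
      exact List.mem_cons_of_mem _ (hperm.mem_iff.2 hw)
  -- final contradiction
  refine fin1 y (u :: (K.reverse ++ [y])) (Seg.cons (hXu _ hb)
    ((hKG.reverse hGs).append (Seg.single y) hyk.1.symm)) ?_ (by simp; omega) ?_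
  · rw [List.nodup_cons]
    constructor
    · simp [huK, huy]
    · rw [(show (K.reverse ++ [y]).Perm (y :: K) from by
        rw [List.perm_iff_count]; intro w
        simp only [List.count_append, List.count_cons, List.count_reverse, List.count_nil]
        omega).nodup_iff, List.nodup_cons]
      exact ⟨hyK, hndK⟩
  · have j1 : (Finset.univ.filter (fun w => G.Adj y w)) ⊆
        Finset.univ.filter (fun w => G.Adj y w ∧ w ∉ u :: (K.reverse ++ [y])) ∪ X := by
      intro w hw
      simp only [Finset.mem_filter, Finset.mem_univ, true_and] at hw
      rw [Finset.mem_union]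
      by_cases hwX : w ∈ X
      · exact Or.inr hwX
      left
      simp only [Finset.mem_filter, Finset.mem_univ, true_and]
      refine ⟨hw, ?_⟩
      simp only [List.mem_cons, List.mem_append, List.mem_reverse, List.not_mem_nil, or_false,
        not_or]
      refine ⟨?_, ?_, hw.ne'⟩
      · rintro rfl; exact huyn hw.symm
      · intro hwK
        rcases hlXY w (by simp [hwK]) with h | h
        · exact hwX h
        · exact hyy w h hwK hw
    have j2 := (Finset.card_le_card j1).trans (Finset.card_union_le _ _)
    have j3 := hmaxb y
    have j4 : (Finset.univ.filter (fun w => G.Adj y w)).card +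
        (Finset.univ.filter (fun w => Gᶜ.Adj y w)).card + 1 = Fintype.card V := by
      have k1 := Finset.card_filter_add_card_filter_not (s := (Finset.univ : Finset V))
        (fun w => G.Adj y w)
      have k2 : Finset.univ.filter (fun w => ¬ G.Adj y w) =
          insert y (Finset.univ.filter (fun w => Gᶜ.Adj y w)) := by
        ext w
        simp only [Finset.mem_filter, Finset.mem_univ, true_and, Finset.mem_insert,
          SimpleGraph.compl_adj]
        constructor
        · intro h
          by_cases e : w = y
          · exact Or.inl e
          · exact Or.inr ⟨fun e' => e e'.symm, h⟩
        · rintro (rfl | h)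
          · exact G.loopless.irrefl _
          · exact h.2
      rw [k2, Finset.card_insert_of_notMem (by simp), Finset.card_univ] at k1
      omega
    have j5 : (Finset.univ.filter (fun w => Gᶜ.Adj y w)).card = ({w | Gᶜ.Adj y w}).ncard := by
      rw [Set.ncard_eq_toFinset_card']; congr 1; ext w; simp
    omega
end

section
/- Let n ≥ m ≥ 2 and p ≥ 1 be integers with n ≥ p + 3, and set c = 2p+1. Consider a 2-coloring of the edges of the complete graph on a vertex set V with |V| = 2(n+m+p) − 1, and suppose u ∈ V satisfies red-d(u) ≥ red-d(v) and red-d(u) ≥ blue-d(v) for all v ∈ V, and red-d(u) ≥ n + m + 2p. If some vertex v ∈ R(u) satisfies blue-d_{R(u)}(v) ≥ m + 2p (i.e. there is a blue (m+2p)-star inside R(u)), then the coloring contains a monochromatic copy of S_c(n,m). -/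
open SimpleGraph

open Classical in
/-- A path with well-attached ends yields a linked double star. -/
theorem lds_copy_of_path {V : Type*} [Fintype V] (H : SimpleGraph V) (n m p : ℕ) (a : ℕ → V)
    (inj : ∀ i j, i ≤ 2 * p → j ≤ 2 * p → a i = a j → i = j)
    (adj : ∀ k, k < 2 * p → H.Adj (a k) (a (k + 1)))
    (h0 : n + m ≤ (Finset.univ.filter (fun x => H.Adj (a 0) x) \
      (Finset.range (2 * p + 1)).image a).card)
    (h1 : m ≤ (Finset.univ.filter (fun x => H.Adj (a (2 * p)) x) \
      (Finset.range (2 * p + 1)).image a).card) :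
    HasCopy (LinkedDoubleStar (2 * p + 1) n m) H := by
  obtain ⟨M, hMs, hM⟩ := Finset.exists_subset_card_eq h1
  have h2 : n ≤ ((Finset.univ.filter (fun x => H.Adj (a 0) x) \
      (Finset.range (2 * p + 1)).image a) \ M).card := by
    have := Finset.le_card_sdiff M (Finset.univ.filter (fun x => H.Adj (a 0) x) \
      (Finset.range (2 * p + 1)).image a)
    omega
  obtain ⟨L, hLs, hL⟩ := Finset.exists_subset_card_eq h2
  let eL := L.equivFinOfCardEq hL
  let eM := M.equivFinOfCardEq hM
  have hLp : ∀ i, H.Adj (a 0) (eL.symm i) ∧ (∀ k, k ≤ 2 * p → a k ≠ eL.symm i) ∧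
      (eL.symm i : V) ∉ M := by
    intro i
    have h := hLs (eL.symm i).2
    simp only [Finset.mem_sdiff, Finset.mem_filter, Finset.mem_univ, true_and, Finset.mem_image,
      Finset.mem_range, not_exists, not_and] at h
    exact ⟨h.1.1, fun k hk => h.1.2 k (by omega), h.2⟩
  have hMp : ∀ i, H.Adj (a (2 * p)) (eM.symm i) ∧ (∀ k, k ≤ 2 * p → a k ≠ eM.symm i) := by
    intro i
    have h := hMs (eM.symm i).2
    simp only [Finset.mem_sdiff, Finset.mem_filter, Finset.mem_univ, true_and, Finset.mem_image,
      Finset.mem_range, not_exists, not_and] at h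
    exact ⟨h.1, fun k hk => h.2 k (by omega)⟩
  let f : Fin (2 * p + 1) ⊕ Fin n ⊕ Fin m → V
    | Sum.inl i => a i
    | Sum.inr (Sum.inl i) => eL.symm i
    | Sum.inr (Sum.inr i) => eM.symm i
  have key : ∀ x y, ldsRel (2 * p + 1) n m x y → H.Adj (f x) (f y) := by
    rintro (i | i | i) (j | j | j) h <;> simp only [ldsRel] at h
    · have := adj i (by omega)
      show H.Adj (a i) (a j)
      rw [h]; exact this
    · show H.Adj (a i) _
      rw [h]; exact (hLp j).1
    · show H.Adj (a i) _
      rw [h]; exact (hMp j).1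
  refine ⟨f, ?_, ?_⟩
  · rintro (i | i | i) (j | j | j) h
    · have := inj i j (by omega) (by omega) h
      congr 1; exact Fin.ext this
    · exact absurd h ((hLp j).2.1 i (by omega))
    · exact absurd h ((hMp j).2 i (by omega))
    · exact absurd h.symm ((hLp i).2.1 j (by omega))
    · have h' : (eL.symm i : V) = eL.symm j := h
      have := eL.symm.injective (Subtype.ext h')
      rw [this]
    · have h' : (eL.symm i : V) = eM.symm j := h
      exact absurd (h' ▸ (eM.symm j).2) (hLp i).2.2
    · exact absurd h.symm ((hMp i).2 j (by omega))
    · have h' : (eM.symm i : V) = eL.symm j := h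
      exact absurd (h' ▸ (eM.symm i).2) (hLp j).2.2
    · have h' : (eM.symm i : V) = eM.symm j := h
      have := eM.symm.injective (Subtype.ext h')
      rw [this]
  · intro x y hxy
    simp only [LinkedDoubleStar, SimpleGraph.fromRel_adj] at hxy
    rcases hxy.2 with h | h
    · exact key _ _ h
    · exact (key _ _ h).symm

open Classical in
/-- Centers `c 0, …, c p` with enough common neighbours yield a linked double star. -/
theorem lds_copy_of_chain {V : Type*} [Fintype V] (H : SimpleGraph V) (n m p : ℕ) (c : ℕ → V)
    (C : Finset V) (hp : 1 ≤ p)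
    (hC : ∀ i, i ≤ p → c i ∈ C)
    (inj : ∀ i j, i ≤ p → j ≤ p → c i = c j → i = j)
    (hS2 : ∀ i, i < p → 2 ≤ (Finset.univ.filter
      (fun x => H.Adj (c i) x ∧ H.Adj (c (i + 1)) x) \ C).card)
    (hSp : ∀ i, 0 < i → i + 1 < p → p ≤ (Finset.univ.filter
      (fun x => H.Adj (c i) x ∧ H.Adj (c (i + 1)) x) \ C).card)
    (h0 : n + m + p ≤ (Finset.univ.filter (fun x => H.Adj (c 0) x) \ C).card)
    (h1 : n + m + p ≤ (Finset.univ.filter (fun x => H.Adj (c p) x) \ C).card) :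
    HasCopy (LinkedDoubleStar (2 * p + 1) n m) H := by
  let S : Fin p → Finset V := fun i => Finset.univ.filter
      (fun x => H.Adj (c i) x ∧ H.Adj (c (i + 1)) x) \ C
  have hall : ∀ A : Finset (Fin p), A.card ≤ (A.biUnion S).card := by
    intro A
    by_cases hA : ∃ i ∈ A, 0 < (i : ℕ) ∧ (i : ℕ) + 1 < p
    · obtain ⟨i, hi, hi1, hi2⟩ := hA
      have h1 : A.card ≤ p := by simpa using Finset.card_le_univ A
      have h2 := hSp i hi1 hi2
      have h3 := Finset.card_le_card (Finset.subset_biUnion_of_mem S hi)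
      exact h1.trans (h2.trans h3)
    · push Not at hA
      rcases A.eq_empty_or_nonempty with rfl | ⟨i, hi⟩
      · simp
      have h2 := hS2 i i.2
      have h3 := Finset.card_le_card (Finset.subset_biUnion_of_mem S hi)
      have h4 : A.card ≤ 2 := by
        have : A ⊆ {⟨0, by omega⟩, ⟨p - 1, by omega⟩} := by
          intro j hj
          have := hA j hj
          simp only [Finset.mem_insert, Finset.mem_singleton, Fin.ext_iff]
          omega
        exact (Finset.card_le_card this).trans Finset.card_le_two
      exact h4.trans (h2.trans h3)
  obtain ⟨g, ginj, hg⟩ := (Finset.all_card_le_biUnion_card_iff_exists_injective S).1 hall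
  let x : ℕ → V := fun i => if h : i < p then g ⟨i, h⟩ else c 0
  have hx : ∀ i, i < p → H.Adj (c i) (x i) ∧ H.Adj (c (i + 1)) (x i) ∧ x i ∉ C := by
    intro i hi
    have := hg ⟨i, hi⟩
    simp only [S, Finset.mem_sdiff, Finset.mem_filter, Finset.mem_univ, true_and] at this
    simp only [x, hi, dite_true]
    exact ⟨this.1.1, this.1.2, this.2⟩
  have xinj : ∀ i j, i < p → j < p → x i = x j → i = j := by
    intro i j hi hj h
    simp only [x, hi, hj, dite_true] at h
    simpa using ginj h
  let a : ℕ → V := fun k => if k % 2 = 0 then c (k / 2) else x (k / 2)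
  have hP : (Finset.range (2 * p + 1)).image a ⊆ C ∪ (Finset.range p).image x := by
    intro y hy
    simp only [Finset.mem_image, Finset.mem_range] at hy
    obtain ⟨k, hk, rfl⟩ := hy
    by_cases h : k % 2 = 0
    · simp only [a, h, if_true, Finset.mem_union]
      exact Or.inl (hC _ (by omega))
    · simp only [a, h, if_false, Finset.mem_union, Finset.mem_image, Finset.mem_range]
      exact Or.inr ⟨k / 2, by omega, rfl⟩
  have hdeg : ∀ y, n + m + p ≤ (Finset.univ.filter (fun x => H.Adj y x) \ C).card →
      n + m ≤ (Finset.univ.filter (fun x => H.Adj y x) \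
        (Finset.range (2 * p + 1)).image a).card := by
    intro y hy
    have h1 := Finset.card_le_card (Finset.sdiff_subset_sdiff
      (Finset.Subset.refl (Finset.univ.filter (fun x => H.Adj y x))) hP)
    rw [← Finset.sup_eq_union, ← sdiff_sdiff_left] at h1
    have h2 := Finset.le_card_sdiff ((Finset.range p).image x)
      (Finset.univ.filter (fun x => H.Adj y x) \ C)
    have h3 : ((Finset.range p).image x).card ≤ p := by
      simpa using Finset.card_image_le (s := Finset.range p) (f := x)
    omega
  apply lds_copy_of_path H n m p a
  · intro i j hi hj h
    by_cases h1 : i % 2 = 0 <;> by_cases h2 : j % 2 = 0 <;> simp only [a, h1, h2, if_true,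
      if_false] at h
    · have := inj _ _ (by omega) (by omega) h
      omega
    · exact absurd (h ▸ hC (i / 2) (by omega)) (hx (j / 2) (by omega)).2.2
    · exact absurd (h ▸ hC (j / 2) (by omega)) (hx (i / 2) (by omega)).2.2
    · have := xinj _ _ (by omega) (by omega) h
      omega
  · intro k hk
    by_cases h : k % 2 = 0
    · have h' : (k + 1) % 2 ≠ 0 := by omega
      have h'' : (k + 1) / 2 = k / 2 := by omega
      simp only [a, h, h', if_true, if_false, h'']
      exact (hx _ (by omega)).1
    · have h' : (k + 1) % 2 = 0 := by omega
      have h'' : (k + 1) / 2 = k / 2 + 1 := by omega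
      simp only [a, h, h', if_true, if_false, h'']
      exact (hx _ (by omega)).2.1.symm
  · apply hdeg
    simpa [a] using h0
  · have := hdeg (c p) h1
    have h2 : a (2 * p) = c p := by simp [a]
    rw [h2]; omega

open Classical in
/-- Enough blue-rich vertices give a blue linked double star. -/
theorem lds_blue_of_set {V : Type*} [Fintype V] (G : SimpleGraph V) (n m p b : ℕ)
    (hp : 1 ≤ p) (T S : Finset V) (hT : p + 1 ≤ T.card) (hTS : T ⊆ S)
    (hb : ∀ t ∈ T, (Finset.univ.filter (fun x => G.Adj t x) \ S).card ≤ b)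
    (h1 : S.card + 2 * b + p + 1 ≤ Fintype.card V)
    (h2 : S.card + b + (n + m + p) ≤ Fintype.card V) :
    HasCopy (LinkedDoubleStar (2 * p + 1) n m) Gᶜ := by
  obtain ⟨H, hH⟩ : ∃ H : SimpleGraph V, H = Gᶜ := ⟨_, rfl⟩
  rw [← hH]
  have hadj : ∀ x y, H.Adj x y ↔ x ≠ y ∧ ¬ G.Adj x y := by
    intro x y; rw [hH, SimpleGraph.compl_adj]
  obtain ⟨T', hT's, hT'⟩ := Finset.exists_subset_card_eq hT
  let e := T'.equivFinOfCardEq hT'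
  let c : ℕ → V := fun i => e.symm (Fin.ofNat (p + 1) i)
  have hc : ∀ i, c i ∈ T' := fun i => (e.symm _).2
  have key : ∀ i j, Fintype.card V ≤ S.card + 2 * b + (Finset.univ.filter
      (fun x => H.Adj (c i) x ∧ H.Adj (c j) x) \ T').card := by
    intro i j
    have hsub : (Finset.univ : Finset V) ⊆ S ∪
        (Finset.univ.filter (fun x => G.Adj (c i) x) \ S) ∪
        (Finset.univ.filter (fun x => G.Adj (c j) x) \ S) ∪
        (Finset.univ.filter (fun x => H.Adj (c i) x ∧ H.Adj (c j) x) \ T') := by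
      intro x _
      by_cases hxS : x ∈ S
      · simp [hxS]
      have hi : c i ≠ x := fun h => hxS (h ▸ hTS (hT's (hc i)))
      have hj : c j ≠ x := fun h => hxS (h ▸ hTS (hT's (hc j)))
      have hxT : x ∉ T' := fun h => hxS (hTS (hT's h))
      simp only [Finset.mem_union, Finset.mem_sdiff, Finset.mem_filter, Finset.mem_univ, true_and,
        hadj]
      tauto
    have h3 := Finset.card_le_card hsub
    rw [Finset.card_univ] at h3
    have h4 := Finset.card_union_le (S ∪
        (Finset.univ.filter (fun x => G.Adj (c i) x) \ S) ∪
        (Finset.univ.filter (fun x => G.Adj (c j) x) \ S))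
        (Finset.univ.filter (fun x => H.Adj (c i) x ∧ H.Adj (c j) x) \ T')
    have h5 := Finset.card_union_le (S ∪
        (Finset.univ.filter (fun x => G.Adj (c i) x) \ S))
        (Finset.univ.filter (fun x => G.Adj (c j) x) \ S)
    have h6 := Finset.card_union_le S (Finset.univ.filter (fun x => G.Adj (c i) x) \ S)
    have h7 := hb _ (hT's (hc i))
    have h8 := hb _ (hT's (hc j))
    omega
  have key1 : ∀ i, Fintype.card V ≤ S.card + b + (Finset.univ.filter
      (fun x => H.Adj (c i) x) \ T').card := by
    intro i
    have hsub : (Finset.univ : Finset V) ⊆ S ∪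
        (Finset.univ.filter (fun x => G.Adj (c i) x) \ S) ∪
        (Finset.univ.filter (fun x => H.Adj (c i) x) \ T') := by
      intro x _
      by_cases hxS : x ∈ S
      · simp [hxS]
      have hi : c i ≠ x := fun h => hxS (h ▸ hTS (hT's (hc i)))
      have hxT : x ∉ T' := fun h => hxS (hTS (hT's h))
      simp only [Finset.mem_union, Finset.mem_sdiff, Finset.mem_filter, Finset.mem_univ, true_and,
        hadj]
      tauto
    have h3 := Finset.card_le_card hsub
    rw [Finset.card_univ] at h3
    have h5 := Finset.card_union_le (S ∪
        (Finset.univ.filter (fun x => G.Adj (c i) x) \ S))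
        (Finset.univ.filter (fun x => H.Adj (c i) x) \ T')
    have h6 := Finset.card_union_le S (Finset.univ.filter (fun x => G.Adj (c i) x) \ S)
    have h7 := hb _ (hT's (hc i))
    omega
  refine lds_copy_of_chain H n m p c T' hp (fun i _ => hc i) ?_ ?_ ?_ ?_ ?_
  · intro i j hi hj h
    have := e.symm.injective (Subtype.ext h)
    have := congrArg Fin.val this
    simpa [Fin.ofNat, Nat.mod_eq_of_lt (show i < p + 1 by omega),
      Nat.mod_eq_of_lt (show j < p + 1 by omega)] using this
  · intro i hi
    have := key i (i + 1)
    omega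
  · intro i hi _
    have := key i (i + 1)
    omega
  · have := key1 0
    omega
  · have := key1 p
    omega

/-- Red path of length `j` from `u` to `w` with vertex set `P`. -/
def LdsPath {V : Type*} [DecidableEq V] (G : SimpleGraph V) (u w : V) (j : ℕ) (P : Finset V)
    (a : ℕ → V) : Prop :=
  a 0 = u ∧ a j = w ∧ (∀ i k, i ≤ j → k ≤ j → a i = a k → i = k) ∧
    (∀ k, k < j → G.Adj (a k) (a (k + 1))) ∧ (Finset.range (j + 1)).image a = P

open Classical in
/-- Rotation of paths. -/
theorem lds_rotate {V : Type*} [Fintype V] (G : SimpleGraph V) (u w : V) (j : ℕ)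
    (P : Finset V) (a : ℕ → V) (h : LdsPath G u w j P a) :
    ∃ E : Finset V, E ⊆ P ∧ E.card = (Finset.univ.filter (fun x => G.Adj w x) ∩ P).card ∧
      ∀ e ∈ E, ∃ a', LdsPath G u e j P a' := by
  obtain ⟨h0, hj, inj, adj, rfl⟩ := h
  let I := (Finset.range j).filter (fun i => G.Adj w (a i))
  refine ⟨I.image (fun i => a (i + 1)), ?_, ?_, ?_⟩
  · intro x hx
    simp only [I, Finset.mem_image, Finset.mem_filter, Finset.mem_range] at hx ⊢
    obtain ⟨i, hi, rfl⟩ := hx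
    exact ⟨i + 1, by omega, rfl⟩
  · have e1 : (I.image (fun i => a (i + 1))).card = I.card := by
      apply Finset.card_image_of_injOn
      intro i hi k hk hik
      simp only [I, Finset.coe_filter, Finset.mem_range, Set.mem_ofPred_eq] at hi hk
      have := inj (i + 1) (k + 1) (by omega) (by omega) hik
      omega
    have e2 : (I.image a).card = I.card := by
      apply Finset.card_image_of_injOn
      intro i hi k hk hik
      simp only [I, Finset.coe_filter, Finset.mem_range, Set.mem_ofPred_eq] at hi hk
      exact inj i k (by omega) (by omega) hik
    rw [e1, ← e2]
    congr 1
    ext x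
    simp only [I, Finset.mem_image, Finset.mem_filter, Finset.mem_range, Finset.mem_inter,
      Finset.mem_univ, true_and]
    constructor
    · rintro ⟨i, ⟨hi, hw⟩, rfl⟩
      exact ⟨hw, i, by omega, rfl⟩
    · rintro ⟨hw, i, hi, rfl⟩
      refine ⟨i, ⟨?_, hw⟩, rfl⟩
      rcases Nat.lt_or_ge i j with h | h
      · exact h
      · have : i = j := by omega
        subst this
        rw [hj] at hw
        exact absurd hw (G.loopless.irrefl _)
  · intro e he
    simp only [I, Finset.mem_image, Finset.mem_filter, Finset.mem_range] at he
    obtain ⟨i, ⟨hi, hw⟩, rfl⟩ := he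
    refine ⟨fun k => if k ≤ i then a k else a (j + i + 1 - k), ?_, ?_, ?_, ?_, ?_⟩
    · simpa using h0
    · have : ¬ j ≤ i := by omega
      simp only [this, if_false]
      congr 1; omega
    · intro k l hk hl hkl
      by_cases h1 : k ≤ i <;> by_cases h2 : l ≤ i <;> simp only [h1, h2, if_true, if_false] at hkl
      all_goals
        have := inj _ _ (by omega) (by omega) hkl
        omega
    · intro k hk
      rcases Nat.lt_trichotomy k i with h | h | h
      · have h1 : k ≤ i := by omega
        have h2 : k + 1 ≤ i := by omega
        simp only [h1, h2, if_true]
        exact adj k hk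
      · subst h
        have h2 : ¬ k + 1 ≤ k := by omega
        have h3 : j + k + 1 - (k + 1) = j := by omega
        simp only [le_refl, h2, if_true, if_false, h3, hj]
        exact hw.symm
      · have h1 : ¬ k ≤ i := by omega
        have h2 : ¬ k + 1 ≤ i := by omega
        have h3 : j + i + 1 - k = (j + i + 1 - (k + 1)) + 1 := by omega
        simp only [h1, h2, if_false]
        rw [h3]
        exact (adj _ (by omega)).symm
    · ext x
      simp only [Finset.mem_image, Finset.mem_range]
      constructor
      · rintro ⟨k, hk, rfl⟩
        by_cases h1 : k ≤ i
        · exact ⟨k, hk, by simp [h1]⟩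
        · exact ⟨j + i + 1 - k, by omega, by simp [h1]⟩
      · rintro ⟨k, hk, rfl⟩
        by_cases h1 : k ≤ i
        · exact ⟨k, hk, by simp [h1]⟩
        · refine ⟨j + i + 1 - k, by omega, ?_⟩
          have h2 : ¬ j + i + 1 - k ≤ i := by omega
          have h3 : j + i + 1 - (j + i + 1 - k) = k := by omega
          simp only [h2, if_false, h3]

open Classical in
/-- Extension of paths. -/
theorem lds_extend {V : Type*} (G : SimpleGraph V) (u w : V) (j : ℕ)
    (P : Finset V) (a : ℕ → V) (h : LdsPath G u w j P a) (x : V) (hx : x ∉ P) (hw : G.Adj w x) :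
    ∃ a', LdsPath G u x (j + 1) (insert x P) a' := by
  obtain ⟨h0, hj, inj, adj, rfl⟩ := h
  have hx' : ∀ k, k ≤ j → a k ≠ x := by
    intro k hk h
    exact hx (Finset.mem_image.2 ⟨k, by simpa using by omega, h⟩)
  refine ⟨fun k => if k ≤ j then a k else x, ?_, ?_, ?_, ?_, ?_⟩
  · simpa using h0
  · simp
  · intro k l hk hl hkl
    by_cases h1 : k ≤ j <;> by_cases h2 : l ≤ j <;> simp only [h1, h2, if_true, if_false] at hkl
    · exact inj k l h1 h2 hkl
    · exact absurd hkl (hx' k h1)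
    · exact absurd hkl.symm (hx' l h2)
    · omega
  · intro k hk
    by_cases h : k < j
    · have h1 : k ≤ j := by omega
      have h2 : k + 1 ≤ j := by omega
      simp only [h1, h2, if_true]
      exact adj k h
    · have : k = j := by omega
      subst this
      have h2 : ¬ k + 1 ≤ k := by omega
      simp only [le_refl, h2, if_true, if_false, hj]
      exact hw
  · ext y
    simp only [Finset.mem_image, Finset.mem_range, Finset.mem_insert]
    constructor
    · rintro ⟨k, hk, rfl⟩
      by_cases h1 : k ≤ j
      · exact Or.inr ⟨k, by omega, by simp [h1]⟩
      · exact Or.inl (by simp [h1])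
    · rintro (rfl | ⟨k, hk, rfl⟩)
      · exact ⟨j + 1, by omega, by simp⟩
      · have h1 : k ≤ j := by omega
        exact ⟨k, by omega, by simp [h1]⟩

open Classical in
/-- Either a long path avoiding `T`, or a stuck one. -/
theorem lds_long_or_stuck {V : Type*} [Fintype V] (G : SimpleGraph V) (u : V) (T : Finset V)
    (hu : u ∉ T) (q : ℕ) :
    (∃ w P a, LdsPath G u w q P a ∧ Disjoint P T) ∨
    (∃ j w P a, j < q ∧ LdsPath G u w j P a ∧ Disjoint P T ∧
      ∀ e a', LdsPath G u e j P a' → ∀ x, G.Adj e x → x ∈ P ∪ T) := by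
  induction q with
  | zero =>
    left
    refine ⟨u, {u}, fun _ => u, ⟨rfl, rfl, ?_, ?_, ?_⟩, by simpa using hu⟩
    · intro i k hi hk _; omega
    · intro k hk; omega
    · simp
  | succ q ih =>
    rcases ih with ⟨w, P, a, h, hd⟩ | ⟨j, w, P, a, hj, h⟩
    · by_cases hs : ∀ e a', LdsPath G u e q P a' → ∀ x, G.Adj e x → x ∈ P ∪ T
      · exact Or.inr ⟨q, w, P, a, by omega, h, hd, hs⟩
      · push Not at hs
        obtain ⟨e, a', ha', x, hex, hx⟩ := hs
        rw [Finset.mem_union, not_or] at hx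
        obtain ⟨a'', ha''⟩ := lds_extend G u e q P a' ha' x hx.1 hex
        refine Or.inl ⟨x, _, a'', ha'', ?_⟩
        rw [Finset.disjoint_insert_left]
        exact ⟨hx.2, hd⟩
    · exact Or.inr ⟨j, w, P, a, by omega, h⟩

open Classical in
/-- The blue linked double star with two rich ends and inner centers among path ends. -/
theorem lds_special {V : Type*} [Fintype V] (G : SimpleGraph V) (n m p b : ℕ)
    (hp : 2 ≤ p) (w1 w2 : V) (E P T : Finset V) (hw : w1 ≠ w2) (h1T : w1 ∈ T) (h2T : w2 ∈ T)
    (hE : p - 1 ≤ E.card) (hEP : E ⊆ P) (hPT : Disjoint P T)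
    (hEn : ∀ e ∈ E, ∀ x, G.Adj e x → x ∈ P ∪ T)
    (hb1 : (Finset.univ.filter (fun x => G.Adj w1 x)).card ≤ b)
    (hb2 : (Finset.univ.filter (fun x => G.Adj w2 x)).card ≤ b)
    (hc1 : (P ∪ T).card + b + 2 ≤ Fintype.card V)
    (hc2 : (P ∪ T).card + p ≤ Fintype.card V)
    (hc3 : p + 1 + b + (n + m + p) ≤ Fintype.card V) :
    HasCopy (LinkedDoubleStar (2 * p + 1) n m) Gᶜ := by
  obtain ⟨H, hH⟩ : ∃ H : SimpleGraph V, H = Gᶜ := ⟨_, rfl⟩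
  rw [← hH]
  have hadj : ∀ x y, H.Adj x y ↔ x ≠ y ∧ ¬ G.Adj x y := by
    intro x y; rw [hH, SimpleGraph.compl_adj]
  obtain ⟨E', hEs, hE'⟩ := Finset.exists_subset_card_eq hE
  let e := E'.equivFinOfCardEq hE'
  let c : ℕ → V := fun i => if i = 0 then w1 else
    if h : i - 1 < p - 1 then e.symm ⟨i - 1, h⟩ else w2
  have c0 : c 0 = w1 := by simp [c]
  have cp : c p = w2 := by
    have : p ≠ 0 := by omega
    simp [c, this]
  have cm : ∀ i, 0 < i → i < p → c i ∈ E' := by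
    intro i h1 h2
    have h3 : i ≠ 0 := by omega
    have h4 : i - 1 < p - 1 := by omega
    simp only [c, h3, h4, if_false, dite_true]
    exact (e.symm _).2
  have cinj : ∀ i j, 0 < i → i < p → 0 < j → j < p → c i = c j → i = j := by
    intro i j h1 h2 h3 h4 h
    have h5 : i ≠ 0 := by omega
    have h6 : i - 1 < p - 1 := by omega
    have h7 : j ≠ 0 := by omega
    have h8 : j - 1 < p - 1 := by omega
    simp only [c, h5, h6, h7, h8, if_false, dite_true] at h
    have := e.symm.injective (Subtype.ext h)
    have := congrArg Fin.val this
    simp only at this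
    omega
  have hP1 : ∀ w ∈ T, w ∉ E' := fun w hw h =>
    (Finset.disjoint_left.1 hPT (hEP (hEs h))) hw
  let C : Finset V := insert w1 (insert w2 E')
  have hCS : C ⊆ P ∪ T := by
    intro x hx
    simp only [C, Finset.mem_insert] at hx
    rcases hx with rfl | rfl | hx
    · exact Finset.mem_union_right _ h1T
    · exact Finset.mem_union_right _ h2T
    · exact Finset.mem_union_left _ (hEP (hEs hx))
  have hCc : C.card ≤ p + 1 := by
    have := Finset.card_insert_le w1 (insert w2 E')
    have := Finset.card_insert_le w2 E'
    simp only [C]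
    omega
  have hcC : ∀ i, i ≤ p → c i ∈ C := by
    intro i hi
    simp only [C, Finset.mem_insert]
    rcases Nat.eq_zero_or_pos i with rfl | h
    · exact Or.inl c0
    rcases Nat.lt_or_ge i p with h' | h'
    · exact Or.inr (Or.inr (cm i h h'))
    · have : i = p := by omega
      subst this
      exact Or.inr (Or.inl cp)
  have hmid : ∀ i j, 0 < i → i < p → 0 < j → j < p → Fintype.card V ≤ (P ∪ T).card +
      (Finset.univ.filter (fun x => H.Adj (c i) x ∧ H.Adj (c j) x) \ C).card := by
    intro i j h1 h2 h3 h4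
    have hsub : (Finset.univ : Finset V) ⊆ (P ∪ T) ∪
        (Finset.univ.filter (fun x => H.Adj (c i) x ∧ H.Adj (c j) x) \ C) := by
      intro x _
      by_cases hx : x ∈ P ∪ T
      · exact Finset.mem_union_left _ hx
      apply Finset.mem_union_right
      simp only [Finset.mem_sdiff, Finset.mem_filter, Finset.mem_univ, true_and,
        hadj]
      refine ⟨⟨⟨?_, ?_⟩, ?_, ?_⟩, fun h => hx (hCS h)⟩
      · rintro rfl; exact hx (hCS (hcC i h2.le))
      · exact fun h => hx (hEn _ (hEs (cm i h1 h2)) x h)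
      · rintro rfl; exact hx (hCS (hcC j h4.le))
      · exact fun h => hx (hEn _ (hEs (cm j h3 h4)) x h)
    have := Finset.card_le_card hsub
    rw [Finset.card_univ] at this
    exact this.trans (Finset.card_union_le _ _)
  have hend : ∀ w ∈ C, (Finset.univ.filter (fun x => G.Adj w x)).card ≤ b → ∀ j, 0 < j → j < p →
      2 ≤ (Finset.univ.filter (fun x => H.Adj w x ∧ H.Adj (c j) x) \ C).card := by
    intro w hwC hwb j h3 h4
    have hsub : (Finset.univ : Finset V) ⊆ (P ∪ T) ∪ Finset.univ.filter (fun x => G.Adj w x) ∪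
        (Finset.univ.filter (fun x => H.Adj w x ∧ H.Adj (c j) x) \ C) := by
      intro x _
      by_cases hx : x ∈ P ∪ T
      · exact Finset.mem_union_left _ (Finset.mem_union_left _ hx)
      by_cases hxw : G.Adj w x
      · apply Finset.mem_union_left
        apply Finset.mem_union_right
        simpa using hxw
      apply Finset.mem_union_right
      simp only [Finset.mem_sdiff, Finset.mem_filter, Finset.mem_univ, true_and,
        hadj]
      refine ⟨⟨⟨?_, hxw⟩, ?_, ?_⟩, fun h => hx (hCS h)⟩
      · rintro rfl; exact hx (hCS hwC)
      · rintro rfl; exact hx (hCS (hcC j h4.le))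
      · exact fun h => hx (hEn _ (hEs (cm j h3 h4)) x h)
    have h5 := Finset.card_le_card hsub
    rw [Finset.card_univ] at h5
    have h6 := Finset.card_union_le ((P ∪ T) ∪ Finset.univ.filter (fun x => G.Adj w x))
        (Finset.univ.filter (fun x => H.Adj w x ∧ H.Adj (c j) x) \ C)
    have h7 := Finset.card_union_le (P ∪ T) (Finset.univ.filter (fun x => G.Adj w x))
    omega
  have hdeg : ∀ w ∈ C, (Finset.univ.filter (fun x => G.Adj w x)).card ≤ b →
      n + m + p ≤ (Finset.univ.filter (fun x => H.Adj w x) \ C).card := by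
    intro w hwC hwb
    have hsub : (Finset.univ : Finset V) ⊆ C ∪ Finset.univ.filter (fun x => G.Adj w x) ∪
        (Finset.univ.filter (fun x => H.Adj w x) \ C) := by
      intro x _
      by_cases hx : x ∈ C
      · exact Finset.mem_union_left _ (Finset.mem_union_left _ hx)
      have : w ≠ x := by rintro rfl; exact hx hwC
      simp only [Finset.mem_union, Finset.mem_sdiff, Finset.mem_filter, Finset.mem_univ, true_and,
        hadj]
      tauto
    have h5 := Finset.card_le_card hsub
    rw [Finset.card_univ] at h5
    have h6 := Finset.card_union_le (C ∪ Finset.univ.filter (fun x => G.Adj w x))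
        (Finset.univ.filter (fun x => H.Adj w x) \ C)
    have h7 := Finset.card_union_le C (Finset.univ.filter (fun x => G.Adj w x))
    omega
  have hw1C : w1 ∈ C := by simp [C]
  have hw2C : w2 ∈ C := by simp [C]
  refine lds_copy_of_chain H n m p c C (by omega) hcC ?_ ?_ ?_ ?_ ?_
  · have hlt : ∀ i j, i < j → j ≤ p → c i ≠ c j := by
      intro i j hij hj h
      rcases Nat.eq_zero_or_pos i with rfl | hi
      · rw [c0] at h
        rcases Nat.lt_or_ge j p with h' | h'
        · exact hP1 w1 h1T (h ▸ cm j hij h')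
        · have : j = p := by omega
          subst this
          exact hw (h.trans cp)
      · rcases Nat.lt_or_ge j p with h' | h'
        · have := cinj i j hi (by omega) (by omega) h' h
          omega
        · have : j = p := by omega
          subst this
          rw [cp] at h
          exact hP1 w2 h2T (h ▸ cm i hi hij)
    intro i j hi hj h
    rcases Nat.lt_trichotomy i j with h' | h' | h'
    · exact absurd h (hlt i j h' hj)
    · exact h'
    · exact absurd h.symm (hlt j i h' hi)
  · intro i hi
    rcases Nat.eq_zero_or_pos i with rfl | h
    · rw [c0]
      exact hend w1 hw1C hb1 _ (by omega) (by omega)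
    rcases Nat.lt_or_ge (i + 1) p with h' | h'
    · have := hmid i (i + 1) h hi (by omega) h'
      omega
    · have : i + 1 = p := by omega
      rw [this, cp]
      have := hend w2 hw2C hb2 i h hi
      simpa only [and_comm] using this
  · intro i h1 h2
    have := hmid i (i + 1) h1 (by omega) (by omega) h2
    omega
  · rw [c0]; exact hdeg w1 hw1C hb1
  · rw [cp]; exact hdeg w2 hw2C hb2

open Classical in
/-- Iteratively collect blue-rich vertices. -/
theorem lds_collect (n m p : ℕ) (hm : 2 ≤ m) (hp : 1 ≤ p)
    (hn : p + 3 ≤ n) {V : Type*} [Fintype V]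
    (hV : Fintype.card V = 2 * (n + m + p) - 1) (G : SimpleGraph V) (u : V)
    (hdu : n + m + 2 * p ≤ (Finset.univ.filter (fun x => G.Adj u x)).card)
    (hno : ¬ HasMonoLDS G (2 * p + 1) n m) (t : ℕ) (ht : t ≤ p + 1) :
    ∃ T L : Finset V, T.card = t ∧ u ∉ T ∧ L ⊆ T ∧ min t 2 ≤ L.card ∧
      (∀ w ∈ T, (Finset.univ.filter (fun x => G.Adj w x) \ T).card ≤ m - 1 + p) ∧
      (∀ w ∈ L, (Finset.univ.filter (fun x => G.Adj w x)).card ≤ m - 1 + p) := by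
  induction t with
  | zero => exact ⟨∅, ∅, by simp⟩
  | succ t ih =>
    obtain ⟨T, L, hTt, huT, hLT, hLc, hTr, hLr⟩ := ih (by omega)
    clear ih
    -- it suffices to find a new vertex
    suffices hz : ∃ z, z ∉ T ∧ z ≠ u ∧
        (Finset.univ.filter (fun x => G.Adj z x) \ T).card ≤ m - 1 + p ∧
        (2 ≤ t ∨ (Finset.univ.filter (fun x => G.Adj z x)).card ≤ m - 1 + p) by
      obtain ⟨z, hzT, hzu, hzr, hzL⟩ := hz
      have hT' : ∀ w ∈ insert z T,
          (Finset.univ.filter (fun x => G.Adj w x) \ insert z T).card ≤ m - 1 + p := by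
        intro w hw
        have h1 : (Finset.univ.filter (fun x => G.Adj w x) \ insert z T).card ≤
            (Finset.univ.filter (fun x => G.Adj w x) \ T).card :=
          Finset.card_le_card (Finset.sdiff_subset_sdiff (Finset.Subset.refl _)
            (Finset.subset_insert z T))
        rcases Finset.mem_insert.1 hw with rfl | hw
        · exact h1.trans hzr
        · exact h1.trans (hTr w hw)
      have hc : (insert z T).card = t + 1 := by rw [Finset.card_insert_of_notMem hzT, hTt]
      have hu' : u ∉ insert z T := by
        rw [Finset.mem_insert, not_or]; exact ⟨hzu.symm, huT⟩
      by_cases h2 : 2 ≤ t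
      · refine ⟨insert z T, L, hc, hu', hLT.trans (Finset.subset_insert z T), by omega, hT', hLr⟩
      · refine ⟨insert z T, insert z L, hc, hu', Finset.insert_subset_insert z hLT, ?_, hT', ?_⟩
        · rw [Finset.card_insert_of_notMem (fun h => hzT (hLT h))]
          omega
        · intro w hw
          rcases Finset.mem_insert.1 hw with rfl | hw
          · exact hzL.resolve_left h2
          · exact hLr w hw
    rcases lds_long_or_stuck G u T huT (2 * p) with
      ⟨w, P, a, hpath, hd⟩ | ⟨j, w, P, a, hj, hpath, hd, hstuck⟩
    · -- a long red path
      have hout : ∀ e a', LdsPath G u e (2 * p) P a' →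
          (Finset.univ.filter (fun x => G.Adj e x) \ P).card ≤ m - 1 := by
        rintro e a' ⟨h0, hj, inj, adj, hP⟩
        by_contra hcon
        apply hno
        left
        apply lds_copy_of_path G n m p a' inj adj
        · rw [h0, hP]
          have h1 : P.card ≤ 2 * p + 1 := by
            rw [← hP]; simpa using Finset.card_image_le (s := Finset.range (2 * p + 1)) (f := a')
          have huP : u ∈ P := by
            rw [← hP, ← h0]; exact Finset.mem_image_of_mem _ (by simp)
          have h2 : Finset.univ.filter (fun x => G.Adj u x) ⊆
              (Finset.univ.filter (fun x => G.Adj u x) \ P) ∪ P.erase u := by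
            intro x hx
            by_cases hxP : x ∈ P
            · apply Finset.mem_union_right
              refine Finset.mem_erase.2 ⟨?_, hxP⟩
              rintro rfl
              simp at hx
            · exact Finset.mem_union_left _ (Finset.mem_sdiff.2 ⟨hx, hxP⟩)
          have h3 := (Finset.card_le_card h2).trans (Finset.card_union_le _ _)
          rw [Finset.card_erase_of_mem huP] at h3
          omega
        · rw [hj, hP]; omega
      have hPc : P.card ≤ 2 * p + 1 := by
        rw [← hpath.2.2.2.2]
        simpa using Finset.card_image_le (s := Finset.range (2 * p + 1)) (f := a)
      obtain ⟨E, hEP, hEc, hE⟩ := lds_rotate G u w (2 * p) P a hpath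
      have hEp : E.card ≤ p := by
        by_contra hcon
        apply hno
        right
        refine lds_blue_of_set G n m p (m - 1) hp E P (by omega) hEP ?_ (by omega) (by omega)
        intro e he
        obtain ⟨a', ha'⟩ := hE e he
        exact hout e a' ha'
      have hwP : w ∈ P := by
        rw [← hpath.2.2.2.2, ← hpath.2.1]; exact Finset.mem_image_of_mem _ (by simp)
      have hwr : (Finset.univ.filter (fun x => G.Adj w x)).card ≤ m - 1 + p := by
        have h1 := Finset.card_sdiff_add_card_inter (Finset.univ.filter (fun x => G.Adj w x)) P
        have h2 := hout w a hpath
        omega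
      refine ⟨w, Finset.disjoint_left.1 hd hwP, ?_, ?_, Or.inr hwr⟩
      · intro h
        have := hpath.2.2.1 (2 * p) 0 (by omega) (by omega) (by rw [hpath.1, hpath.2.1, h])
        omega
      · exact (Finset.card_le_card Finset.sdiff_subset).trans hwr
    · -- a stuck red path
      have hPc : P.card ≤ 2 * p := by
        rw [← hpath.2.2.2.2]
        have := Finset.card_image_le (s := Finset.range (j + 1)) (f := a)
        rw [Finset.card_range] at this
        omega
      have hPT : (P ∪ T).card ≤ 2 * p + t := by
        have := Finset.card_union_le P T
        omega
      obtain ⟨E, hEP, hEc, hE⟩ := lds_rotate G u w j P a hpath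
      have hEn : ∀ e ∈ E, ∀ x, G.Adj e x → x ∈ P ∪ T := by
        intro e he x hx
        obtain ⟨a', ha'⟩ := hE e he
        exact hstuck e a' ha' x hx
      have hEp : E.card ≤ p := by
        by_contra hcon
        apply hno
        right
        by_cases h2 : 2 ≤ t
        · obtain ⟨w1, hw1, w2, hw2, hne⟩ := Finset.one_lt_card.1
            (show 1 < L.card by omega)
          exact lds_special G n m p (m - 1 + p) (by omega) w1 w2 E P T hne (hLT hw1) (hLT hw2)
            (by omega) hEP hd hEn (hLr _ hw1) (hLr _ hw2) (by omega) (by omega) (by omega)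
        · refine lds_blue_of_set G n m p 0 hp E (P ∪ T) (by omega)
            (hEP.trans Finset.subset_union_left) ?_ (by omega) (by omega)
          intro e he
          rw [Nat.le_zero, Finset.card_eq_zero, Finset.sdiff_eq_empty_iff_subset]
          intro x hx
          exact hEn e he x (by simpa using hx)
      have hwP : w ∈ P := by
        rw [← hpath.2.2.2.2, ← hpath.2.1]; exact Finset.mem_image_of_mem _ (by simp)
      have hsub : Finset.univ.filter (fun x => G.Adj w x) \ T ⊆
          Finset.univ.filter (fun x => G.Adj w x) ∩ P := by
        intro x hx
        rw [Finset.mem_sdiff] at hx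
        refine Finset.mem_inter.2 ⟨hx.1, ?_⟩
        have := hstuck w a hpath x (by simpa using hx.1)
        exact (Finset.mem_union.1 this).resolve_right hx.2
      have hwT := Finset.card_le_card hsub
      have hw2 := Finset.card_sdiff_add_card_inter (Finset.univ.filter (fun x => G.Adj w x)) T
      have hw3 := Finset.card_le_card (Finset.inter_subset_right
        (s₁ := Finset.univ.filter (fun x => G.Adj w x)) (s₂ := T))
      refine ⟨w, Finset.disjoint_left.1 hd hwP, ?_, by omega, by omega⟩
      rintro rfl
      omega

/-- a blue `(m+2p)`-star inside `R(u)`, where `u` has maximum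
monochromatic degree and `red-d(u) ≥ n + m + 2p`, forces a monochromatic
`S_c(n,m)`. -/
theorem lds_no_blue_star (n m p : ℕ) (hm : 2 ≤ m) (hmn : m ≤ n) (hp : 1 ≤ p)
    (hn : p + 3 ≤ n) {V : Type*} [Fintype V]
    (hV : Fintype.card V = 2 * (n + m + p) - 1) (G : SimpleGraph V) (u : V)
    (hmaxr : ∀ v : V, ({w | G.Adj v w}).ncard ≤ ({w | G.Adj u w}).ncard)
    (hmaxb : ∀ v : V, ({w | Gᶜ.Adj v w}).ncard ≤ ({w | G.Adj u w}).ncard)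
    (hdu : n + m + 2 * p ≤ ({w | G.Adj u w}).ncard)
    (v : V) (hv : G.Adj u v)
    (hstar : m + 2 * p ≤ ({w | Gᶜ.Adj v w} ∩ {w | G.Adj u w}).ncard) :
    HasMonoLDS G (2 * p + 1) n m := by
  classical
  by_contra hno
  have hdu' : n + m + 2 * p ≤ (Finset.univ.filter (fun x => G.Adj u x)).card := by
    have h : ({w | G.Adj u w} : Set V) = ↑(Finset.univ.filter (fun x => G.Adj u x)) := by
      ext x; simp
    rw [h, Set.ncard_coe_finset] at hdu
    exact hdu
  obtain ⟨T, L, hTt, -, -, -, hTr, -⟩ :=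
    lds_collect n m p hm hp hn hV G u hdu' hno (p + 1) le_rfl
  exact hno (Or.inr (lds_blue_of_set G n m p (m - 1 + p) hp T T hTt.ge (Finset.Subset.refl T)
    hTr (by omega) (by omega)))
end
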